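/- Let 2 < p ≤ (1+√17)/2 and 1 < γ₀ < p−1, and let B > 0. There exists a constant C > 0, depending only on p, γ₀ and B, such that for every smooth solution φ of the defocusing semilinear wave equation with E_{0,γ₀}[φ] ≤ B and E_{1,γ₀}[φ] < ∞, the function ψ defined below satisfies, at every point (t₀,x₀) ∈ D with t₀ ≥ 0: |ψ(t₀,x₀)| ≤ C (2 + t₀ + |x₀|)^{−α_p γ₀} (1 + | |x₀| − t₀ |)^{−γ₀/(p+1)} √(E_{1,γ₀}[φ]), where α_p = (3+(p−2)²)/((p+1)(5−p)). -/

import Mathlib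

open MeasureTheory Real
open scoped ENNReal InnerProductSpace

noncomputable section

/-- Three-dimensional Euclidean space. -/
abbrev E3 : Type := EuclideanSpace ℝ (Fin 3)

/-- Second derivative of `f` at `x` in the direction `v`. -/
def der2 (f : E3 → ℝ) (x v : E3) : ℝ := fderiv ℝ (fun y => fderiv ℝ f y v) x v

/-- The (spatial) Laplacian on `ℝ³`. -/
def lap3 (f : E3 → ℝ) (x : E3) : ℝ :=
  ∑ i : Fin 3, der2 f x (EuclideanSpace.single i 1)

/-- First time derivative `∂_t φ`. -/
def dt1 (φ : ℝ → E3 → ℝ) (t : ℝ) (x : E3) : ℝ := deriv (fun s => φ s x) t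

/-- Second time derivative `∂_t² φ`. -/
def dtt (φ : ℝ → E3 → ℝ) (t : ℝ) (x : E3) : ℝ := deriv (fun s => dt1 φ s x) t

/-- `φ` is a smooth solution of the defocusing semilinear wave equation
`∂_t²φ − Δφ + |φ|^{p−1}φ = 0` on `[0,∞) × ℝ³`. -/
def IsNLWSolution (p : ℝ) (φ : ℝ → E3 → ℝ) : Prop :=
  ContDiff ℝ (⊤ : ℕ∞) (fun q : ℝ × E3 => φ q.1 q.2) ∧
    ∀ t : ℝ, 0 ≤ t → ∀ x : E3,
      dtt φ t x - lap3 (φ t) x + |φ t x| ^ (p - 1) * φ t x = 0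

/-- The weighted initial energy `E_{k,γ₀}[φ]`. -/
def wEnergy (p : ℝ) (k : ℕ) (γ₀ : ℝ) (φ : ℝ → E3 → ℝ) : ℝ≥0∞ :=
  (∑ l ∈ Finset.range (k + 1),
    ∫⁻ x : E3, ENNReal.ofReal ((1 + ‖x‖) ^ (γ₀ + 2 * (l : ℝ)) *
      (‖iteratedFDeriv ℝ (l + 1) (φ 0) x‖ ^ 2 + ‖iteratedFDeriv ℝ l (dt1 φ 0) x‖ ^ 2))) +
  ∫⁻ x : E3, ENNReal.ofReal ((1 + ‖x‖) ^ γ₀ * |φ 0 x| ^ (p + 1))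

/-- `u₊ = √(1+((t−r)/2)²)`. -/
def uplus (t r : ℝ) : ℝ := Real.sqrt (1 + ((t - r) / 2) ^ 2)

/-- `v₊ = √(1+((t+r)/2)²)`. -/
def vplus (t r : ℝ) : ℝ := Real.sqrt (1 + ((t + r) / 2) ^ 2)

/-- Surface measure on the unit sphere `S² ⊂ ℝ³` (total mass `4π`). -/
def sphereMeasure : Measure (Metric.sphere (0 : E3) 1) := (volume : Measure E3).toSphere

/-- The region enclosed by the hyperboloid: `D = {(t,x) : (t+3)² − |x|² ≥ (6/5)(t+3)}`. -/
def Dset : Set (ℝ × E3) := {q | 6 / 5 * (q.1 + 3) ≤ (q.1 + 3) ^ 2 - ‖q.2‖ ^ 2}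

open Classical in
/-- The exterior source `F = −|φ|^{p−1}φ` for `t ≥ 0` outside `D`, and `0` otherwise. -/
def Fext (p : ℝ) (φ : ℝ → E3 → ℝ) (t : ℝ) (x : E3) : ℝ :=
  if 0 ≤ t ∧ (t, x) ∉ Dset then -(|φ t x| ^ (p - 1) * φ t x) else 0

/-- The evolution `ψ` given by the Kirchhoff–Duhamel formula with data `(φ(0), ∂_tφ(0))`
and source `Fext`, i.e. the evolution which is linear inside `D`. -/
def psiLin (p : ℝ) (φ : ℝ → E3 → ℝ) (t₀ : ℝ) (x₀ : E3) : ℝ :=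
  1 / (4 * Real.pi) *
    (deriv (fun s => s * ∫ ω : Metric.sphere (0 : E3) 1, φ 0 (x₀ + s • (ω : E3)) ∂sphereMeasure) t₀
      + t₀ * ∫ ω : Metric.sphere (0 : E3) 1, dt1 φ 0 (x₀ + t₀ • (ω : E3)) ∂sphereMeasure
      + ∫ r' in Set.Ioc (0 : ℝ) t₀,
          r' * ∫ ω : Metric.sphere (0 : E3) 1, Fext p φ (t₀ - r') (x₀ + r' • (ω : E3)) ∂sphereMeasure)

/-- Polar coordinates around `x₀` for lower Lebesgue integrals. -/
theorem lintegral_polar (x₀ : E3) {f : E3 → ℝ≥0∞} (hf : Measurable f) :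
    ∫⁻ x, f x = ∫⁻ s in Set.Ioi (0 : ℝ), ∫⁻ ω : Metric.sphere (0 : E3) 1,
      ENNReal.ofReal (s ^ 2) * f (x₀ + s • (ω : E3)) ∂sphereMeasure := by
  have h1 : ∫⁻ x, f x = ∫⁻ x, f (x₀ + x) := (lintegral_add_left_eq_self f x₀).symm
  have hmeas : Measurable fun x => f (x₀ + x) := hf.comp (measurable_const_add x₀)
  have h2 : ∫⁻ x, f (x₀ + x) = ∫⁻ x : ({(0 : E3)}ᶜ : Set E3), f (x₀ + x.1)
      ∂((volume : Measure E3).comap (↑)) := by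
    rw [lintegral_subtype_comap (measurableSet_singleton _).compl (fun x => f (x₀ + x)),
      restrict_compl_singleton]
  have h3 := (volume : Measure E3).measurePreserving_homeomorphUnitSphereProd.lintegral_comp_emb
    (Homeomorph.measurableEmbedding _)
    (fun q : Metric.sphere (0 : E3) 1 × Set.Ioi (0 : ℝ) => f (x₀ + q.2.1 • (q.1 : E3)))
  have h4 : ∀ x : ({(0 : E3)}ᶜ : Set E3),
      ((homeomorphUnitSphereProd E3 x).2.1 • ((homeomorphUnitSphereProd E3 x).1 : E3)) = x.1 := by
    intro x
    have hx : ‖x.1‖ ≠ 0 := norm_ne_zero_iff.2 x.2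
    simp [smul_smul, hx]
  simp only [h4] at h3
  have hm2 : Measurable fun q : Metric.sphere (0 : E3) 1 × Set.Ioi (0 : ℝ) =>
      f (x₀ + q.2.1 • (q.1 : E3)) := by
    apply hf.comp
    fun_prop
  rw [h1, h2, h3, lintegral_prod_symm _ hm2.aemeasurable]
  have h5 : Module.finrank ℝ E3 - 1 = 2 := by simp [E3]
  rw [h5, Measure.volumeIoiPow, lintegral_withDensity_eq_lintegral_mul _ (by fun_prop)
    hm2.lintegral_prod_left']
  rw [← lintegral_subtype_comap measurableSet_Ioi]
  refine lintegral_congr fun s => ?_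
  rw [lintegral_const_mul]
  · rfl
  · exact hm2.comp measurable_prodMk_right

theorem map_polar (x₀ : E3) :
    Measure.map (fun q : ℝ × Metric.sphere (0 : E3) 1 => x₀ + q.1 • (q.2 : E3))
      (((volume.restrict (Set.Ioi (0 : ℝ))).withDensity fun s => ENNReal.ofReal (s ^ 2)).prod
        sphereMeasure) = volume := by
  have : SFinite sphereMeasure := by unfold sphereMeasure; infer_instance
  have hm : Measurable fun q : ℝ × Metric.sphere (0 : E3) 1 => x₀ + q.1 • (q.2 : E3) := by fun_prop
  refine Measure.ext_of_lintegral _ fun f hf => ?_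
  rw [lintegral_map hf hm, lintegral_polar x₀ hf, lintegral_prod _ (by fun_prop),
    lintegral_withDensity_eq_lintegral_mul _ (by fun_prop)]
  · refine lintegral_congr fun s => ?_
    rw [lintegral_const_mul _ (by fun_prop)]
    rfl
  · have : Measurable fun q : ℝ × Metric.sphere (0 : E3) 1 => f (x₀ + q.1 • (q.2 : E3)) := hf.comp hm
    exact this.lintegral_prod_right'

instance : IsFiniteMeasure sphereMeasure := by unfold sphereMeasure; infer_instance

theorem sphereMeasure_real_univ_pos : 0 < sphereMeasure.real Set.univ := by
  unfold sphereMeasure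
  rw [Measure.toSphere_real_apply_univ]
  refine mul_pos (by simp [E3]) ?_
  exact ENNReal.toReal_pos (Metric.measure_ball_pos _ _ one_pos).ne' measure_ball_lt_top.ne

/-- Polar coordinates around `x₀` for Bochner integrals. -/
theorem integral_polar (x₀ : E3) {f : E3 → ℝ} (hf : Integrable f) :
    ∫ x, f x = ∫ s in Set.Ioi (0 : ℝ), s ^ 2 * ∫ ω : Metric.sphere (0 : E3) 1,
      f (x₀ + s • (ω : E3)) ∂sphereMeasure := by
  have hm : Measurable fun q : ℝ × Metric.sphere (0 : E3) 1 => x₀ + q.1 • (q.2 : E3) := by fun_prop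
  have hf' := hf
  rw [← map_polar x₀] at hf'
  conv_lhs => rw [← map_polar x₀]
  rw [integral_map hm.aemeasurable hf'.aestronglyMeasurable]
  have hi := (integrable_map_measure hf'.aestronglyMeasurable hm.aemeasurable).1 hf'
  have hprod := integral_prod _ hi
  simp only [Function.comp_apply] at hprod
  rw [hprod]
  rw [integral_withDensity_eq_integral_toReal_smul (by fun_prop) (by simp)]
  refine integral_congr_ae (Filter.Eventually.of_forall fun s => ?_)
  simp [ENNReal.toReal_ofReal, sq_nonneg]

open scoped Pointwise in
/-- A spherical cap of height `y` has area `O(y)`. -/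
theorem sphereMeasure_cap_le {e : E3} (he : ‖e‖ = 1) {y : ℝ} (hy : 0 ≤ y) :
    sphereMeasure {ω | 1 + ⟪(ω : E3), e⟫_ℝ ≤ y} ≤ ENNReal.ofReal (48 * y) := by
  obtain ⟨b, hb⟩ : ∃ b : OrthonormalBasis (Fin 3) ℝ E3, ∀ i ∈ ({0} : Set (Fin 3)),
      b i = (fun _ => e) i := by
    refine Orthonormal.exists_orthonormalBasis_extension_of_card_eq (by simp) ?_
    exact ⟨fun i => he, fun i j hij => (hij (Subsingleton.elim _ _)).elim⟩
  have hb0 : b 0 = e := hb 0 rfl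
  have hms : MeasurableSet {ω : Metric.sphere (0 : E3) 1 | 1 + ⟪(ω : E3), e⟫_ℝ ≤ y} :=
    measurableSet_le (by fun_prop) measurable_const
  unfold sphereMeasure
  rw [Measure.toSphere_apply' _ hms]
  set R := √(2 * y) with hR
  have hRsq : R ^ 2 = 2 * y := Real.sq_sqrt (by positivity)
  set a : Fin 3 → ℝ := ![1, R, R] with ha
  set S : Set (Fin 3 → ℝ) := Set.Icc (-a) a with hS
  have hvolS : volume S = ENNReal.ofReal (16 * y) := by
    rw [hS, Real.volume_Icc_pi]
    simp only [Fin.prod_univ_three, ha, Pi.neg_apply, Matrix.cons_val]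
    have : 0 ≤ R := Real.sqrt_nonneg _
    rw [← ENNReal.ofReal_mul (by norm_num), ← ENNReal.ofReal_mul (by norm_num; positivity)]
    congr 1
    nlinarith
  have hmp := (EuclideanSpace.volume_preserving_symm_measurableEquiv_toLp (Fin 3)).symm
  have hsub : (Set.Ioo (0 : ℝ) 1 • ((↑) '' {ω : Metric.sphere (0 : E3) 1 | 1 + ⟪(ω : E3), e⟫_ℝ ≤ y}))
      ⊆ b.repr ⁻¹' ((WithLp.ofLp : E3 → (Fin 3 → ℝ)) ⁻¹' S) := by
    rintro _ ⟨c, ⟨hc0, hc1⟩, _, ⟨ω, hω, rfl⟩, rfl⟩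
    have hω1 : ‖(ω : E3)‖ = 1 := by simp
    have hsum := b.sum_sq_norm_inner_right (ω : E3)
    rw [hω1, Fin.sum_univ_three, hb0] at hsum
    simp only [Real.norm_eq_abs, sq_abs] at hsum
    have hω' : 1 + ⟪(ω : E3), e⟫_ℝ ≤ y := hω
    rw [real_inner_comm] at hω'
    have h01 : ⟪e, (ω : E3)⟫_ℝ ≤ 1 := by nlinarith [sq_nonneg ⟪b 1, (ω : E3)⟫_ℝ, sq_nonneg ⟪b 2, (ω : E3)⟫_ℝ]
    have h02 : -1 ≤ ⟪e, (ω : E3)⟫_ℝ := by nlinarith [sq_nonneg ⟪b 1, (ω : E3)⟫_ℝ, sq_nonneg ⟪b 2, (ω : E3)⟫_ℝ]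
    have hperp : ⟪b 1, (ω : E3)⟫_ℝ ^ 2 + ⟪b 2, (ω : E3)⟫_ℝ ^ 2 ≤ R ^ 2 := by nlinarith
    have hR0 : 0 ≤ R := Real.sqrt_nonneg _
    have key : ∀ (u M : ℝ), 0 ≤ M → u ^ 2 ≤ M ^ 2 → -M ≤ c * u ∧ c * u ≤ M := by
      intro u M hM hu
      have := abs_le.1 (abs_le_of_sq_le_sq hu hM)
      constructor <;> nlinarith
    have k0 := key ⟪e, (ω : E3)⟫_ℝ 1 zero_le_one (by nlinarith)
    have k1 := key ⟪b 1, (ω : E3)⟫_ℝ R hR0 (by nlinarith [sq_nonneg ⟪b 2, (ω : E3)⟫_ℝ])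
    have k2 := key ⟪b 2, (ω : E3)⟫_ℝ R hR0 (by nlinarith [sq_nonneg ⟪b 1, (ω : E3)⟫_ℝ])
    simp only [Set.mem_preimage, hS, Set.mem_Icc, Pi.le_def, Fin.forall_fin_succ]
    simp [ha, b.repr_apply_apply, hb0, k0, k1, k2]
  have hvol : volume (b.repr ⁻¹' ((WithLp.ofLp : E3 → (Fin 3 → ℝ)) ⁻¹' S)) = ENNReal.ofReal (16 * y) := by
    rw [b.measurePreserving_repr.measure_preimage, ← hvolS]
    · exact (PiLp.volume_preserving_ofLp (Fin 3)).measure_preimage measurableSet_Icc.nullMeasurableSet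
    · exact ((WithLp.measurable_ofLp _ _) measurableSet_Icc).nullMeasurableSet
  have hdim : (Module.finrank ℝ E3 : ℝ≥0∞) = ENNReal.ofReal 3 := by simp
  calc _ ≤ (Module.finrank ℝ E3 : ℝ≥0∞) * ENNReal.ofReal (16 * y) := by
        gcongr; rw [← hvol]; exact measure_mono hsub
    _ = ENNReal.ofReal (48 * y) := by
        rw [hdim, ← ENNReal.ofReal_mul (by norm_num)]; congr 1; ring

theorem one_add_inner_mem {e : E3} (he : ‖e‖ = 1) (ω : Metric.sphere (0 : E3) 1) :
    0 ≤ 1 + ⟪(ω : E3), e⟫_ℝ ∧ 1 + ⟪(ω : E3), e⟫_ℝ ≤ 2 := by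
  have hω1 : ‖(ω : E3)‖ = 1 := by simp
  have h := abs_le.1 (abs_real_inner_le_norm (ω : E3) e)
  rw [hω1, he] at h
  constructor <;> linarith

/-- Integrals over the sphere of a decreasing function of the height. -/
theorem lintegral_sphere_antitone_le {e : E3} (he : ‖e‖ = 1) {g : ℝ → ℝ} (hg0 : ∀ y, 0 ≤ g y)
    (hgm : Measurable g) (hg : AntitoneOn g (Set.Ioc 0 2)) :
    ∫⁻ ω, ENNReal.ofReal (g (1 + ⟪(ω : E3), e⟫_ℝ)) ∂sphereMeasure
      ≤ 48 * ∫⁻ y in Set.Ioc (0 : ℝ) 2, ENNReal.ofReal (g y) := by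
  rw [lintegral_eq_lintegral_meas_lt _ (Filter.Eventually.of_forall fun ω => hg0 _)
      (by fun_prop : Measurable fun ω : Metric.sphere (0 : E3) 1 => g (1 + ⟪(ω : E3), e⟫_ℝ)).aemeasurable,
    lintegral_eq_lintegral_meas_lt _ (Filter.Eventually.of_forall fun ω => hg0 _) hgm.aemeasurable,
    ← lintegral_const_mul' _ _ (by norm_num)]
  refine lintegral_mono fun t => ?_
  set T : Set ℝ := {y | y ∈ Set.Ioc (0 : ℝ) 2 ∧ t < g y} with hT
  have hTbdd : BddAbove T := ⟨2, fun y hy => hy.1.2⟩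
  have hnull : sphereMeasure {ω | 1 + ⟪(ω : E3), e⟫_ℝ ≤ 0} = 0 := by
    have := sphereMeasure_cap_le he le_rfl
    simpa using this
  rcases T.eq_empty_or_nonempty with hTe | hTn
  · have : sphereMeasure {ω | t < g (1 + ⟪(ω : E3), e⟫_ℝ)} = 0 := by
      refine measure_mono_null (fun ω hω => ?_) hnull
      by_contra hcon
      have : 1 + ⟪(ω : E3), e⟫_ℝ ∈ T := ⟨⟨not_le.1 hcon, (one_add_inner_mem he ω).2⟩, hω⟩
      rw [hTe] at this
      exact this
    simp [this]
  · set c := sSup T with hc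
    obtain ⟨y₀, hy₀⟩ := hTn
    have hc0 : 0 < c := hy₀.1.1.trans_le (le_csSup hTbdd hy₀)
    have h1 : sphereMeasure {ω | t < g (1 + ⟪(ω : E3), e⟫_ℝ)} ≤ ENNReal.ofReal (48 * c) := by
      refine (measure_mono fun ω hω => ?_).trans (sphereMeasure_cap_le he hc0.le)
      rcases le_or_gt (1 + ⟪(ω : E3), e⟫_ℝ) 0 with h | h
      · exact h.trans hc0.le
      · exact le_csSup hTbdd ⟨⟨h, (one_add_inner_mem he ω).2⟩, hω⟩
    have h2 : ENNReal.ofReal c ≤ (volume.restrict (Set.Ioc (0 : ℝ) 2)) {y | t < g y} := by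
      rw [Measure.restrict_apply (measurableSet_lt measurable_const hgm)]
      have : Set.Ioo 0 c ⊆ {y | t < g y} ∩ Set.Ioc (0 : ℝ) 2 := by
        rintro y ⟨hy0, hyc⟩
        obtain ⟨z, hz, hyz⟩ := exists_lt_of_lt_csSup ⟨y₀, hy₀⟩ hyc
        have hy2 : y ∈ Set.Ioc (0 : ℝ) 2 := ⟨hy0, hyz.le.trans hz.1.2⟩
        exact ⟨hz.2.trans_le (hg hy2 hz.1 hyz.le), hy2⟩
      simpa using measure_mono (μ := volume) this
    calc _ ≤ ENNReal.ofReal (48 * c) := h1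
      _ = 48 * ENNReal.ofReal c := by rw [ENNReal.ofReal_mul (by norm_num)]; simp
      _ ≤ _ := by gcongr

section Parametric

variable {α : Type*} [TopologicalSpace α] [CompactSpace α] [SecondCountableTopology α]
  [MeasurableSpace α] [OpensMeasurableSpace α] {μ : Measure α} [IsFiniteMeasure μ]

theorem continuous_integral_of_compactSpace {X E : Type*} [TopologicalSpace X]
    [FirstCountableTopology X] [LocallyCompactSpace X] [NormedAddCommGroup E] [NormedSpace ℝ E]
    {F : X → α → E} (hF : Continuous F.uncurry) : Continuous fun x => ∫ a, F x a ∂μ := by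
  have := continuous_parametric_integral_of_continuous (μ := μ) hF isCompact_univ
  simpa using this

theorem continuous_integrable_of_compactSpace {E : Type*} [NormedAddCommGroup E]
    {f : α → E} (hf : Continuous f) : Integrable f μ := by
  rcases (isCompact_univ (X := α)).bddAbove_image hf.norm.continuousOn with ⟨M, hM⟩
  exact Integrable.of_bound hf.aestronglyMeasurable M
    (Filter.Eventually.of_forall fun a => hM (Set.mem_image_of_mem _ (Set.mem_univ a)))

/-- Differentiation under the integral sign over a compact space. -/
theorem hasFDerivAt_integral_of_compactSpace {X : Type*} [NormedAddCommGroup X]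
    [NormedSpace ℝ X] [LocallyCompactSpace X] {F : X → α → ℝ} {F' : X → α → X →L[ℝ] ℝ}
    (hF : Continuous F.uncurry) (hF' : Continuous F'.uncurry)
    (h : ∀ x a, HasFDerivAt (fun x => F x a) (F' x a) x) (x₀ : X) :
    HasFDerivAt (fun x => ∫ a, F x a ∂μ) (∫ a, F' x₀ a ∂μ) x₀ := by
  rcases exists_compact_mem_nhds x₀ with ⟨U, hUc, hU⟩
  rcases (hUc.prod isCompact_univ).bddAbove_image hF'.norm.continuousOn with ⟨M, hM⟩
  have hc : ∀ x, Continuous (F x) := fun x => hF.comp (Continuous.prodMk_right x)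
  have hc' : Continuous (F' x₀) := hF'.comp (Continuous.prodMk_right x₀)
  have hb : ∀ a, ∀ x ∈ U, ‖F' x a‖ ≤ M := by
    intro a x hx
    have := hM (Set.mem_image_of_mem (fun q : X × α => ‖F'.uncurry q‖)
      (Set.mk_mem_prod hx (Set.mem_univ a)))
    exact this
  have hb' : ∀ᵐ a ∂μ, ∀ x ∈ U, ‖F' x a‖ ≤ M := Filter.Eventually.of_forall hb
  have hm : ∀ x, AEStronglyMeasurable (F x) μ := fun x => (hc x).aestronglyMeasurable
  have hd : ∀ᵐ a ∂μ, ∀ x ∈ U, HasFDerivAt (F · a) (F' x a) x :=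
    Filter.Eventually.of_forall fun a x _ => h x a
  exact hasFDerivAt_integral_of_dominated_of_fderiv_le (bound := fun _ => M) hU
    (Filter.Eventually.of_forall hm) (continuous_integrable_of_compactSpace (hc x₀))
    hc'.aestronglyMeasurable hb' (integrable_const _) hd

theorem hasDerivAt_integral_of_compactSpace {F F' : ℝ → α → ℝ}
    (hF : Continuous F.uncurry) (hF' : Continuous F'.uncurry)
    (h : ∀ x a, HasDerivAt (fun x => F x a) (F' x a) x) (x₀ : ℝ) :
    HasDerivAt (fun x => ∫ a, F x a ∂μ) (∫ a, F' x₀ a ∂μ) x₀ := by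
  rcases exists_compact_mem_nhds x₀ with ⟨U, hUc, hU⟩
  rcases (hUc.prod isCompact_univ).bddAbove_image hF'.norm.continuousOn with ⟨M, hM⟩
  have hc : ∀ x, Continuous (F x) := fun x => hF.comp (Continuous.prodMk_right x)
  have hc' : Continuous (F' x₀) := hF'.comp (Continuous.prodMk_right x₀)
  have hb : ∀ a, ∀ x ∈ U, ‖F' x a‖ ≤ M := fun a x hx =>
    hM (Set.mem_image_of_mem (fun q : ℝ × α => ‖F'.uncurry q‖)
      (Set.mk_mem_prod hx (Set.mem_univ a)))
  have hb' : ∀ᵐ a ∂μ, ∀ x ∈ U, ‖F' x a‖ ≤ M := Filter.Eventually.of_forall hb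
  have hm : ∀ x, AEStronglyMeasurable (F x) μ := fun x => (hc x).aestronglyMeasurable
  have hd : ∀ᵐ a ∂μ, ∀ x ∈ U, HasDerivAt (F · a) (F' x a) x :=
    Filter.Eventually.of_forall fun a x _ => h x a
  exact (hasDerivAt_integral_of_dominated_loc_of_deriv_le (bound := fun _ => M) hU
    (Filter.Eventually.of_forall hm) (continuous_integrable_of_compactSpace (hc x₀))
    hc'.aestronglyMeasurable hb' (integrable_const _) hd).2

end Parametric

theorem hasFDerivAt_norm_E3 {y : E3} (hy : y ≠ 0) :
    HasFDerivAt (fun x : E3 => ‖x‖) (‖y‖⁻¹ • innerSL ℝ y) y := by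
  have h0 : ‖y‖ ^ 2 ≠ 0 := pow_ne_zero 2 (norm_ne_zero_iff.2 hy)
  have h := ((hasStrictFDerivAt_norm_sq (F := E3) y).hasFDerivAt).sqrt h0
  have he : (fun x : E3 => √(‖x‖ ^ 2)) = fun x => ‖x‖ := by
    ext x; exact Real.sqrt_sq (norm_nonneg x)
  simp only [he] at h
  refine h.congr_fderiv ?_
  rw [Real.sqrt_sq (norm_nonneg y)]
  ext v
  simp
  field_simp

theorem lipschitzWith_coneTent (R : ℝ) : LipschitzWith 1 fun y : E3 => max (R - ‖y‖) 0 := by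
  refine LipschitzWith.max_const ?_ 0
  refine LipschitzWith.of_dist_le_mul fun x y => ?_
  rw [Real.dist_eq, show R - ‖x‖ - (R - ‖y‖) = -(‖x‖ - ‖y‖) by ring, abs_neg, dist_eq_norm]
  simpa using abs_norm_sub_norm_le x y

theorem hasCompactSupport_coneTent (R : ℝ) : HasCompactSupport fun y : E3 => max (R - ‖y‖) 0 := by
  refine HasCompactSupport.intro (isCompact_closedBall (0 : E3) R) fun y hy => ?_
  have : R < ‖y‖ := by simpa using hy
  exact max_eq_right (by linarith)

theorem lineDeriv_coneTent {R : ℝ} {y : E3} (hy : y ≠ 0) (hR : ‖y‖ ≠ R) (v : E3) :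
    lineDeriv ℝ (fun y : E3 => max (R - ‖y‖) 0) y (-v)
      = if ‖y‖ < R then ⟪y, v⟫_ℝ / ‖y‖ else 0 := by
  have h1 : HasFDerivAt (fun y : E3 => R - ‖y‖) (-(‖y‖⁻¹ • innerSL ℝ y)) y := by
    simpa using (hasFDerivAt_norm_E3 hy).const_sub R
  split_ifs with h
  · have h2 : HasFDerivAt (fun y : E3 => max (R - ‖y‖) 0) (-(‖y‖⁻¹ • innerSL ℝ y)) y := by
      refine h1.congr_of_eventuallyEq ?_
      filter_upwards [(continuous_norm.tendsto y).eventually_lt_const h] with z hz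
      exact max_eq_left (by linarith)
    rw [h2.differentiableAt.lineDeriv_eq_fderiv, h2.fderiv]
    simp
    ring
  · have h2 : HasFDerivAt (fun y : E3 => max (R - ‖y‖) 0) (0 : E3 →L[ℝ] ℝ) y := by
      refine (hasFDerivAt_const (0 : ℝ) y).congr_of_eventuallyEq ?_
      filter_upwards [(continuous_norm.tendsto y).eventually_const_lt
        (lt_of_le_of_ne (not_lt.1 h) hR.symm)] with z hz
      exact max_eq_right (by linarith)
    rw [h2.differentiableAt.lineDeriv_eq_fderiv, h2.fderiv]
    simp

theorem contDiff_fderiv_apply_const {u : E3 → ℝ} {n : WithTop ℕ∞} (hu : ContDiff ℝ (n + 1) u) (v : E3) :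
    ContDiff ℝ n fun y => fderiv ℝ u y v :=
  (hu.fderiv_right le_rfl).clm_apply contDiff_const

theorem clm_apply_eq_sum (L : E3 →L[ℝ] ℝ) (y : E3) :
    L y = ∑ i, ⟪y, EuclideanSpace.single i (1 : ℝ)⟫_ℝ * L (EuclideanSpace.single i 1) := by
  conv_lhs => rw [← (EuclideanSpace.basisFun (Fin 3) ℝ).sum_repr y]
  simp [EuclideanSpace.inner_single_right]

theorem integral_coneTent_mul_lap3 {u : E3 → ℝ} (hu : ContDiff ℝ 2 u) (hc : HasCompactSupport u)
    (R : ℝ) :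
    ∫ y, lap3 u y * max (R - ‖y‖) 0
      = ∫ y, if ‖y‖ < R then fderiv ℝ u y (‖y‖⁻¹ • y) else 0 := by
  have hf : ∀ v, ContDiff ℝ 1 fun y => fderiv ℝ u y v := fun v =>
    contDiff_fderiv_apply_const (by norm_num; exact hu) v
  have hfc : ∀ v, HasCompactSupport fun y => fderiv ℝ u y v := fun v => hc.fderiv_apply ℝ v
  have hfd : ∀ v, Continuous fun y => der2 u y v := fun v =>
    (((hf v).continuous_fderiv one_ne_zero).clm_apply continuous_const)
  have hg := lipschitzWith_coneTent R
  have hgc := hasCompactSupport_coneTent R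
  have key : ∀ v : E3, ∫ y, der2 u y v * max (R - ‖y‖) 0
      = ∫ y, if ‖y‖ < R then ⟪y, v⟫_ℝ / ‖y‖ * fderiv ℝ u y v else 0 := by
    intro v
    obtain ⟨D, hD⟩ := (hf v).lipschitzWith_of_hasCompactSupport (hfc v) one_ne_zero
    have h := hD.integral_lineDeriv_mul_eq (μ := volume) hg hgc v
    have h1 : ∀ y, lineDeriv ℝ (fun y => fderiv ℝ u y v) y v = der2 u y v := fun y =>
      ((hf v).differentiable one_ne_zero).differentiableAt.lineDeriv_eq_fderiv
    simp only [h1] at h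
    rw [h]
    have hn1 : ∀ᵐ y : E3, y ≠ 0 := by simp [ae_iff]
    have hn2 : ∀ᵐ y : E3, ‖y‖ ≠ R := by
      have := Measure.addHaar_sphere (volume : Measure E3) 0 R
      simpa [ae_iff, Metric.sphere] using this
    refine integral_congr_ae ?_
    filter_upwards [hn1, hn2] with y h1 h2
    rw [lineDeriv_coneTent h1 h2]
    split_ifs <;> ring
  have hint : ∀ v, Integrable fun y => der2 u y v * max (R - ‖y‖) 0 := fun v =>
    ((hfd v).mul hg.continuous).integrable_of_hasCompactSupport hgc.mul_left
  have hint2 : ∀ v, Integrable fun y => if ‖y‖ < R then ⟪y, v⟫_ℝ / ‖y‖ * fderiv ℝ u y v else 0 := by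
    intro v
    have hi : Integrable fun y => ‖v‖ * ‖fderiv ℝ u y v‖ :=
      (((hf v).continuous.norm).integrable_of_hasCompactSupport (hfc v).norm).const_mul _
    refine hi.mono' ?_ (Filter.Eventually.of_forall fun y => ?_)
    · refine Measurable.aestronglyMeasurable ?_
      refine Measurable.ite (measurableSet_lt measurable_norm measurable_const) ?_ measurable_const
      exact ((measurable_id.inner measurable_const).div measurable_norm).mul
        (hf v).continuous.measurable
    · split_ifs
      · rw [norm_mul, norm_div, norm_norm]
        gcongr
        refine div_le_of_le_mul₀ (norm_nonneg _) (norm_nonneg _) ?_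
        rw [mul_comm]
        exact norm_inner_le_norm y v
      · simp; positivity
  unfold lap3
  simp_rw [Finset.sum_mul]
  rw [integral_finsetSum _ (fun i _ => hint _)]
  simp_rw [key]
  rw [← integral_finsetSum _ (fun i _ => hint2 _)]
  refine integral_congr_ae (Filter.Eventually.of_forall fun y => ?_)
  dsimp only
  split_ifs
  · rw [map_smul, clm_apply_eq_sum _ y, smul_eq_mul, Finset.mul_sum]
    exact Finset.sum_congr rfl fun i _ => by ring
  · simp

theorem integrable_radialDeriv {u : E3 → ℝ} (hu : ContDiff ℝ 1 u) (hc : HasCompactSupport u)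
    (R : ℝ) : Integrable fun y => if ‖y‖ < R then fderiv ℝ u y (‖y‖⁻¹ • y) else 0 := by
  have hcont := hu.continuous_fderiv one_ne_zero
  have hi : Integrable fun y => ‖fderiv ℝ u y‖ :=
    hcont.norm.integrable_of_hasCompactSupport (hc.fderiv ℝ).norm
  have hm : AEStronglyMeasurable (fun y : E3 => fderiv ℝ u y (‖y‖⁻¹ • y)) :=
    (ContinuousLinearMap.id ℝ (E3 →L[ℝ] ℝ)).aestronglyMeasurable_comp₂ hcont.aestronglyMeasurable
      (by fun_prop)
  have hm2 := hm.indicator (measurableSet_lt (measurable_norm (α := E3)) (measurable_const (a := R)))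
  refine hi.mono' (hm2.congr (Filter.Eventually.of_forall fun y => ?_))
    (Filter.Eventually.of_forall fun y => ?_)
  · simp [Set.indicator]
  · split_ifs
    · refine (ContinuousLinearMap.le_opNorm _ _).trans ?_
      refine mul_le_of_le_one_right (norm_nonneg _) ?_
      rw [norm_smul, norm_inv, norm_norm]
      exact inv_mul_le_one
    · simp

theorem norm_sphere_smul {s : ℝ} (hs : 0 ≤ s) (ω : Metric.sphere (0 : E3) 1) :
    ‖s • (ω : E3)‖ = s := by
  rw [norm_smul, Real.norm_of_nonneg hs]; simp

theorem intervalIntegral_sphere_lap3 {u : E3 → ℝ} (hu : ContDiff ℝ 2 u) (hc : HasCompactSupport u)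
    {R : ℝ} (hR : 0 < R) :
    ∫ s in (0 : ℝ)..R, (R - s) * (s ^ 2 * ∫ ω : Metric.sphere (0 : E3) 1,
        lap3 u (s • (ω : E3)) ∂sphereMeasure)
      = ∫ s in (0 : ℝ)..R, s ^ 2 * ∫ ω : Metric.sphere (0 : E3) 1,
        fderiv ℝ u (s • (ω : E3)) (ω : E3) ∂sphereMeasure := by
  have h := integral_coneTent_mul_lap3 hu hc R
  have hlap : Continuous (lap3 u) := by
    unfold lap3 der2
    refine continuous_finsetSum _ fun i _ => ?_
    exact ((contDiff_fderiv_apply_const (n := 1) (by norm_num; exact hu) _).continuous_fderiv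
      one_ne_zero).clm_apply continuous_const
  rw [integral_polar 0, integral_polar 0] at h
  · rw [intervalIntegral.integral_of_le hR.le, intervalIntegral.integral_of_le hR.le]
    have e : ∀ F : ℝ → ℝ, (∀ s, R < s → F s = 0) →
        ∫ s in Set.Ioi (0 : ℝ), F s = ∫ s in Set.Ioc (0 : ℝ) R, F s := by
      intro F hF
      refine (setIntegral_eq_of_subset_of_forall_sdiff_eq_zero measurableSet_Ioi
        (fun s hs => hs.1) fun s hs => hF s ?_)
      by_contra hcon
      exact hs.2 ⟨hs.1, not_lt.1 hcon⟩
    rw [e, e] at h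
    · calc _ = _ := ?_
        _ = _ := h
        _ = _ := ?_
      · refine setIntegral_congr_fun measurableSet_Ioc fun s hs => ?_
        rw [mul_left_comm, ← integral_const_mul]
        congr 2
        ext ω
        rw [zero_add, norm_sphere_smul hs.1.le, max_eq_left (by linarith [hs.2]), mul_comm]
      · rw [integral_Ioc_eq_integral_Ioo, integral_Ioc_eq_integral_Ioo]
        refine setIntegral_congr_fun measurableSet_Ioo fun s hs => ?_
        congr 2
        ext ω
        rw [zero_add, norm_sphere_smul hs.1.le, if_pos hs.2, smul_smul,
          inv_mul_cancel₀ hs.1.ne', one_smul]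
    · intro s hs
      have : ∀ ω : Metric.sphere (0 : E3) 1,
          ¬ ‖(0 : E3) + s • (ω : E3)‖ < R := fun ω => by
        rw [zero_add, norm_sphere_smul (hR.trans hs).le]; linarith
      simp only [this, if_false, integral_zero, mul_zero]
    · intro s hs
      have : ∀ ω : Metric.sphere (0 : E3) 1,
          max (R - ‖(0 : E3) + s • (ω : E3)‖) 0 = 0 := fun ω => by
        rw [zero_add, norm_sphere_smul (hR.trans hs).le]; exact max_eq_right (by linarith)
      simp only [this, integral_zero, mul_zero]
  · exact integrable_radialDeriv (hu.of_le (by norm_num)) hc R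
  · exact (hlap.mul (lipschitzWith_coneTent R).continuous).integrable_of_hasCompactSupport
      (hasCompactSupport_coneTent R).mul_left


theorem continuous_lap3 {u : E3 → ℝ} (hu : ContDiff ℝ 2 u) : Continuous (lap3 u) := by
  unfold lap3 der2
  refine continuous_finsetSum _ fun i _ => ?_
  exact ((contDiff_fderiv_apply_const (n := 1) (by norm_num; exact hu) _).continuous_fderiv
    one_ne_zero).clm_apply continuous_const

theorem contDiff_fderiv_one {X : Type*} [NormedAddCommGroup X] [NormedSpace ℝ X] {u : X → ℝ} (hu : ContDiff ℝ 2 u) : ContDiff ℝ 1 (fderiv ℝ u) :=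
  hu.fderiv_right (by norm_num)

theorem hasFDerivAt_fderiv_apply {X : Type*} [NormedAddCommGroup X] [NormedSpace ℝ X]
    {u : X → ℝ} (hu : ContDiff ℝ 2 u) (y v : X) :
    HasFDerivAt (fun y => fderiv ℝ u y v) ((fderiv ℝ (fderiv ℝ u) y).flip v) y := by
  have hd : HasFDerivAt (fderiv ℝ u) (fderiv ℝ (fderiv ℝ u) y) y :=
    ((contDiff_fderiv_one hu).differentiable one_ne_zero y).hasFDerivAt
  exact (ContinuousLinearMap.apply ℝ ℝ v).hasFDerivAt.comp y hd

theorem der2_eq {u : E3 → ℝ} (hu : ContDiff ℝ 2 u) (y v : E3) :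
    der2 u y v = fderiv ℝ (fderiv ℝ u) y v v := by
  unfold der2
  rw [(hasFDerivAt_fderiv_apply hu y v).fderiv]
  rfl

theorem hasDerivAt_sphere_radial {u : E3 → ℝ} (hu : ContDiff ℝ 2 u) (s : ℝ) :
    HasDerivAt (fun s : ℝ => ∫ ω : Metric.sphere (0 : E3) 1,
        fderiv ℝ u (s • (ω : E3)) (ω : E3) ∂sphereMeasure)
      (∫ ω : Metric.sphere (0 : E3) 1,
        fderiv ℝ (fderiv ℝ u) (s • (ω : E3)) (ω : E3) (ω : E3) ∂sphereMeasure) s := by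
  have h1 := contDiff_fderiv_one hu
  have h2 := h1.continuous_fderiv one_ne_zero
  have h3 := h1.continuous
  refine hasDerivAt_integral_of_compactSpace
    (F := fun s (ω : Metric.sphere (0 : E3) 1) => fderiv ℝ u (s • (ω : E3)) (ω : E3))
    (F' := fun s (ω : Metric.sphere (0 : E3) 1) =>
      fderiv ℝ (fderiv ℝ u) (s • (ω : E3)) (ω : E3) (ω : E3)) ?_ ?_ ?_ s
  · simp only [Function.uncurry_def]
    fun_prop
  · simp only [Function.uncurry_def]
    exact ((h2.comp (by fun_prop)).clm_apply (by fun_prop)).clm_apply (by fun_prop)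
  · intro s ω
    have hl : HasDerivAt (fun s : ℝ => s • (ω : E3)) (ω : E3) s := by
      simpa using (hasDerivAt_id s).smul_const (ω : E3)
    exact (hasFDerivAt_fderiv_apply hu (s • (ω : E3)) (ω : E3)).comp_hasDerivAt s hl

theorem sphere_identity_of_hasCompactSupport {u : E3 → ℝ} (hu : ContDiff ℝ 2 u)
    (hc : HasCompactSupport u) {s : ℝ} (hs : 0 < s) :
    s * (∫ ω : Metric.sphere (0 : E3) 1, lap3 u (s • (ω : E3)) ∂sphereMeasure)
      = 2 * (∫ ω : Metric.sphere (0 : E3) 1, fderiv ℝ u (s • (ω : E3)) (ω : E3) ∂sphereMeasure)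
        + s * ∫ ω : Metric.sphere (0 : E3) 1,
          fderiv ℝ (fderiv ℝ u) (s • (ω : E3)) (ω : E3) (ω : E3) ∂sphereMeasure := by
  set m : ℝ → ℝ := fun s => ∫ ω : Metric.sphere (0 : E3) 1, lap3 u (s • (ω : E3)) ∂sphereMeasure
    with hm
  set q : ℝ → ℝ := fun s => ∫ ω : Metric.sphere (0 : E3) 1,
    fderiv ℝ u (s • (ω : E3)) (ω : E3) ∂sphereMeasure with hq
  set q' : ℝ → ℝ := fun s => ∫ ω : Metric.sphere (0 : E3) 1,
    fderiv ℝ (fderiv ℝ u) (s • (ω : E3)) (ω : E3) (ω : E3) ∂sphereMeasure with hq'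
  have hqd : ∀ s, HasDerivAt q (q' s) s := hasDerivAt_sphere_radial hu
  have hqc : Continuous q := continuous_iff_continuousAt.2 fun s => (hqd s).continuousAt
  have hmc : Continuous m := by
    refine continuous_integral_of_compactSpace
      (F := fun s (ω : Metric.sphere (0 : E3) 1) => lap3 u (s • (ω : E3))) ?_
    exact (continuous_lap3 hu).comp (by fun_prop)
  have hk1 : Continuous fun s => s ^ 2 * m s := by fun_prop
  have hk1' : Continuous fun s => s * (s ^ 2 * m s) := by fun_prop
  have hk2 : Continuous fun s => s ^ 2 * q s := by fun_prop
  have hI : ∀ R, 0 < R → R * (∫ s in (0 : ℝ)..R, s ^ 2 * m s)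
      - ∫ s in (0 : ℝ)..R, s * (s ^ 2 * m s) = ∫ s in (0 : ℝ)..R, s ^ 2 * q s := by
    intro R hR
    rw [← intervalIntegral_sphere_lap3 hu hc hR, ← intervalIntegral.integral_const_mul,
      ← intervalIntegral.integral_sub]
    · refine intervalIntegral.integral_congr fun s _ => ?_
      ring
    · exact (continuous_const.mul hk1).intervalIntegrable _ _
    · exact hk1'.intervalIntegrable _ _
  have hA : ∀ R, 0 < R → ∫ s in (0 : ℝ)..R, s ^ 2 * m s = R ^ 2 * q R := by
    intro R hR
    have d1 := (hasDerivAt_id R).mul (hk1.integral_hasStrictDerivAt 0 R).hasDerivAt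
    have d2 := d1.sub (hk1'.integral_hasStrictDerivAt 0 R).hasDerivAt
    have d3 := (hk2.integral_hasStrictDerivAt 0 R).hasDerivAt
    have d4 := d3.congr_of_eventuallyEq (f₁ := fun R => R * (∫ s in (0 : ℝ)..R, s ^ 2 * m s)
      - ∫ s in (0 : ℝ)..R, s * (s ^ 2 * m s)) (by
        filter_upwards [lt_mem_nhds hR] with R' hR'
        exact hI R' hR')
    have := d2.unique d4
    simp only [id] at this
    linarith
  have e1 := (hk1.integral_hasStrictDerivAt 0 s).hasDerivAt
  have e2 := ((hasDerivAt_pow 2 s).mul (hqd s)).congr_of_eventuallyEq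
    (f₁ := fun R => ∫ s in (0 : ℝ)..R, s ^ 2 * m s) (by
        filter_upwards [lt_mem_nhds hs] with R' hR'
        exact hA R' hR')
  have e3 := e1.unique e2
  refine mul_left_cancel₀ hs.ne' ?_
  simp at e3
  linarith

theorem sphere_identity {u : E3 → ℝ} (hu : ContDiff ℝ 2 u) (x₀ : E3) {s : ℝ} (hs : 0 < s) :
    s * (∫ ω : Metric.sphere (0 : E3) 1, lap3 u (x₀ + s • (ω : E3)) ∂sphereMeasure)
      = 2 * (∫ ω : Metric.sphere (0 : E3) 1,
          fderiv ℝ u (x₀ + s • (ω : E3)) (ω : E3) ∂sphereMeasure)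
        + s * ∫ ω : Metric.sphere (0 : E3) 1,
          fderiv ℝ (fderiv ℝ u) (x₀ + s • (ω : E3)) (ω : E3) (ω : E3) ∂sphereMeasure := by
  let χ : ContDiffBump (0 : E3) := ⟨s + 1, s + 2, by linarith, by linarith⟩
  set w : E3 → ℝ := fun y => u (x₀ + y) with hw
  have hwd : ContDiff ℝ 2 w := hu.comp (contDiff_const.add contDiff_id)
  set v : E3 → ℝ := fun y => χ y * w y with hv
  have hvd : ContDiff ℝ 2 v := χ.contDiff.mul hwd
  have hvc : HasCompactSupport v := χ.hasCompactSupport.mul_right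
  have heq : ∀ ω : Metric.sphere (0 : E3) 1, v =ᶠ[nhds (s • (ω : E3))] w := by
    intro ω
    have : Metric.ball (0 : E3) (s + 1) ∈ nhds (s • (ω : E3)) := by
      refine Metric.isOpen_ball.mem_nhds ?_
      rw [mem_ball_zero_iff, norm_sphere_smul hs.le]
      linarith
    filter_upwards [this] with y hy
    simp only [hv]
    rw [χ.one_of_mem_closedBall (Metric.ball_subset_closedBall hy), one_mul]
  have hf1 : fderiv ℝ w = fun y => fderiv ℝ u (x₀ + y) := by
    ext1 y
    exact fderiv_comp_add_left x₀
  have hf2 : ∀ y, fderiv ℝ (fderiv ℝ w) y = fderiv ℝ (fderiv ℝ u) (x₀ + y) := by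
    intro y
    rw [hf1]
    exact fderiv_comp_add_left (f := fderiv ℝ u) x₀
  have e1 : ∀ ω : Metric.sphere (0 : E3) 1,
      fderiv ℝ v (s • (ω : E3)) = fderiv ℝ u (x₀ + s • (ω : E3)) := fun ω => by
    rw [(heq ω).fderiv_eq, hf1]
  have e2 : ∀ ω : Metric.sphere (0 : E3) 1,
      fderiv ℝ (fderiv ℝ v) (s • (ω : E3)) = fderiv ℝ (fderiv ℝ u) (x₀ + s • (ω : E3)) := fun ω => by
    rw [(heq ω).fderiv.fderiv_eq, hf2]
  have e3 : ∀ ω : Metric.sphere (0 : E3) 1,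
      lap3 v (s • (ω : E3)) = lap3 u (x₀ + s • (ω : E3)) := fun ω => by
    unfold lap3
    simp_rw [der2_eq hvd, der2_eq hu, e2]
  have h := sphere_identity_of_hasCompactSupport hvd hvc hs
  simpa only [e1, e2, e3] using h

/-- The contribution of the initial data to the Kirchhoff formula. -/
def linPart (φ : ℝ → E3 → ℝ) (t₀ : ℝ) (x₀ : E3) : ℝ :=
  ∫ ω : Metric.sphere (0 : E3) 1, (φ 0 (x₀ + t₀ • (ω : E3)) +
    t₀ * (dt1 φ 0 (x₀ + t₀ • (ω : E3)) +
      fderiv ℝ (φ 0) (x₀ + t₀ • (ω : E3)) (ω : E3))) ∂sphereMeasure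

section Slices

variable {φ : ℝ → E3 → ℝ}

theorem dt1_eq (h : Differentiable ℝ fun q : ℝ × E3 => φ q.1 q.2) (t : ℝ) (x : E3) :
    dt1 φ t x = fderiv ℝ (fun q : ℝ × E3 => φ q.1 q.2) (t, x) (1, 0) := by
  have h1 : HasDerivAt (fun s : ℝ => ((s, x) : ℝ × E3)) (1, 0) t :=
    (hasDerivAt_id t).prodMk (hasDerivAt_const t x)
  exact ((h (t, x)).hasFDerivAt.comp_hasDerivAt t h1).deriv

theorem fderiv_slice (h : Differentiable ℝ fun q : ℝ × E3 => φ q.1 q.2) (t : ℝ) (x v : E3) :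
    fderiv ℝ (φ t) x v = fderiv ℝ (fun q : ℝ × E3 => φ q.1 q.2) (t, x) (0, v) := by
  have h1 : HasFDerivAt (fun y : E3 => ((t, y) : ℝ × E3))
      ((0 : E3 →L[ℝ] ℝ).prod (ContinuousLinearMap.id ℝ E3)) x :=
    (hasFDerivAt_const t x).prodMk (hasFDerivAt_id x)
  have := ((h (t, x)).hasFDerivAt.comp x h1).fderiv
  change fderiv ℝ (φ t) x = _ at this
  rw [this]
  rfl

theorem dtt_eq (h : ContDiff ℝ 2 fun q : ℝ × E3 => φ q.1 q.2) (t : ℝ) (x : E3) :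
    dtt φ t x = fderiv ℝ (fderiv ℝ fun q : ℝ × E3 => φ q.1 q.2) (t, x) (1, 0) (1, 0) := by
  have h1 : HasDerivAt (fun s : ℝ => ((s, x) : ℝ × E3)) (1, 0) t :=
    (hasDerivAt_id t).prodMk (hasDerivAt_const t x)
  have h2 := (hasFDerivAt_fderiv_apply h (t, x) (1, 0)).comp_hasDerivAt t h1
  unfold dtt
  simp_rw [dt1_eq (h.differentiable two_ne_zero)]
  exact h2.deriv

theorem contDiff_slice {n : WithTop ℕ∞} (h : ContDiff ℝ n fun q : ℝ × E3 => φ q.1 q.2) (t : ℝ) :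
    ContDiff ℝ n (φ t) :=
  h.comp (contDiff_const.prodMk contDiff_id)

theorem fderiv_fderiv_slice (h : ContDiff ℝ 2 fun q : ℝ × E3 => φ q.1 q.2) (t : ℝ) (x v w : E3) :
    fderiv ℝ (fderiv ℝ (φ t)) x v w
      = fderiv ℝ (fderiv ℝ fun q : ℝ × E3 => φ q.1 q.2) (t, x) (0, v) (0, w) := by
  have h1 : HasFDerivAt (fun y : E3 => ((t, y) : ℝ × E3))
      ((0 : E3 →L[ℝ] ℝ).prod (ContinuousLinearMap.id ℝ E3)) x :=
    (hasFDerivAt_const t x).prodMk (hasFDerivAt_id x)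
  have h2 := ((hasFDerivAt_fderiv_apply h (t, x) (0, w)).comp x h1)
  have h3 := hasFDerivAt_fderiv_apply (contDiff_slice h t) x w
  have h4 : (fun y => fderiv ℝ (φ t) y w)
      = (fun q => fderiv ℝ (fun q : ℝ × E3 => φ q.1 q.2) q (0, w)) ∘ fun y : E3 => (t, y) := by
    ext y
    exact fderiv_slice (h.differentiable two_ne_zero) t y w
  rw [h4] at h3
  have := congrArg (fun L : E3 →L[ℝ] ℝ => L v) (h3.unique h2)
  simpa using this

end Slices


/-- Kirchhoff's formula for a solution of `∂_t²φ − Δφ + G = 0`. -/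
theorem kirchhoff {φ G : ℝ → E3 → ℝ} (h : ContDiff ℝ 2 fun q : ℝ × E3 => φ q.1 q.2)
    (hG : ∀ t, 0 ≤ t → ∀ x, dtt φ t x - lap3 (φ t) x + G t x = 0)
    {t₀ : ℝ} (ht₀ : 0 ≤ t₀) (x₀ : E3) :
    sphereMeasure.real Set.univ * φ t₀ x₀ = linPart φ t₀ x₀
      - ∫ s in (0 : ℝ)..t₀, s * ∫ ω : Metric.sphere (0 : E3) 1,
          G (t₀ - s) (x₀ + s • (ω : E3)) ∂sphereMeasure := by
  set U : ℝ × E3 → ℝ := fun q => φ q.1 q.2 with hU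
  have hUd : Differentiable ℝ U := h.differentiable two_ne_zero
  have h1 := contDiff_fderiv_one h
  have h2 := h1.continuous_fderiv one_ne_zero
  have h3 := h1.continuous
  have hUc := h.continuous
  set c : ℝ → Metric.sphere (0 : E3) 1 → ℝ × E3 := fun s ω => (t₀ - s, x₀ + s • (ω : E3)) with hc
  have hcc : Continuous fun z : ℝ × Metric.sphere (0 : E3) 1 => c z.1 z.2 := by
    simp only [hc]; fun_prop
  have hcd : ∀ s ω, HasDerivAt (fun s => c s ω) (-1, (ω : E3)) s := fun s ω => by
    have a1 : HasDerivAt (fun s : ℝ => t₀ - s) (-1) s := by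
      simpa using (hasDerivAt_id s).const_sub t₀
    have a2 : HasDerivAt (fun s : ℝ => x₀ + s • (ω : E3)) (ω : E3) s := by
      simpa using ((hasDerivAt_id s).smul_const (ω : E3)).const_add x₀
    exact a1.prodMk a2
  set F : ℝ → Metric.sphere (0 : E3) 1 → ℝ := fun s ω =>
    U (c s ω) + s * fderiv ℝ U (c s ω) (1, (ω : E3)) with hF
  set F' : ℝ → Metric.sphere (0 : E3) 1 → ℝ := fun s ω =>
    2 * fderiv ℝ U (c s ω) (0, (ω : E3))
      + s * (fderiv ℝ (fderiv ℝ U) (c s ω) (0, (ω : E3)) (0, (ω : E3))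
        - fderiv ℝ (fderiv ℝ U) (c s ω) (1, 0) (1, 0)) with hF'
  have hFc : Continuous F.uncurry := by
    simp only [Function.uncurry_def, hF]
    exact (hUc.comp hcc).add (continuous_fst.mul ((h3.comp hcc).clm_apply (by fun_prop)))
  have hFc' : Continuous F'.uncurry := by
    simp only [Function.uncurry_def, hF']
    exact (continuous_const.mul ((h3.comp hcc).clm_apply (by fun_prop))).add
      (continuous_fst.mul ((((h2.comp hcc).clm_apply (by fun_prop)).clm_apply (by fun_prop)).sub
        (((h2.comp hcc).clm_apply continuous_const).clm_apply continuous_const)))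
  have hFd : ∀ s ω, HasDerivAt (fun s => F s ω) (F' s ω) s := by
    intro s ω
    have d1 := (hUd (c s ω)).hasFDerivAt.comp_hasDerivAt s (hcd s ω)
    have d2 := (hasFDerivAt_fderiv_apply h (c s ω) (1, (ω : E3))).comp_hasDerivAt s (hcd s ω)
    have d3 := d1.add ((hasDerivAt_id s).mul d2)
    refine d3.congr_deriv ?_
    have hsymm : IsSymmSndFDerivAt ℝ U (c s ω) :=
      h.contDiffAt.isSymmSndFDerivAt (by simp)
    have e1 : ((-1 : ℝ), (ω : E3)) = -(1, 0) + (0, (ω : E3)) := by simp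
    have e2 : ((1 : ℝ), (ω : E3)) = (1, 0) + (0, (ω : E3)) := by simp
    have e3 := hsymm (1, 0) (0, (ω : E3))
    simp only [hF', ContinuousLinearMap.flip_apply, Function.comp_apply, id]
    rw [e1, e2]
    simp only [map_add, map_neg, add_apply, neg_apply, e3]
    ring
  have hB : ∀ s, HasDerivAt (fun s => ∫ ω, F s ω ∂sphereMeasure) (∫ ω, F' s ω ∂sphereMeasure) s :=
    hasDerivAt_integral_of_compactSpace hFc hFc' hFd
  have hBc : Continuous fun s => ∫ ω, F' s ω ∂sphereMeasure :=
    continuous_integral_of_compactSpace hFc'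
  have hint : ∫ s in (0 : ℝ)..t₀, ∫ ω, F' s ω ∂sphereMeasure
      = (∫ ω, F t₀ ω ∂sphereMeasure) - ∫ ω, F 0 ω ∂sphereMeasure :=
    intervalIntegral.integral_eq_sub_of_hasDerivAt (fun s _ => hB s) (hBc.intervalIntegrable _ _)
  have hF0 : ∫ ω, F 0 ω ∂sphereMeasure = sphereMeasure.real Set.univ * φ t₀ x₀ := by
    simp [hF, hc, hU]
  have hFt : ∫ ω, F t₀ ω ∂sphereMeasure = linPart φ t₀ x₀ := by
    unfold linPart
    refine integral_congr_ae (Filter.Eventually.of_forall fun ω => ?_)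
    simp only [hF, hc, sub_self, hU]
    rw [dt1_eq hUd, fderiv_slice hUd, ← map_add]
    simp
  have hFs : ∀ s ∈ Set.uIoc 0 t₀, ∫ ω, F' s ω ∂sphereMeasure
      = s * ∫ ω : Metric.sphere (0 : E3) 1, G (t₀ - s) (x₀ + s • (ω : E3)) ∂sphereMeasure := by
    intro s hs
    rw [Set.uIoc_of_le ht₀] at hs
    have hsl := contDiff_slice h (t₀ - s)
    have hsp := sphere_identity hsl x₀ hs.1
    have cs : Continuous fun ω => c s ω := hcc.comp (Continuous.prodMk_right s)
    have i1 : Integrable (fun ω : Metric.sphere (0 : E3) 1 =>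
        fderiv ℝ U (c s ω) (0, (ω : E3))) sphereMeasure :=
      continuous_integrable_of_compactSpace ((h3.comp cs).clm_apply (by fun_prop))
    have i2 : Integrable (fun ω : Metric.sphere (0 : E3) 1 =>
        fderiv ℝ (fderiv ℝ U) (c s ω) (0, (ω : E3)) (0, (ω : E3))) sphereMeasure :=
      continuous_integrable_of_compactSpace
        (((h2.comp cs).clm_apply (by fun_prop)).clm_apply (by fun_prop))
    have i3 : Integrable (fun ω : Metric.sphere (0 : E3) 1 =>
        fderiv ℝ (fderiv ℝ U) (c s ω) (1, 0) (1, 0)) sphereMeasure :=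
      continuous_integrable_of_compactSpace
        (((h2.comp cs).clm_apply continuous_const).clm_apply continuous_const)
    have i4 : Integrable (fun ω : Metric.sphere (0 : E3) 1 =>
        lap3 (φ (t₀ - s)) (x₀ + s • (ω : E3))) sphereMeasure :=
      continuous_integrable_of_compactSpace ((continuous_lap3 hsl).comp (by fun_prop))
    simp_rw [fderiv_slice hUd, fderiv_fderiv_slice h] at hsp
    simp only [hF']
    have i23 : Integrable (fun ω : Metric.sphere (0 : E3) 1 =>
        fderiv ℝ (fderiv ℝ U) (c s ω) (0, (ω : E3)) (0, (ω : E3))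
          - fderiv ℝ (fderiv ℝ U) (c s ω) (1, 0) (1, 0)) sphereMeasure := i2.sub i3
    rw [integral_add (i1.const_mul 2) (i23.const_mul s), integral_const_mul,
      integral_const_mul, integral_sub i2 i3]
    have hlast : ∫ ω : Metric.sphere (0 : E3) 1, G (t₀ - s) (x₀ + s • (ω : E3)) ∂sphereMeasure
        = (∫ ω : Metric.sphere (0 : E3) 1,
            lap3 (φ (t₀ - s)) (x₀ + s • (ω : E3)) ∂sphereMeasure)
          - ∫ ω, fderiv ℝ (fderiv ℝ U) (c s ω) (1, 0) (1, 0) ∂sphereMeasure := by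
      rw [← integral_sub i4 i3]
      refine integral_congr_ae (Filter.Eventually.of_forall fun ω => ?_)
      have := hG (t₀ - s) (by linarith [hs.2]) (x₀ + s • (ω : E3))
      rw [dtt_eq h] at this
      simp only [hc]
      linarith
    rw [hlast]
    simp only [hc, hU]
    linear_combination -hsp
  rw [← hF0, ← hFt, ← intervalIntegral.integral_congr_ae
    (Filter.Eventually.of_forall hFs), hint]
  ring

theorem deriv_mul_sphereMean {u : E3 → ℝ} (hu : ContDiff ℝ 1 u) (x₀ : E3) (t : ℝ) :
    deriv (fun s => s * ∫ ω : Metric.sphere (0 : E3) 1, u (x₀ + s • (ω : E3)) ∂sphereMeasure) t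
      = (∫ ω : Metric.sphere (0 : E3) 1, u (x₀ + t • (ω : E3)) ∂sphereMeasure)
        + t * ∫ ω : Metric.sphere (0 : E3) 1,
          fderiv ℝ u (x₀ + t • (ω : E3)) (ω : E3) ∂sphereMeasure := by
  have h3 := hu.continuous_fderiv one_ne_zero
  have huc := hu.continuous
  have := hasDerivAt_integral_of_compactSpace (μ := sphereMeasure)
    (F := fun s (ω : Metric.sphere (0 : E3) 1) => u (x₀ + s • (ω : E3)))
    (F' := fun s (ω : Metric.sphere (0 : E3) 1) => fderiv ℝ u (x₀ + s • (ω : E3)) (ω : E3))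
    (by simp only [Function.uncurry_def]; fun_prop)
    (by simp only [Function.uncurry_def]; fun_prop) (fun s ω => by
      have a2 : HasDerivAt (fun s : ℝ => x₀ + s • (ω : E3)) (ω : E3) s := by
        simpa using ((hasDerivAt_id s).smul_const (ω : E3)).const_add x₀
      exact (hu.differentiable one_ne_zero _).hasFDerivAt.comp_hasDerivAt s a2) t
  have h4 := ((hasDerivAt_id t).fun_mul this).deriv
  simpa using h4

theorem psiLin_eq {p : ℝ} {φ : ℝ → E3 → ℝ} (h : ContDiff ℝ 1 fun q : ℝ × E3 => φ q.1 q.2)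
    (t₀ : ℝ) (x₀ : E3) :
    psiLin p φ t₀ x₀ = 1 / (4 * Real.pi) * (linPart φ t₀ x₀
      + ∫ r' in Set.Ioc (0 : ℝ) t₀, r' * ∫ ω : Metric.sphere (0 : E3) 1,
          Fext p φ (t₀ - r') (x₀ + r' • (ω : E3)) ∂sphereMeasure) := by
  unfold psiLin linPart
  have h0 := contDiff_slice h 0
  have h3 := h0.continuous_fderiv one_ne_zero
  have h4 := h.continuous_fderiv one_ne_zero
  have huc := h0.continuous
  rw [deriv_mul_sphereMean h0]
  have i1 : Integrable (fun ω : Metric.sphere (0 : E3) 1 => φ 0 (x₀ + t₀ • (ω : E3)))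
      sphereMeasure := continuous_integrable_of_compactSpace (by fun_prop)
  have i2 : Integrable (fun ω : Metric.sphere (0 : E3) 1 => dt1 φ 0 (x₀ + t₀ • (ω : E3)))
      sphereMeasure := continuous_integrable_of_compactSpace (by
        simp_rw [dt1_eq (h.differentiable one_ne_zero)]
        exact (h4.comp (by fun_prop)).clm_apply (by fun_prop))
  have i3 : Integrable (fun ω : Metric.sphere (0 : E3) 1 =>
      fderiv ℝ (φ 0) (x₀ + t₀ • (ω : E3)) (ω : E3))
      sphereMeasure := continuous_integrable_of_compactSpace (by
        exact (h3.comp (by fun_prop)).clm_apply (by fun_prop))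
  have i23 : Integrable (fun ω : Metric.sphere (0 : E3) 1 => dt1 φ 0 (x₀ + t₀ • (ω : E3))
      + fderiv ℝ (φ 0) (x₀ + t₀ • (ω : E3)) (ω : E3)) sphereMeasure := i2.add i3
  rw [integral_add i1 (i23.const_mul t₀), integral_const_mul]
  have : ∫ ω : Metric.sphere (0 : E3) 1, (dt1 φ 0 (x₀ + t₀ • (ω : E3))
      + fderiv ℝ (φ 0) (x₀ + t₀ • (ω : E3)) (ω : E3)) ∂sphereMeasure = _ := integral_add i2 i3
  rw [this]
  ring

theorem enorm_ray_sub_le {F : Type*} [NormedAddCommGroup F] [NormedSpace ℝ F] [CompleteSpace F]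
    {h : E3 → F} (hh : ContDiff ℝ 1 h) (x₀ : E3) {e : E3} (he : ‖e‖ = 1) {t s : ℝ} (hts : t ≤ s) :
    ‖h (x₀ + s • e) - h (x₀ + t • e)‖ₑ ≤ ∫⁻ s' in Set.Ioc t s, ‖fderiv ℝ h (x₀ + s' • e)‖ₑ := by
  have hc := hh.continuous_fderiv one_ne_zero
  have hd : ∀ s, HasDerivAt (fun s : ℝ => h (x₀ + s • e)) (fderiv ℝ h (x₀ + s • e) e) s := fun s => by
    have a2 : HasDerivAt (fun s : ℝ => x₀ + s • e) e s := by
      simpa using ((hasDerivAt_id s).smul_const e).const_add x₀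
    exact (hh.differentiable one_ne_zero _).hasFDerivAt.comp_hasDerivAt s a2
  rw [← intervalIntegral.integral_eq_sub_of_hasDerivAt (fun s _ => hd s)
    ((show Continuous fun s : ℝ => fderiv ℝ h (x₀ + s • e) e by fun_prop).intervalIntegrable _ _),
    intervalIntegral.integral_of_le hts]
  refine (enorm_integral_le_lintegral_enorm _).trans (lintegral_mono fun s' => ?_)
  have := (fderiv ℝ h (x₀ + s' • e)).le_opENorm e
  have h1 : ‖e‖ₑ = 1 := by rw [← ofReal_norm, he]; simp
  rwa [h1, mul_one] at this

/-- Along almost every ray an integrable function is controlled by the integral of its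
derivative towards infinity. -/
theorem ae_enorm_ray_le {F : Type*} [NormedAddCommGroup F] [NormedSpace ℝ F] [CompleteSpace F]
    {h : E3 → F} (hh : ContDiff ℝ 1 h) {q : ℝ} (hq : 0 < q) (hint : ∫⁻ x, ‖h x‖ₑ ^ q ≠ ⊤)
    (x₀ : E3) : ∀ᵐ ω : Metric.sphere (0 : E3) 1 ∂sphereMeasure, ∀ t : ℝ, 0 ≤ t →
      ‖h (x₀ + t • (ω : E3))‖ₑ ≤ ∫⁻ s in Set.Ioi t, ‖fderiv ℝ h (x₀ + s • (ω : E3))‖ₑ := by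
  have hm : Measurable fun x => ‖h x‖ₑ ^ q := (hh.continuous.enorm.measurable).pow_const _
  rw [lintegral_polar x₀ hm, lintegral_lintegral_swap] at hint
  · have hae := ae_lt_top' (AEMeasurable.lintegral_prod_right' (μ := sphereMeasure)
      (ν := volume.restrict (Set.Ioi (0 : ℝ)))
      (f := fun z : Metric.sphere (0 : E3) 1 × ℝ =>
        ENNReal.ofReal (z.2 ^ 2) * ‖h (x₀ + z.2 • (z.1 : E3))‖ₑ ^ q)
      (Measurable.aemeasurable (by
        refine Measurable.mul (by fun_prop) ?_
        exact hm.comp (by fun_prop)))) hint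
    filter_upwards [hae] with ω hω t ht
    by_contra! hlt
    set J := ∫⁻ s in Set.Ioi t, ‖fderiv ℝ h (x₀ + s • (ω : E3))‖ₑ with hJ
    set c := ‖h (x₀ + t • (ω : E3))‖ₑ - J with hc
    have hc0 : 0 < c := tsub_pos_of_lt hlt
    have hcs : ∀ s ∈ Set.Ioi t, c ≤ ‖h (x₀ + s • (ω : E3))‖ₑ := by
      intro s hs
      have h1 := enorm_ray_sub_le hh x₀ (e := (ω : E3)) (by simp) (le_of_lt hs)
      have h2 : ∫⁻ s' in Set.Ioc t s, ‖fderiv ℝ h (x₀ + s' • (ω : E3))‖ₑ ≤ J :=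
        lintegral_mono_set Set.Ioc_subset_Ioi_self
      rw [hc, tsub_le_iff_right]
      calc ‖h (x₀ + t • (ω : E3))‖ₑ
          = ‖h (x₀ + s • (ω : E3)) - (h (x₀ + s • (ω : E3)) - h (x₀ + t • (ω : E3)))‖ₑ := by
            congr 1; abel
        _ ≤ ‖h (x₀ + s • (ω : E3))‖ₑ + ‖h (x₀ + s • (ω : E3)) - h (x₀ + t • (ω : E3))‖ₑ :=
            enorm_sub_le
        _ ≤ _ := by gcongr; exact h1.trans h2
    have h3 : ∫⁻ s in Set.Ioi (t + 1), ENNReal.ofReal ((t + 1) ^ 2) * c ^ q ≤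
        ∫⁻ s in Set.Ioi (0 : ℝ), ENNReal.ofReal (s ^ 2) * ‖h (x₀ + s • (ω : E3))‖ₑ ^ q := by
      refine (setLIntegral_mono' measurableSet_Ioi fun s hs => ?_).trans
        (lintegral_mono_set (Set.Ioi_subset_Ioi (by positivity)))
      have hs' : t + 1 ≤ s := le_of_lt hs
      gcongr
      exact hcs s (lt_of_lt_of_le (lt_add_one t) hs')
    rw [setLIntegral_const, Real.volume_Ioi, ENNReal.mul_top] at h3
    · exact absurd (lt_of_le_of_lt h3 hω) (by simp)
    · refine mul_ne_zero (by simp; positivity) ?_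
      exact (ENNReal.rpow_pos_of_nonneg hc0 hq.le).ne'
  · refine Measurable.aemeasurable ?_
    refine Measurable.mul (by fun_prop) ?_
    exact hm.comp (by fun_prop)

theorem lintegral_Ioi_lintegral_Ioi {f : ℝ → ℝ≥0∞} (hf : Measurable f) {t : ℝ} (ht : 0 ≤ t) :
    ∫⁻ s in Set.Ioi t, ∫⁻ s' in Set.Ioi s, f s' ≤ ∫⁻ s in Set.Ioi t, ENNReal.ofReal s * f s := by
  have h1 : ∀ s, ∫⁻ s' in Set.Ioi s, f s' = ∫⁻ s', (Set.Ioi s).indicator f s' := fun s =>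
    (lintegral_indicator measurableSet_Ioi f).symm
  simp_rw [h1]
  rw [lintegral_lintegral_swap]
  · have h2 : ∀ s', ∫⁻ s in Set.Ioi t, (Set.Ioi s).indicator f s'
        = (Set.Ioi t).indicator (fun s' => ENNReal.ofReal (s' - t) * f s') s' := by
      intro s'
      have : ∀ s, (Set.Ioi s).indicator f s' = (Set.Iio s').indicator (fun _ => f s') s := by
        intro s; simp [Set.indicator]
      simp_rw [this]
      rw [lintegral_indicator measurableSet_Iio, Measure.restrict_restrict measurableSet_Iio,
        setLIntegral_const, Set.inter_comm, Set.Ioi_inter_Iio, Real.volume_Ioo]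
      by_cases h : t < s'
      · rw [Set.indicator_of_mem (Set.mem_Ioi.2 h), mul_comm]
      · rw [Set.indicator_of_notMem (by simpa using h), ENNReal.ofReal_of_nonpos (by linarith),
          mul_zero]
    simp_rw [h2]
    rw [lintegral_indicator measurableSet_Ioi]
    refine lintegral_mono fun s => ?_
    gcongr
    linarith
  · refine Measurable.aemeasurable ?_
    have : (Function.uncurry fun s s' : ℝ => (Set.Ioi s).indicator f s')
        = {z : ℝ × ℝ | z.1 < z.2}.indicator fun z => f z.2 := by
      ext z; simp [Function.uncurry, Set.indicator]
    rw [this]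
    exact (hf.comp measurable_snd).indicator (measurableSet_lt measurable_fst measurable_snd)


/-- The linear evolution is controlled by second derivatives of the data outside the ball of
radius `t₀`. -/
theorem enorm_linPart_le {φ : ℝ → E3 → ℝ} {q : ℝ} (hq : 0 < q)
    (h0 : ContDiff ℝ 2 (φ 0)) (h1 : ContDiff ℝ 1 (dt1 φ 0))
    (i0 : ∫⁻ x, ‖φ 0 x‖ₑ ^ q ≠ ⊤) (i1 : ∫⁻ x, ‖fderiv ℝ (φ 0) x‖ₑ ^ (2 : ℝ) ≠ ⊤)
    (i2 : ∫⁻ x, ‖dt1 φ 0 x‖ₑ ^ (2 : ℝ) ≠ ⊤) {t₀ : ℝ} (ht₀ : 0 ≤ t₀) (x₀ : E3) :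
    ‖linPart φ t₀ x₀‖ₑ ≤ 3 * ∫⁻ y, {y : E3 | t₀ < ‖y - x₀‖}.indicator
      (fun y => ENNReal.ofReal (‖y - x₀‖⁻¹) *
        (‖fderiv ℝ (fderiv ℝ (φ 0)) y‖ₑ + ‖fderiv ℝ (dt1 φ 0) y‖ₑ)) y := by
  have h2 : ContDiff ℝ 1 (fderiv ℝ (φ 0)) := contDiff_fderiv_one h0
  have c2 := (h2.continuous_fderiv one_ne_zero).enorm
  have c1 := (h1.continuous_fderiv one_ne_zero).enorm
  set H : E3 → ℝ≥0∞ := fun y => ‖fderiv ℝ (fderiv ℝ (φ 0)) y‖ₑ + ‖fderiv ℝ (dt1 φ 0) y‖ₑ with hH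
  have hHm : Measurable H := c2.measurable.add c1.measurable
  have hmeas : Measurable ({y : E3 | t₀ < ‖y - x₀‖}.indicator
      (fun y => ENNReal.ofReal (‖y - x₀‖⁻¹) * H y)) := by
    refine Measurable.indicator (Measurable.mul (by fun_prop) hHm)
      (measurableSet_lt measurable_const (by fun_prop))
  have hray : ∀ ω : Metric.sphere (0 : E3) 1, Measurable fun s : ℝ => x₀ + s • (ω : E3) := fun ω => by
    fun_prop
  rw [lintegral_polar x₀ hmeas, lintegral_lintegral_swap]
  swap
  · refine Measurable.aemeasurable (Measurable.mul (by fun_prop) ?_)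
    exact hmeas.comp (by fun_prop)
  rw [← lintegral_const_mul' _ _ (by norm_num)]
  unfold linPart
  refine (enorm_integral_le_lintegral_enorm _).trans (lintegral_mono_ae ?_)
  filter_upwards [ae_enorm_ray_le (h0.of_le (by norm_num)) hq i0 x₀,
    ae_enorm_ray_le h2 two_pos i1 x₀, ae_enorm_ray_le h1 two_pos i2 x₀] with ω a0 a1 a2
  have hω : ‖(ω : E3)‖ₑ = 1 := by rw [← ofReal_norm]; simp
  set S := ∫⁻ s in Set.Ioi t₀, ENNReal.ofReal s * H (x₀ + s • (ω : E3)) with hS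
  have hmain : ∫⁻ s in Set.Ioi (0 : ℝ), ENNReal.ofReal (s ^ 2) *
      {y : E3 | t₀ < ‖y - x₀‖}.indicator (fun y => ENNReal.ofReal (‖y - x₀‖⁻¹) * H y)
        (x₀ + s • (ω : E3)) = S := by
    have e : ∀ s ∈ Set.Ioi (0 : ℝ), ENNReal.ofReal (s ^ 2) *
        {y : E3 | t₀ < ‖y - x₀‖}.indicator (fun y => ENNReal.ofReal (‖y - x₀‖⁻¹) * H y)
          (x₀ + s • (ω : E3))
        = (Set.Ioi t₀).indicator (fun s => ENNReal.ofReal s * H (x₀ + s • (ω : E3))) s := by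
      intro s hs
      have hn : ‖x₀ + s • (ω : E3) - x₀‖ = s := by
        rw [add_sub_cancel_left, norm_sphere_smul (le_of_lt hs)]
      by_cases hts : t₀ < s
      · rw [Set.indicator_of_mem (show x₀ + s • (ω : E3) ∈ {y : E3 | t₀ < ‖y - x₀‖} from lt_of_lt_of_eq hts hn.symm),
          Set.indicator_of_mem (by simpa using hts),
          hn, ← mul_assoc, ← ENNReal.ofReal_mul (by positivity)]
        congr 2
        have : s ≠ 0 := ne_of_gt hs
        field_simp
      · rw [Set.indicator_of_notMem (show x₀ + s • (ω : E3) ∉ {y : E3 | t₀ < ‖y - x₀‖} from fun h => hts (hn ▸ h)),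
          Set.indicator_of_notMem (by simpa using hts), mul_zero]
    rw [setLIntegral_congr_fun measurableSet_Ioi e, setLIntegral_indicator measurableSet_Ioi,
      Set.inter_eq_left.2 (Set.Ioi_subset_Ioi ht₀)]
  rw [hmain]
  have b1 : ∀ s : ℝ, 0 ≤ s → ‖fderiv ℝ (φ 0) (x₀ + s • (ω : E3))‖ₑ
      ≤ ∫⁻ s' in Set.Ioi s, H (x₀ + s' • (ω : E3)) := fun s hs =>
    (a1 s hs).trans (lintegral_mono fun s' => le_self_add)
  have b2 : ∀ s : ℝ, 0 ≤ s → ‖dt1 φ 0 (x₀ + s • (ω : E3))‖ₑ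
      ≤ ∫⁻ s' in Set.Ioi s, H (x₀ + s' • (ω : E3)) := fun s hs =>
    (a2 s hs).trans (lintegral_mono fun s' => le_add_self)
  have b0 : ‖φ 0 (x₀ + t₀ • (ω : E3))‖ₑ ≤ S := by
    refine (a0 t₀ ht₀).trans ?_
    refine (setLIntegral_mono' measurableSet_Ioi fun s hs => b1 s (ht₀.trans (le_of_lt hs))).trans ?_
    exact lintegral_Ioi_lintegral_Ioi (hHm.comp (hray ω)) ht₀
  have bt : ENNReal.ofReal t₀ * ∫⁻ s' in Set.Ioi t₀, H (x₀ + s' • (ω : E3)) ≤ S := by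
    rw [← lintegral_const_mul' _ _ ENNReal.ofReal_ne_top]
    refine setLIntegral_mono' measurableSet_Ioi fun s hs => ?_
    have : t₀ ≤ s := le_of_lt hs
    gcongr
  have et : ‖t₀‖ₑ = ENNReal.ofReal t₀ := Real.enorm_of_nonneg ht₀
  have b3 : ‖fderiv ℝ (φ 0) (x₀ + t₀ • (ω : E3)) (ω : E3)‖ₑ
      ≤ ‖fderiv ℝ (φ 0) (x₀ + t₀ • (ω : E3))‖ₑ := by
    have := (fderiv ℝ (φ 0) (x₀ + t₀ • (ω : E3))).le_opENorm (ω : E3)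
    rwa [hω, mul_one] at this
  calc _ ≤ ‖φ 0 (x₀ + t₀ • (ω : E3))‖ₑ + ‖t₀‖ₑ * (‖dt1 φ 0 (x₀ + t₀ • (ω : E3))‖ₑ
        + ‖fderiv ℝ (φ 0) (x₀ + t₀ • (ω : E3)) (ω : E3)‖ₑ) := by
        refine (enorm_add_le _ _).trans ?_
        rw [enorm_mul]
        gcongr
        exact enorm_add_le _ _
    _ ≤ S + (S + S) := by
        rw [mul_add, et]
        refine add_le_add b0 (add_le_add ?_ ?_)
        · exact le_trans (by gcongr; exact b2 t₀ ht₀) bt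
        · exact le_trans (by gcongr; exact b3.trans (b1 t₀ ht₀)) bt
    _ = 3 * S := by ring

/-- Integral over a ball of an inverse square. -/
theorem lintegral_ball_inv_sq_le (x₀ : E3) {R : ℝ} (hR : 0 ≤ R) :
    ∫⁻ y, {y : E3 | ‖y - x₀‖ < R}.indicator (fun y => ENNReal.ofReal (‖y - x₀‖ ^ (-2 : ℝ))) y
      ≤ ENNReal.ofReal (R * sphereMeasure.real Set.univ) := by
  have hm : Measurable ({y : E3 | ‖y - x₀‖ < R}.indicator
      (fun y => ENNReal.ofReal (‖y - x₀‖ ^ (-2 : ℝ)))) :=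
    Measurable.indicator (by fun_prop) (measurableSet_lt (by fun_prop) measurable_const)
  rw [lintegral_polar x₀ hm]
  have h : ∀ s ∈ Set.Ioi (0 : ℝ), ∫⁻ ω : Metric.sphere (0 : E3) 1, ENNReal.ofReal (s ^ 2) *
      {y : E3 | ‖y - x₀‖ < R}.indicator (fun y => ENNReal.ofReal (‖y - x₀‖ ^ (-2 : ℝ)))
        (x₀ + s • (ω : E3)) ∂sphereMeasure
      ≤ (Set.Iio R).indicator (fun _ => sphereMeasure Set.univ) s := by
    intro s hs
    have hs0 : 0 < s := hs
    have hn : ∀ ω : Metric.sphere (0 : E3) 1, ‖x₀ + s • (ω : E3) - x₀‖ = s := fun ω => by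
      rw [add_sub_cancel_left, norm_sphere_smul (le_of_lt hs)]
    by_cases hsR : s < R
    · rw [Set.indicator_of_mem (Set.mem_Iio.2 hsR)]
      calc _ ≤ ∫⁻ ω : Metric.sphere (0 : E3) 1, 1 ∂sphereMeasure := by
            refine lintegral_mono fun ω => ?_
            refine (mul_le_mul_right (Set.indicator_le_self _ _ _) _).trans ?_
            rw [hn, ← ENNReal.ofReal_mul (by positivity)]
            rw [← Real.rpow_natCast, ← Real.rpow_add hs0]
            norm_num
        _ = _ := by simp
    · rw [Set.indicator_of_notMem (by simpa using hsR)]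
      refine le_of_eq ?_
      rw [lintegral_eq_zero_iff']
      · refine Filter.Eventually.of_forall fun ω => ?_
        have : x₀ + s • (ω : E3) ∉ {y : E3 | ‖y - x₀‖ < R} := fun h =>
          hsR (lt_of_eq_of_lt (hn ω).symm h)
        simp only [Set.indicator_of_notMem this, mul_zero, Pi.zero_apply]
      · exact (Measurable.mul (by fun_prop) (hm.comp (by fun_prop))).aemeasurable
  refine (setLIntegral_mono' measurableSet_Ioi h).trans ?_
  rw [setLIntegral_indicator measurableSet_Iio, setLIntegral_const, Set.inter_comm,
    Set.Ioi_inter_Iio, Real.volume_Ioo, ENNReal.ofReal_mul hR, mul_comm, sub_zero,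
    ofReal_measureReal]

theorem exists_lintegral_one_add_norm_eq {k : ℝ} (hk : 3 < k) : ∃ j : ℝ, 0 ≤ j ∧
    ∫⁻ y : E3, ENNReal.ofReal ((1 + ‖y‖) ^ (-k)) = ENNReal.ofReal j := by
  refine ⟨_, ENNReal.toReal_nonneg, (ENNReal.ofReal_toReal (LT.lt.ne ?_)).symm⟩
  refine finite_integral_one_add_norm ?_
  rw [finrank_euclideanSpace_fin]; exact_mod_cast hk

/-- The kernel in the estimate for the linear evolution. -/
def linKernel (γ t₀ : ℝ) (x₀ : E3) : ℝ≥0∞ :=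
  ∫⁻ y, {y : E3 | t₀ < ‖y - x₀‖}.indicator
    (fun y => ENNReal.ofReal (‖y - x₀‖ ^ (-2 : ℝ) * (1 + ‖y‖) ^ (-(γ + 2)))) y

/-- Splitting of the kernel into the regions close to and away from `x₀`. -/
theorem linKernel_le_split {γ t₀ R A : ℝ} (hR : 0 < R) (x₀ : E3) (hA0 : 0 ≤ A)
    (hA : ∀ y : E3, ‖y - x₀‖ < R → (1 + ‖y‖) ^ (-(γ + 2)) ≤ A) :
    linKernel γ t₀ x₀ ≤ ENNReal.ofReal (A * R * sphereMeasure.real Set.univ)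
      + ENNReal.ofReal (R ^ (-2 : ℝ)) * ∫⁻ y : E3, ENNReal.ofReal ((1 + ‖y‖) ^ (-(γ + 2))) := by
  have h : ∀ y : E3, {y : E3 | t₀ < ‖y - x₀‖}.indicator
      (fun y => ENNReal.ofReal (‖y - x₀‖ ^ (-2 : ℝ) * (1 + ‖y‖) ^ (-(γ + 2)))) y
      ≤ ENNReal.ofReal A * {y : E3 | ‖y - x₀‖ < R}.indicator
          (fun y => ENNReal.ofReal (‖y - x₀‖ ^ (-2 : ℝ))) y
        + ENNReal.ofReal (R ^ (-2 : ℝ)) * ENNReal.ofReal ((1 + ‖y‖) ^ (-(γ + 2))) := by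
    intro y
    refine (Set.indicator_le_self _ _ _).trans ?_
    by_cases hy : ‖y - x₀‖ < R
    · rw [Set.indicator_of_mem (by exact hy)]
      refine le_add_right ?_
      rw [← ENNReal.ofReal_mul hA0, mul_comm]
      exact ENNReal.ofReal_le_ofReal (mul_le_mul_of_nonneg_right (hA y hy) (by positivity))
    · refine le_add_left ?_
      rw [← ENNReal.ofReal_mul (by positivity)]
      refine ENNReal.ofReal_le_ofReal (mul_le_mul_of_nonneg_right ?_ (by positivity))
      exact Real.rpow_le_rpow_of_nonpos hR (not_lt.1 hy) (by norm_num)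
  refine (lintegral_mono h).trans ?_
  rw [lintegral_add_right _ (by fun_prop), lintegral_const_mul' _ _ ENNReal.ofReal_ne_top,
    lintegral_const_mul' _ _ ENNReal.ofReal_ne_top]
  gcongr
  rw [mul_assoc, ENNReal.ofReal_mul hA0]
  gcongr
  exact lintegral_ball_inv_sq_le x₀ hR.le

theorem linKernel_exterior {γ : ℝ} (hγ : 1 < γ) : ∃ C : ℝ, 0 < C ∧ ∀ t₀ : ℝ, ∀ x₀ : E3,
    2 ≤ ‖x₀‖ → linKernel γ t₀ x₀ ≤ ENNReal.ofReal (C * ‖x₀‖ ^ (-2 : ℝ)) := by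
  obtain ⟨j, hj, hJ⟩ := exists_lintegral_one_add_norm_eq (show 3 < γ + 2 by linarith)
  refine ⟨2 ^ (γ + 1) * sphereMeasure.real Set.univ + 4 * j, ?_, fun t₀ x₀ hx => ?_⟩
  · have := sphereMeasure_real_univ_pos
    positivity
  have hr : 0 < ‖x₀‖ := by linarith
  have hR : 0 < ‖x₀‖ / 2 := by linarith
  refine (linKernel_le_split (A := (‖x₀‖ / 2) ^ (-(γ + 2))) hR x₀ (by positivity) ?_).trans ?_
  · intro y hy
    refine Real.rpow_le_rpow_of_nonpos hR ?_ (by linarith)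
    have := norm_sub_norm_le x₀ (x₀ - y)
    rw [sub_sub_cancel, norm_sub_rev] at this
    linarith
  · rw [hJ, ← ENNReal.ofReal_mul (by positivity),
      ← ENNReal.ofReal_add (by positivity) (by positivity)]
    refine ENNReal.ofReal_le_ofReal ?_
    have e1 : (‖x₀‖ / 2) ^ (-(γ + 2)) * (‖x₀‖ / 2) ≤ 2 ^ (γ + 1) * ‖x₀‖ ^ (-2 : ℝ) := by
      rw [← Real.rpow_add_one hR.ne', Real.div_rpow hr.le (by norm_num)]
      have : (2 : ℝ) ^ (-(γ + 2) + 1) = (2 ^ (γ + 1))⁻¹ := by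
        rw [← Real.rpow_neg (by norm_num)]; congr 1; ring
      rw [this, div_inv_eq_mul, mul_comm]
      gcongr
      · linarith
      · linarith
    have e2 : (‖x₀‖ / 2) ^ (-2 : ℝ) = 4 * ‖x₀‖ ^ (-2 : ℝ) := by
      rw [Real.div_rpow hr.le (by norm_num), Real.rpow_neg (by norm_num : (0:ℝ) ≤ 2)]
      norm_num; ring
    rw [e2]
    nlinarith [mul_le_mul_of_nonneg_right e1 (measureReal_nonneg (μ := sphereMeasure) (s := Set.univ))]

theorem linKernel_interior {γ : ℝ} (hγ : 1 < γ) : ∃ C : ℝ, 0 < C ∧ ∀ t₀ : ℝ, 0 ≤ t₀ → ∀ x₀ : E3,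
    ‖x₀‖ ≤ t₀ + 2 → linKernel γ t₀ x₀ ≤ ENNReal.ofReal (C * ((2 + t₀ + ‖x₀‖) ^ (-2 : ℝ) *
      (1 + |‖x₀‖ - t₀|) ^ (-((γ - 1) / 2)))) := by
  obtain ⟨j, hj, hJ⟩ := exists_lintegral_one_add_norm_eq (show 3 < γ + 2 by linarith)
  obtain ⟨j', hj', hJ'⟩ := exists_lintegral_one_add_norm_eq
    (show 3 < γ + 2 - (γ - 1) / 2 by linarith)
  have hσ := sphereMeasure_real_univ_pos
  set D := (6 : ℝ) ^ (-2 : ℝ) * 6 ^ (-((γ - 1) / 2)) with hD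
  have hD0 : 0 < D := by positivity
  refine ⟨(sphereMeasure.real Set.univ + j + 36 * 3 ^ ((γ - 1) / 2) * D * j') / D, by positivity,
    fun t₀ ht x₀ hx => ?_⟩
  have hr := norm_nonneg x₀
  rcases lt_or_ge t₀ 1 with h1 | h1
  · refine (linKernel_le_split (A := 1) one_pos x₀ zero_le_one fun y _ =>
      Real.rpow_le_one_of_one_le_of_nonpos (by linarith [norm_nonneg y]) (by linarith)).trans ?_
    rw [hJ, ← ENNReal.ofReal_mul (by positivity),
      ← ENNReal.ofReal_add (by positivity) (by positivity)]
    refine ENNReal.ofReal_le_ofReal ?_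
    have e : D ≤ (2 + t₀ + ‖x₀‖) ^ (-2 : ℝ) * (1 + |‖x₀‖ - t₀|) ^ (-((γ - 1) / 2)) := by
      refine mul_le_mul ?_ ?_ (by positivity) (by positivity)
      · exact Real.rpow_le_rpow_of_nonpos (by positivity) (by linarith) (by norm_num)
      · refine Real.rpow_le_rpow_of_nonpos (by positivity) ?_ (by linarith)
        have : |‖x₀‖ - t₀| ≤ 2 := abs_le.2 ⟨by linarith, by linarith⟩
        linarith
    rw [div_mul_eq_mul_div, le_div_iff₀ hD0]
    refine mul_le_mul ?_ e hD0.le (by positivity)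
    have : 0 ≤ 36 * 3 ^ ((γ - 1) / 2) * D * j' := by positivity
    simp; exact this
  · have ht0 : 0 < t₀ := by linarith
    set u := 1 + |‖x₀‖ - t₀| with hu
    have hu1 : 1 ≤ u := by simp [hu]
    have h : ∀ y : E3, {y : E3 | t₀ < ‖y - x₀‖}.indicator
        (fun y => ENNReal.ofReal (‖y - x₀‖ ^ (-2 : ℝ) * (1 + ‖y‖) ^ (-(γ + 2)))) y
        ≤ ENNReal.ofReal (t₀ ^ (-2 : ℝ) * (u / 3) ^ (-((γ - 1) / 2))) *
          ENNReal.ofReal ((1 + ‖y‖) ^ (-(γ + 2 - (γ - 1) / 2))) := by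
      intro y
      by_cases hy : y ∈ {y : E3 | t₀ < ‖y - x₀‖}
      swap
      · rw [Set.indicator_of_notMem hy]; exact zero_le
      have hy' : t₀ < ‖y - x₀‖ := hy
      rw [Set.indicator_of_mem hy, ← ENNReal.ofReal_mul (by positivity), mul_assoc]
      refine ENNReal.ofReal_le_ofReal (mul_le_mul ?_ ?_ (by positivity) (by positivity))
      · exact Real.rpow_le_rpow_of_nonpos ht0 hy'.le (by norm_num)
      · have : (1 + ‖y‖) ^ (-(γ + 2)) = (1 + ‖y‖) ^ (-((γ - 1) / 2)) *
            (1 + ‖y‖) ^ (-(γ + 2 - (γ - 1) / 2)) := by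
          rw [← Real.rpow_add (by positivity)]; congr 1; ring
        rw [this]
        refine mul_le_mul_of_nonneg_right ?_ (by positivity)
        refine Real.rpow_le_rpow_of_nonpos (by positivity) ?_ (by linarith)
        have := norm_sub_le y x₀
        have := norm_nonneg y
        rcases abs_cases (‖x₀‖ - t₀) with h | h <;> linarith
    refine (lintegral_mono h).trans ?_
    rw [lintegral_const_mul' _ _ ENNReal.ofReal_ne_top, hJ',
      ← ENNReal.ofReal_mul (by positivity)]
    refine ENNReal.ofReal_le_ofReal ?_
    have e1 : t₀ ^ (-2 : ℝ) ≤ 36 * (2 + t₀ + ‖x₀‖) ^ (-2 : ℝ) := by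
      have : (36 : ℝ) * (2 + t₀ + ‖x₀‖) ^ (-2 : ℝ) = ((2 + t₀ + ‖x₀‖) / 6) ^ (-2 : ℝ) := by
        rw [Real.div_rpow (by positivity) (by norm_num), Real.rpow_neg (by norm_num : (0:ℝ) ≤ 6)]
        norm_num; ring
      rw [this]
      exact Real.rpow_le_rpow_of_nonpos (by positivity) (by linarith) (by norm_num)
    have e2 : (u / 3) ^ (-((γ - 1) / 2)) = 3 ^ ((γ - 1) / 2) * u ^ (-((γ - 1) / 2)) := by
      rw [Real.div_rpow (by positivity) (by norm_num), Real.rpow_neg (by norm_num : (0:ℝ) ≤ 3),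
        div_inv_eq_mul, mul_comm]
    rw [e2]
    calc _ ≤ (36 * (2 + t₀ + ‖x₀‖) ^ (-2 : ℝ)) * (3 ^ ((γ - 1) / 2) * u ^ (-((γ - 1) / 2))) *
          j' := by gcongr
      _ = (36 * 3 ^ ((γ - 1) / 2) * D * j') / D *
          ((2 + t₀ + ‖x₀‖) ^ (-2 : ℝ) * u ^ (-((γ - 1) / 2))) := by field_simp
      _ ≤ _ := by
          gcongr
          linarith

theorem contDiff_dt1 {φ : ℝ → E3 → ℝ} {n : WithTop ℕ∞}
    (h : ContDiff ℝ (n + 1) fun q : ℝ × E3 => φ q.1 q.2) (t : ℝ) : ContDiff ℝ n (dt1 φ t) := by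
  have : dt1 φ t = fun x => fderiv ℝ (fun q : ℝ × E3 => φ q.1 q.2) (t, x) (1, 0) := by
    ext x; exact dt1_eq (h.differentiable (by simp)) t x
  rw [this]
  have h1 : ContDiff ℝ n (fderiv ℝ (fun q : ℝ × E3 => φ q.1 q.2)) := h.fderiv_right le_rfl
  exact (h1.comp (contDiff_const.prodMk contDiff_id)).clm_apply contDiff_const

theorem lintegral_le_wEnergy_zero (p γ : ℝ) (φ : ℝ → E3 → ℝ) :
    ∫⁻ x : E3, ENNReal.ofReal ((1 + ‖x‖) ^ γ * (‖fderiv ℝ (φ 0) x‖ ^ 2 + |dt1 φ 0 x| ^ 2))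
      ≤ wEnergy p 0 γ φ := by
  unfold wEnergy
  refine le_add_right (le_of_eq ?_)
  have h1 : ∀ x, ‖iteratedFDeriv ℝ (0 + 1) (φ 0) x‖ = ‖fderiv ℝ (φ 0) x‖ := fun x =>
    norm_iteratedFDeriv_one (φ 0)
  simp only [h1, zero_add, Finset.range_one, Finset.sum_singleton, Nat.cast_zero, mul_zero, add_zero,
    norm_iteratedFDeriv_zero, Real.norm_eq_abs]

theorem lintegral_le_wEnergy_one (p γ : ℝ) (φ : ℝ → E3 → ℝ) :
    ∫⁻ x : E3, ENNReal.ofReal ((1 + ‖x‖) ^ (γ + 2) *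
      (‖fderiv ℝ (fderiv ℝ (φ 0)) x‖ ^ 2 + ‖fderiv ℝ (dt1 φ 0) x‖ ^ 2)) ≤ wEnergy p 1 γ φ := by
  unfold wEnergy
  refine le_add_right ?_
  rw [Finset.sum_range_succ]
  refine le_add_left (le_of_eq ?_)
  have h2 : ∀ x, ‖iteratedFDeriv ℝ 2 (φ 0) x‖ = ‖fderiv ℝ (fderiv ℝ (φ 0)) x‖ := fun x => by
    rw [← norm_iteratedFDeriv_fderiv, norm_iteratedFDeriv_one]
  norm_num [h2, norm_iteratedFDeriv_one]

theorem lintegral_potential_le_wEnergy (p γ : ℝ) (k : ℕ) (φ : ℝ → E3 → ℝ) :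
    ∫⁻ x : E3, ENNReal.ofReal ((1 + ‖x‖) ^ γ * |φ 0 x| ^ (p + 1)) ≤ wEnergy p k γ φ :=
  le_add_self

theorem wEnergy_zero_le_one (p γ : ℝ) (φ : ℝ → E3 → ℝ) : wEnergy p 0 γ φ ≤ wEnergy p 1 γ φ := by
  unfold wEnergy
  gcongr
  norm_num

theorem two_mul_ofReal (z : ℝ) : 2 * ENNReal.ofReal z = ENNReal.ofReal (2 * z) := by
  rw [ENNReal.ofReal_mul (by norm_num)]; simp

theorem enorm_rpow_eq (x : ℝ) {q : ℝ} (hq : 0 ≤ q) : ‖x‖ₑ ^ q = ENNReal.ofReal (|x| ^ q) := by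
  rw [Real.enorm_eq_ofReal_abs, ENNReal.ofReal_rpow_of_nonneg (abs_nonneg _) hq]

/-- The linear evolution in terms of the first order weighted energy. -/
theorem enorm_linPart_le_linKernel {p γ : ℝ} {φ : ℝ → E3 → ℝ} (hp : 0 ≤ p) (hγ : 0 ≤ γ)
    (h : ContDiff ℝ 2 fun q : ℝ × E3 => φ q.1 q.2) (hE : wEnergy p 1 γ φ < ⊤)
    {t₀ : ℝ} (ht₀ : 0 ≤ t₀) (x₀ : E3) :
    ‖linPart φ t₀ x₀‖ₑ ≤ 3 * (linKernel γ t₀ x₀ ^ (1 / 2 : ℝ) *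
      (2 * wEnergy p 1 γ φ) ^ (1 / 2 : ℝ)) := by
  have h0 : ContDiff ℝ 2 (φ 0) := contDiff_slice h 0
  have h1 : ContDiff ℝ 1 (dt1 φ 0) := contDiff_dt1 (n := 1) h 0
  have hw : ∀ x : E3, 1 ≤ (1 + ‖x‖) ^ γ := fun x =>
    Real.one_le_rpow (by linarith [norm_nonneg x]) hγ
  have hE0 := (wEnergy_zero_le_one p γ φ).trans_lt hE
  have i0 : ∫⁻ x, ‖φ 0 x‖ₑ ^ (p + 1) ≠ ⊤ := by
    refine (((lintegral_mono fun x => ?_).trans (lintegral_potential_le_wEnergy p γ 1 φ)).trans_lt hE).ne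
    rw [enorm_rpow_eq _ (by linarith)]
    exact ENNReal.ofReal_le_ofReal (le_mul_of_one_le_left (by positivity) (hw x))
  have i1 : ∫⁻ x, ‖fderiv ℝ (φ 0) x‖ₑ ^ (2 : ℝ) ≠ ⊤ := by
    refine (((lintegral_mono fun x => ?_).trans (lintegral_le_wEnergy_zero p γ φ)).trans_lt hE0).ne
    rw [← ofReal_norm, ENNReal.ofReal_rpow_of_nonneg (norm_nonneg _) (by norm_num), Real.rpow_two]
    refine ENNReal.ofReal_le_ofReal ?_
    nlinarith [hw x, sq_nonneg ‖fderiv ℝ (φ 0) x‖, sq_nonneg |dt1 φ 0 x|]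
  have i2 : ∫⁻ x, ‖dt1 φ 0 x‖ₑ ^ (2 : ℝ) ≠ ⊤ := by
    refine (((lintegral_mono fun x => ?_).trans (lintegral_le_wEnergy_zero p γ φ)).trans_lt hE0).ne
    rw [enorm_rpow_eq _ (by norm_num), Real.rpow_two]
    refine ENNReal.ofReal_le_ofReal ?_
    nlinarith [hw x, sq_nonneg ‖fderiv ℝ (φ 0) x‖, sq_nonneg |dt1 φ 0 x|]
  refine (enorm_linPart_le (by linarith) h0 h1 i0 i1 i2 ht₀ x₀).trans ?_
  gcongr
  have h2 : ContDiff ℝ 1 (fderiv ℝ (φ 0)) := contDiff_fderiv_one h0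
  have c2 := (h2.continuous_fderiv one_ne_zero).enorm
  have c1 := (h1.continuous_fderiv one_ne_zero).enorm
  set H : E3 → ℝ≥0∞ := fun y => ‖fderiv ℝ (fderiv ℝ (φ 0)) y‖ₑ + ‖fderiv ℝ (dt1 φ 0) y‖ₑ with hH
  have hHm : Measurable H := c2.measurable.add c1.measurable
  set f : E3 → ℝ≥0∞ := {y : E3 | t₀ < ‖y - x₀‖}.indicator
    (fun y => ENNReal.ofReal (‖y - x₀‖⁻¹ * (1 + ‖y‖) ^ (-((γ + 2) / 2)))) with hf
  set g : E3 → ℝ≥0∞ := fun y => ENNReal.ofReal ((1 + ‖y‖) ^ ((γ + 2) / 2)) * H y with hg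
  have hfm : Measurable f := Measurable.indicator (by fun_prop)
    (measurableSet_lt measurable_const (by fun_prop))
  have hgm : Measurable g := Measurable.mul (by fun_prop) hHm
  have hfg : ∀ y, {y : E3 | t₀ < ‖y - x₀‖}.indicator
      (fun y => ENNReal.ofReal (‖y - x₀‖⁻¹) * H y) y = (f * g) y := by
    intro y
    by_cases hy : y ∈ {y : E3 | t₀ < ‖y - x₀‖}
    · simp only [Pi.mul_apply, hf, hg, Set.indicator_of_mem hy]
      rw [← mul_assoc, ← ENNReal.ofReal_mul (by positivity), mul_assoc, ← Real.rpow_add (by positivity)]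
      simp
    · simp only [Pi.mul_apply, hf, Set.indicator_of_notMem hy, zero_mul]
  rw [lintegral_congr hfg]
  refine (ENNReal.lintegral_mul_le_Lp_mul_Lq volume Real.HolderConjugate.two_two
    hfm.aemeasurable hgm.aemeasurable).trans ?_
  gcongr
  · refine lintegral_mono fun y => ?_
    by_cases hy : y ∈ {y : E3 | t₀ < ‖y - x₀‖}
    · simp only [hf, Set.indicator_of_mem hy]
      rw [ENNReal.ofReal_rpow_of_nonneg (by positivity) (by norm_num),
        Real.mul_rpow (by positivity) (by positivity), ← Real.rpow_mul (by positivity),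
        Real.inv_rpow (by positivity), ← Real.rpow_neg (by positivity)]
      refine le_of_eq ?_
      congr 3; ring
    · simp only [hf, Set.indicator_of_notMem hy]
      simp
  · refine le_trans (lintegral_mono fun y => ?_) (le_trans (lintegral_const_mul' 2
      (fun x : E3 => ENNReal.ofReal ((1 + ‖x‖) ^ (γ + 2) *
      (‖fderiv ℝ (fderiv ℝ (φ 0)) x‖ ^ 2 + ‖fderiv ℝ (dt1 φ 0) x‖ ^ 2))) (by norm_num)).le
      (mul_le_mul_right (lintegral_le_wEnergy_one p γ φ) 2))
    simp only [hg, hH]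
    rw [← ofReal_norm, ← ofReal_norm, ← ENNReal.ofReal_add (by positivity) (by positivity),
      ← ENNReal.ofReal_mul (by positivity), ENNReal.ofReal_rpow_of_nonneg (by positivity) (by norm_num),
      Real.mul_rpow (by positivity) (by positivity), ← Real.rpow_mul (by positivity)]
    rw [two_mul_ofReal]
    refine ENNReal.ofReal_le_ofReal ?_
    rw [show (γ + 2) / 2 * 2 = γ + 2 by ring, Real.rpow_two, ← mul_assoc, mul_comm 2, mul_assoc]
    refine mul_le_mul_of_nonneg_left ?_ (by positivity)
    nlinarith [sq_nonneg (‖fderiv ℝ (fderiv ℝ (φ 0)) y‖ - ‖fderiv ℝ (dt1 φ 0) y‖)]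

theorem lintegral_Ioi_rpow_neg_two {r : ℝ} (hr : 0 < r) :
    ∫⁻ s in Set.Ioi r, ENNReal.ofReal (s ^ (-2 : ℝ)) = ENNReal.ofReal r⁻¹ := by
  rw [← ofReal_integral_eq_lintegral_ofReal (integrableOn_Ioi_rpow_of_lt (by norm_num) hr)]
  · rw [integral_Ioi_rpow_of_lt (by norm_num) hr]
    congr 1
    norm_num [Real.rpow_neg_one]
  · filter_upwards [ae_restrict_mem measurableSet_Ioi] with s hs
    have : 0 < s := hr.trans hs
    positivity

/-- Weighted Hardy inequality. -/
theorem lintegral_hardy_le {f : E3 → ℝ} (hf : ContDiff ℝ 1 f) {q : ℝ} (hq : 0 < q)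
    (hint : ∫⁻ x, ‖f x‖ₑ ^ q ≠ ⊤) {γ : ℝ} (hγ : 1 ≤ γ) :
    ∫⁻ x : E3, ENNReal.ofReal (‖x‖ ^ (γ - 2) * f x ^ 2)
      ≤ ∫⁻ x : E3, ENNReal.ofReal (‖x‖ ^ γ * ‖fderiv ℝ f x‖ ^ 2) := by
  have hfc := hf.continuous
  have hdc := hf.continuous_fderiv one_ne_zero
  have m1 : Measurable fun x : E3 => ENNReal.ofReal (‖x‖ ^ (γ - 2) * f x ^ 2) := by fun_prop
  have m2 : Measurable fun x : E3 => ENNReal.ofReal (‖x‖ ^ γ * ‖fderiv ℝ f x‖ ^ 2) := by fun_prop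
  have sw : ∀ {g : E3 → ℝ≥0∞}, Measurable g → ∫⁻ x, g x = ∫⁻ ω : Metric.sphere (0 : E3) 1,
      (∫⁻ s in Set.Ioi (0 : ℝ), ENNReal.ofReal (s ^ 2) * g (s • (ω : E3))) ∂sphereMeasure := by
    intro g hg
    rw [lintegral_polar 0 hg, lintegral_lintegral_swap]
    · simp
    · exact (Measurable.mul (by fun_prop) (hg.comp (by fun_prop))).aemeasurable
  rw [sw m1, sw m2]
  refine lintegral_mono_ae ?_
  filter_upwards [ae_enorm_ray_le hf hq hint 0] with ω hω
  simp only [zero_add] at hω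
  set G : ℝ → ℝ := fun s => ‖fderiv ℝ f (s • (ω : E3))‖ with hG
  have hGc : Continuous G := by fun_prop
  have key : ∀ r ∈ Set.Ioi (0 : ℝ), ENNReal.ofReal (r ^ 2) *
      ENNReal.ofReal (‖r • (ω : E3)‖ ^ (γ - 2) * f (r • (ω : E3)) ^ 2)
      ≤ ∫⁻ s in Set.Ioi r, ENNReal.ofReal (s ^ (γ + 1) * G s ^ 2) := by
    intro r hr
    have hr0 : 0 < r := hr
    rw [norm_sphere_smul hr0.le]
    have cs : ENNReal.ofReal (f (r • (ω : E3)) ^ 2) ≤ ENNReal.ofReal r⁻¹ *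
        ∫⁻ s in Set.Ioi r, ENNReal.ofReal (s ^ 2 * G s ^ 2) := by
      have h1 : ‖f (r • (ω : E3))‖ₑ ≤ (∫⁻ s in Set.Ioi r, ENNReal.ofReal (s ^ (-2 : ℝ))) ^ (1 / 2 : ℝ) *
          (∫⁻ s in Set.Ioi r, ENNReal.ofReal (s ^ 2 * G s ^ 2)) ^ (1 / 2 : ℝ) := by
        refine (hω r hr0.le).trans ?_
        have := ENNReal.lintegral_mul_le_Lp_mul_Lq (volume.restrict (Set.Ioi r))
          Real.HolderConjugate.two_two (f := fun s => ENNReal.ofReal s⁻¹)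
          (g := fun s => ENNReal.ofReal (s * G s)) (by fun_prop) (by fun_prop)
        refine le_trans (setLIntegral_mono' measurableSet_Ioi fun s hs => ?_) (this.trans ?_)
        · have hs0 : 0 < s := hr0.trans hs
          rw [Pi.mul_apply, ← ENNReal.ofReal_mul (by positivity), ← ofReal_norm]
          exact ENNReal.ofReal_le_ofReal (by rw [inv_mul_cancel_left₀ hs0.ne'])
        · gcongr ?_ ^ _ * ?_ ^ _
          · refine setLIntegral_mono' measurableSet_Ioi fun s hs => ?_
            have hs0 : 0 < s := hr0.trans hs
            rw [ENNReal.ofReal_rpow_of_nonneg (by positivity) (by norm_num), Real.inv_rpow hs0.le,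
              Real.rpow_neg hs0.le]
          · refine setLIntegral_mono' measurableSet_Ioi fun s hs => ?_
            have hs0 : 0 < s := hr0.trans hs
            rw [ENNReal.ofReal_rpow_of_nonneg (by positivity) (by norm_num), Real.rpow_two, mul_pow]
      have h2 : ENNReal.ofReal (f (r • (ω : E3)) ^ 2) = ‖f (r • (ω : E3))‖ₑ ^ (2 : ℝ) := by
        rw [enorm_rpow_eq _ (by norm_num), Real.rpow_two, sq_abs]
      rw [h2]
      refine (ENNReal.rpow_le_rpow h1 (by norm_num)).trans ?_
      rw [ENNReal.mul_rpow_of_nonneg _ _ (by norm_num), ← ENNReal.rpow_mul, ← ENNReal.rpow_mul,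
        lintegral_Ioi_rpow_neg_two hr0]
      norm_num
    rw [← ENNReal.ofReal_mul (by positivity), ← mul_assoc, ENNReal.ofReal_mul (by positivity)]
    refine (mul_le_mul_right cs _).trans ?_
    rw [← mul_assoc, ← ENNReal.ofReal_mul (by positivity), ← lintegral_const_mul' _ _ ENNReal.ofReal_ne_top]
    refine setLIntegral_mono' measurableSet_Ioi fun s hs => ?_
    have hs' : r ≤ s := le_of_lt hs
    have hs0 : 0 < s := hr0.trans hs
    rw [← ENNReal.ofReal_mul (by positivity), ← mul_assoc]
    refine ENNReal.ofReal_le_ofReal (mul_le_mul_of_nonneg_right ?_ (by positivity))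
    have e1 : r ^ 2 * r ^ (γ - 2) * r⁻¹ = r ^ (γ - 1) := by
      rw [← Real.rpow_natCast, ← Real.rpow_add hr0, ← Real.rpow_neg_one, ← Real.rpow_add hr0]
      congr 1; push_cast; ring
    have e2 : s ^ (γ + 1) = s ^ (γ - 1) * s ^ 2 := by
      rw [← Real.rpow_natCast, ← Real.rpow_add hs0]; congr 1; push_cast; ring
    rw [e1, e2]
    gcongr
  refine (setLIntegral_mono' measurableSet_Ioi key).trans
    ((lintegral_Ioi_lintegral_Ioi (by fun_prop) le_rfl).trans
      (setLIntegral_mono' measurableSet_Ioi fun s hs => ?_))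
  have hs0 : 0 < s := hs
  rw [← ENNReal.ofReal_mul (by positivity), ← ENNReal.ofReal_mul (by positivity),
    norm_sphere_smul hs0.le, ← mul_assoc, ← mul_assoc]
  refine le_of_eq ?_
  congr 2
  rw [← Real.rpow_natCast, ← Real.rpow_add hs0, mul_comm, ← Real.rpow_add_one hs0.ne']
  congr 1; push_cast; ring

/-- Primitive in time, `(τ, x) ↦ ∫₀^τ J(t, x) dt`, written over a fixed interval. -/
def timePrim (J : ℝ × E3 → ℝ) (z : ℝ × E3) : ℝ :=
  z.1 * ∫ σ : unitInterval, J (z.1 * (σ : ℝ), z.2)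

theorem mul_integral_unitInterval (f : ℝ → ℝ) (τ : ℝ) :
    τ * ∫ σ : unitInterval, f (τ * (σ : ℝ)) = ∫ t in (0 : ℝ)..τ, f t := by
  have h1 : ∫ σ : unitInterval, f (τ * (σ : ℝ)) = ∫ σ in Set.Icc (0 : ℝ) 1, f (τ * σ) :=
    integral_subtype_comap measurableSet_Icc (fun σ : ℝ => f (τ * σ))
  rw [h1, integral_Icc_eq_integral_Ioc, ← intervalIntegral.integral_of_le zero_le_one]
  simp

theorem timePrim_eq (J : ℝ × E3 → ℝ) (τ : ℝ) (x : E3) :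
    timePrim J (τ, x) = ∫ t in (0 : ℝ)..τ, J (t, x) :=
  mul_integral_unitInterval (fun t => J (t, x)) τ

/-- Scaling of the time variable. -/
def scaleTime (σ : ℝ) : (ℝ × E3) →L[ℝ] ℝ × E3 :=
  (σ • ContinuousLinearMap.fst ℝ ℝ E3).prod (ContinuousLinearMap.snd ℝ ℝ E3)

theorem scaleTime_apply (σ : ℝ) (z : ℝ × E3) : scaleTime σ z = (z.1 * σ, z.2) := by
  simp [scaleTime, mul_comm]

theorem continuous_scaleTime : Continuous scaleTime := by
  have e : scaleTime = fun σ : ℝ => σ • ((ContinuousLinearMap.fst ℝ ℝ E3).prod 0) +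
      (0 : (ℝ × E3) →L[ℝ] ℝ).prod (ContinuousLinearMap.snd ℝ ℝ E3) := by
    funext σ
    ext z <;> simp [scaleTime]
  rw [e]
  exact (continuous_id.smul continuous_const).add continuous_const

theorem contDiff_timePrim {J : ℝ × E3 → ℝ} (hJ : ContDiff ℝ 1 J) : ContDiff ℝ 1 (timePrim J) := by
  refine contDiff_fst.mul ?_
  have hd := hJ.continuous_fderiv one_ne_zero
  have hF : Continuous (fun (z : ℝ × E3) (σ : unitInterval) => J (z.1 * (σ : ℝ), z.2)).uncurry := by
    refine hJ.continuous.comp ?_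
    fun_prop
  have hF' : Continuous (fun (z : ℝ × E3) (σ : unitInterval) =>
      (fderiv ℝ J (z.1 * (σ : ℝ), z.2)).comp (scaleTime σ)).uncurry := by
    have h1 : Continuous fun w : (ℝ × E3) × unitInterval =>
        fderiv ℝ J (w.1.1 * (w.2 : ℝ), w.1.2) := hd.comp (by fun_prop)
    have h2 : Continuous fun w : (ℝ × E3) × unitInterval => scaleTime (w.2 : ℝ) :=
      continuous_scaleTime.comp (by fun_prop)
    exact h1.clm_comp h2
  have h : ∀ (z : ℝ × E3) (σ : unitInterval), HasFDerivAt (fun z : ℝ × E3 => J (z.1 * (σ : ℝ), z.2))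
      ((fderiv ℝ J (z.1 * (σ : ℝ), z.2)).comp (scaleTime σ)) z := by
    intro z σ
    have e : (fun z : ℝ × E3 => J (z.1 * (σ : ℝ), z.2)) = J ∘ scaleTime σ := by
      ext w; simp [scaleTime_apply]
    rw [e, ← scaleTime_apply]
    exact ((hJ.differentiable one_ne_zero) _).hasFDerivAt.comp z (scaleTime (σ : ℝ)).hasFDerivAt
  have hder := fun z => hasFDerivAt_integral_of_compactSpace (μ := (volume : Measure unitInterval))
    hF hF' h z
  rw [contDiff_one_iff_fderiv]
  refine ⟨fun z => (hder z).differentiableAt, ?_⟩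
  have := continuous_integral_of_compactSpace (μ := (volume : Measure unitInterval)) hF'
  refine this.congr fun z => (hder z).fderiv.symm

theorem fderiv_timePrim_time {J : ℝ × E3 → ℝ} (hJ : ContDiff ℝ 1 J) (τ : ℝ) (x : E3) :
    fderiv ℝ (timePrim J) (τ, x) (1, 0) = J (τ, x) := by
  have h1 : HasDerivAt (fun s : ℝ => ((s, x) : ℝ × E3)) (1, 0) τ :=
    (hasDerivAt_id τ).prodMk (hasDerivAt_const τ x)
  have h2 := (((contDiff_timePrim hJ).differentiable one_ne_zero) (τ, x)).hasFDerivAt.comp_hasDerivAt τ h1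
  have hc : Continuous fun t : ℝ => J (t, x) := hJ.continuous.comp (by fun_prop)
  have h3 : HasDerivAt (fun s : ℝ => ∫ t in (0 : ℝ)..s, J (t, x)) (J (τ, x)) τ :=
    intervalIntegral.integral_hasDerivAt_right (hc.intervalIntegrable _ _)
      (hc.stronglyMeasurableAtFilter _ _) hc.continuousAt
  have e : (timePrim J ∘ fun s : ℝ => ((s, x) : ℝ × E3)) = fun s => ∫ t in (0 : ℝ)..s, J (t, x) := by
    ext s; exact timePrim_eq J s x
  rw [e] at h2
  exact h2.unique h3

theorem fderiv_timePrim_space {J : ℝ × E3 → ℝ} (hJ : ContDiff ℝ 1 J) (τ : ℝ) (x v : E3) :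
    fderiv ℝ (timePrim J) (τ, x) (0, v) = ∫ t in (0 : ℝ)..τ, fderiv ℝ J (t, x) (0, v) := by
  have h1 : HasDerivAt (fun s : ℝ => ((τ, x + s • v) : ℝ × E3)) (0, v) 0 := by
    have : HasDerivAt (fun s : ℝ => x + s • v) v 0 := by
      simpa using ((hasDerivAt_id (0 : ℝ)).smul_const v).const_add x
    exact (hasDerivAt_const _ _).prodMk this
  have hx : ((τ, x) : ℝ × E3) = (fun s : ℝ => ((τ, x + s • v) : ℝ × E3)) 0 := by simp
  have h2 := (((contDiff_timePrim hJ).differentiable one_ne_zero) (τ, x)).hasFDerivAt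
  rw [hx] at h2
  have h2' := h2.comp_hasDerivAt (0 : ℝ) h1
  rw [← hx] at h2'
  have hd := hJ.continuous_fderiv one_ne_zero
  have h3 := hasDerivAt_integral_of_compactSpace (μ := (volume : Measure unitInterval))
    (F := fun (s : ℝ) (σ : unitInterval) => J (τ * (σ : ℝ), x + s • v))
    (F' := fun (s : ℝ) (σ : unitInterval) => fderiv ℝ J (τ * (σ : ℝ), x + s • v) (0, v))
    (hJ.continuous.comp (by fun_prop))
    ((hd.comp (by fun_prop : Continuous fun w : ℝ × unitInterval =>
      ((τ * (w.2 : ℝ), x + w.1 • v) : ℝ × E3))).clm_apply continuous_const)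
    (fun s σ => by
      have a1 : HasDerivAt (fun s : ℝ => ((τ * (σ : ℝ), x + s • v) : ℝ × E3)) (0, v) s := by
        have : HasDerivAt (fun s : ℝ => x + s • v) v s := by
          simpa using ((hasDerivAt_id s).smul_const v).const_add x
        exact (hasDerivAt_const _ _).prodMk this
      exact ((hJ.differentiable one_ne_zero) _).hasFDerivAt.comp_hasDerivAt s a1) 0
  have h4 := h3.const_mul τ
  have e := h2'.unique h4
  rw [e]
  simp only [zero_smul, add_zero]
  exact mul_integral_unitInterval (fun t => fderiv ℝ J (t, x) (0, v)) τ

theorem integral_lineDeriv_eq_zero {K : E3 → ℝ} {L : NNReal} (hK : LipschitzWith L K)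
    (hc : HasCompactSupport K) (v : E3) :
    Integrable (fun x => lineDeriv ℝ K x v) ∧ ∫ x, lineDeriv ℝ K x v = 0 := by
  have hcL : HasCompactSupport fun x => lineDeriv ℝ K x v := by
    refine hc.mono' fun x hx => ?_
    by_contra hxt
    refine hx ?_
    have : K =ᶠ[nhds x] fun _ => (0 : ℝ) := notMem_tsupport_iff_eventuallyEq.1 hxt
    show lineDeriv ℝ K x v = 0
    rw [this.lineDeriv_eq]
    simp [lineDeriv]
  refine ⟨?_, ?_⟩
  · have hm : AEStronglyMeasurable (fun x => lineDeriv ℝ K x v) :=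
      (measurable_lineDeriv hK.continuous).aestronglyMeasurable
    have hon : IntegrableOn (fun x => lineDeriv ℝ K x v) (tsupport fun x => lineDeriv ℝ K x v) := by
      refine Measure.integrableOn_of_bounded (M := L * ‖v‖) hcL.isCompact.measure_lt_top.ne hm ?_
      exact Filter.Eventually.of_forall fun x => norm_lineDeriv_le_of_lipschitz ℝ hK
    rwa [integrableOn_iff_integrable_of_support_subset (subset_tsupport _)] at hon
  · have h := LipschitzWith.integral_lineDeriv_mul_eq (μ := (volume : Measure E3))
      (LipschitzWith.const (1 : ℝ)) hK hc (-v)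
    simp only [neg_neg, mul_one] at h
    rw [← h]
    simp [lineDeriv]

/-- Divergence theorem on the region below a Lipschitz graph `t = h(x)`. -/
theorem exists_divergence_le {J : Fin 3 → ℝ × E3 → ℝ} (hJ : ∀ i, ContDiff ℝ 1 (J i))
    {J0 J0' : ℝ → E3 → ℝ} {h : E3 → ℝ} {L : NNReal} (hh : LipschitzWith L h) (hc : HasCompactSupport h)
    (h0 : ∀ x, 0 ≤ h x)
    (hder : ∀ x, 0 < h x → ∀ t, 0 ≤ t → HasDerivAt (fun t => J0 t x) (J0' t x) t)
    (hdiv : ∀ x, 0 < h x → ∀ t, 0 ≤ t →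
      J0' t x + ∑ i, fderiv ℝ (J i) (t, x) (0, EuclideanSpace.single i 1) ≤ 0) :
    ∃ D : E3 → ℝ, Integrable D ∧ ∫ x, D x = 0 ∧ ∀ᵐ x, DifferentiableAt ℝ h x ∧
      (h x = 0 → D x = 0) ∧ (0 < h x → D x ≤
        ∑ i, J i (h x, x) * fderiv ℝ h x (EuclideanSpace.single i 1) - J0 (h x) x + J0 0 x) := by
  have hhx : LipschitzWith (max L 1) fun x => ((h x, x) : ℝ × E3) := hh.prodMk LipschitzWith.id
  -- a compact set containing the graph
  have hS : IsCompact ((fun x => ((h x, x) : ℝ × E3)) '' tsupport h) :=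
    hc.isCompact.image hhx.continuous
  obtain ⟨R, hR⟩ := hS.isBounded.subset_ball (0 : ℝ × E3)
  set θ : ContDiffBump (0 : ℝ × E3) := ⟨max R 1, max R 1 + 1, by positivity, by linarith⟩ with hθ
  have hθ1 : ∀ x ∈ tsupport h, θ (h x, x) = 1 := fun x hx => by
    refine θ.one_of_mem_closedBall (Metric.closedBall_subset_closedBall (le_max_left R 1)
      (Metric.ball_subset_closedBall (hR ⟨x, hx, rfl⟩)))
  set K : Fin 3 → E3 → ℝ := fun i x => timePrim (J i) (h x, x) with hK
  have hK0 : ∀ i x, h x = 0 → K i x = 0 := fun i x hx => by simp [hK, timePrim, hx]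
  have hKc : ∀ i, HasCompactSupport (K i) := fun i =>
    hc.mono fun x hx hx0 => hx (hK0 i x hx0)
  have hKL : ∀ i, ∃ M, LipschitzWith M (K i) := by
    intro i
    have c1 : ContDiff ℝ 1 fun z => θ z * timePrim (J i) z :=
      (θ.contDiff (n := 1)).mul (contDiff_timePrim (hJ i))
    obtain ⟨M, hM⟩ := c1.lipschitzWith_of_hasCompactSupport (θ.hasCompactSupport.mul_right) one_ne_zero
    have e : K i = (fun z => θ z * timePrim (J i) z) ∘ fun x => ((h x, x) : ℝ × E3) := by
      funext x
      by_cases hx : x ∈ tsupport h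
      · simp [hK, hθ1 x hx]
      · simp [hK, timePrim, image_eq_zero_of_notMem_tsupport hx]
    rw [e]
    exact ⟨_, hM.comp hhx⟩
  choose M hM using hKL
  refine ⟨fun x => ∑ i, lineDeriv ℝ (K i) x (EuclideanSpace.single i 1), ?_, ?_, ?_⟩
  · exact integrable_finsetSum _ fun i _ => (integral_lineDeriv_eq_zero (hM i) (hKc i) _).1
  · rw [integral_finsetSum _ fun i _ => (integral_lineDeriv_eq_zero (hM i) (hKc i) _).1]
    exact Finset.sum_eq_zero fun i _ => (integral_lineDeriv_eq_zero (hM i) (hKc i) _).2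
  filter_upwards [hh.ae_differentiableAt] with x hx
  have hl : ∀ i (v : E3), lineDeriv ℝ (K i) x v = J i (h x, x) * fderiv ℝ h x v +
      ∫ t in (0 : ℝ)..h x, fderiv ℝ (J i) (t, x) (0, v) := by
    intro i v
    have a1 : HasFDerivAt (fun x => ((h x, x) : ℝ × E3))
        ((fderiv ℝ h x).prod (ContinuousLinearMap.id ℝ E3)) x := hx.hasFDerivAt.prodMk (hasFDerivAt_id x)
    have a2 : HasFDerivAt (K i) ((fderiv ℝ (timePrim (J i)) (h x, x)).comp
        ((fderiv ℝ h x).prod (ContinuousLinearMap.id ℝ E3))) x :=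
      HasFDerivAt.comp (f := fun y : E3 => ((h y, y) : ℝ × E3)) x
        (((contDiff_timePrim (hJ i)).differentiable one_ne_zero) (h x, x)).hasFDerivAt a1
    rw [(a2.hasLineDerivAt v).lineDeriv]
    simp only [ContinuousLinearMap.comp_apply, ContinuousLinearMap.prod_apply,
      ContinuousLinearMap.id_apply]
    have : ((fderiv ℝ h x v, v) : ℝ × E3) = fderiv ℝ h x v • ((1, 0) : ℝ × E3) + (0, v) := by simp
    rw [this, map_add, map_smul, fderiv_timePrim_time (hJ i), fderiv_timePrim_space (hJ i),
      smul_eq_mul, mul_comm]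
  refine ⟨hx, fun hx0 => ?_, fun hpos => ?_⟩
  · have hmin : IsLocalMin h x := Filter.Eventually.of_forall fun y => by rw [hx0]; exact h0 y
    simp [hl, hmin.fderiv_eq_zero, hx0]
  · simp_rw [hl]
    rw [Finset.sum_add_distrib]
    set m : ℝ → ℝ := fun τ => J0 τ x +
      ∑ i, ∫ t in (0 : ℝ)..τ, fderiv ℝ (J i) (t, x) (0, EuclideanSpace.single i 1) with hm
    have hcd : ∀ i, Continuous fun t : ℝ => fderiv ℝ (J i) (t, x) (0, EuclideanSpace.single i 1) :=
      fun i => (((hJ i).continuous_fderiv one_ne_zero).comp (by fun_prop :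
        Continuous fun t : ℝ => ((t, x) : ℝ × E3))).clm_apply continuous_const
    have hmd : ∀ τ, 0 ≤ τ → HasDerivAt m
        (J0' τ x + ∑ i, fderiv ℝ (J i) (τ, x) (0, EuclideanSpace.single i 1)) τ := by
      intro τ hτ
      refine (hder x hpos τ hτ).add (HasDerivAt.fun_sum fun i _ => ?_)
      exact intervalIntegral.integral_hasDerivAt_right ((hcd i).intervalIntegrable _ _)
        ((hcd i).stronglyMeasurableAtFilter _ _) (hcd i).continuousAt
    have hanti : AntitoneOn m (Set.Icc 0 (h x)) := by
      refine antitoneOn_of_deriv_nonpos (convex_Icc _ _)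
        (fun τ hτ => (hmd τ hτ.1).continuousAt.continuousWithinAt)
        (fun τ hτ => (hmd τ (interior_subset hτ).1).differentiableAt.differentiableWithinAt)
        (fun τ hτ => ?_)
      have hτ0 := (interior_subset hτ).1
      rw [(hmd τ hτ0).deriv]
      exact hdiv x hpos τ hτ0
    have := hanti (Set.left_mem_Icc.2 hpos.le) (Set.right_mem_Icc.2 hpos.le) hpos.le
    simp only [hm, intervalIntegral.integral_same, Finset.sum_const_zero, add_zero] at this
    linarith

/-- Density of the weighted energy current, in terms of `ρ = 1/|x|`, the weight `W`, the potential
`V`, and the values `u, v, d` of the solution, its time derivative and its gradient. -/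
def curDensity (ρ W V u v : ℝ) (x d : Fin 3 → ℝ) : ℝ :=
  W * ((v + ρ * u) ^ 2 / 2 + ρ * (v + ρ * u) * (∑ j, x j * d j) + (∑ j, d j ^ 2) / 2 + V)
    + (v ^ 2 + (∑ j, d j ^ 2) + 2 * V)

/-- Flux of the weighted energy current. -/
def curFlux (ρ W V u v : ℝ) (x d : Fin 3 → ℝ) (i : Fin 3) : ℝ :=
  ρ * W * ((∑ j, d j ^ 2) / 2 + V - (v + ρ * u) ^ 2 / 2) * x i
    - W * (v + ρ * u + ρ * ∑ j, x j * d j) * d i - 2 * v * d i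

/-- Time derivative of the density. -/
def curDensityDt (ρ W V' u v vt : ℝ) (x d dv : Fin 3 → ℝ) : ℝ :=
  W * ((v + ρ * u) * (vt + ρ * v) + ρ * (vt + ρ * v) * (∑ j, x j * d j)
      + ρ * (v + ρ * u) * (∑ j, x j * dv j) + (∑ j, d j * dv j) + V' * v)
    + (2 * v * vt + 2 * (∑ j, d j * dv j) + 2 * V' * v)

/-- Derivative of the flux component `i` in the direction `i`;
`h j` is the `i`-th derivative of `d j`. -/
def curFluxDi (γ ρ W V V' u v : ℝ) (x d dv h : Fin 3 → ℝ) (i : Fin 3) : ℝ :=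
  (γ - 1) * ρ ^ 3 * W * x i * ((∑ j, d j ^ 2) / 2 + V - (v + ρ * u) ^ 2 / 2) * x i
    + ρ * W * ((∑ j, d j * h j) + V' * d i
      - (v + ρ * u) * (dv i + ρ * d i - ρ ^ 3 * x i * u)) * x i
    + ρ * W * ((∑ j, d j ^ 2) / 2 + V - (v + ρ * u) ^ 2 / 2)
    - γ * ρ ^ 2 * W * x i * (v + ρ * u + ρ * ∑ j, x j * d j) * d i
    - W * (dv i + ρ * d i - ρ ^ 3 * x i * u - ρ ^ 3 * x i * (∑ j, x j * d j)
      + ρ * (d i + ∑ j, x j * h j)) * d i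
    - W * (v + ρ * u + ρ * ∑ j, x j * d j) * h i
    - 2 * dv i * d i - 2 * v * h i

theorem hasDerivAt_curDensity {ρ W : ℝ} {x : Fin 3 → ℝ} {V u v : ℝ → ℝ} {d : Fin 3 → ℝ → ℝ}
    {V' vt : ℝ} {dv : Fin 3 → ℝ} {t : ℝ} (hu : HasDerivAt u (v t) t) (hv : HasDerivAt v vt t)
    (hd : ∀ j, HasDerivAt (d j) (dv j) t) (hV : HasDerivAt V (V' * v t) t) :
    HasDerivAt (fun s => curDensity ρ W (V s) (u s) (v s) x (fun j => d j s))
      (curDensityDt ρ W V' (u t) (v t) vt x (fun j => d j t) dv) t := by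
  have hA : HasDerivAt (fun s => v s + ρ * u s) (vt + ρ * v t) t := hv.add (hu.const_mul ρ)
  have hS : HasDerivAt (fun s => ∑ j, x j * d j s) (∑ j, x j * dv j) t :=
    HasDerivAt.fun_sum fun j _ => (hd j).const_mul (x j)
  have hN : HasDerivAt (fun s => ∑ j, d j s ^ 2) (∑ j, 2 * d j t * dv j) t :=
    HasDerivAt.fun_sum fun j _ => by simpa using (hd j).fun_pow 2
  refine (((((((hA.fun_pow 2).div_const 2).add ((hA.const_mul ρ).mul hS)).add
    (hN.div_const 2)).add hV).const_mul W).add (((hv.fun_pow 2).add hN).add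
      (hV.const_mul 2))).congr_deriv ?_
  simp only [curDensityDt, Fin.sum_univ_three]
  ring

theorem hasDerivAt_curFlux {γ : ℝ} {ρ W V u v : ℝ → ℝ} {x d : Fin 3 → ℝ → ℝ}
    {V' : ℝ} {dv h : Fin 3 → ℝ} {s : ℝ} {i : Fin 3}
    (hρ : HasDerivAt ρ (-(ρ s ^ 3 * x i s)) s) (hW : HasDerivAt W (γ * ρ s ^ 2 * W s * x i s) s)
    (hx : ∀ j, HasDerivAt (x j) (if j = i then 1 else 0) s)
    (hu : HasDerivAt u (d i s) s) (hv : HasDerivAt v (dv i) s)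
    (hd : ∀ j, HasDerivAt (d j) (h j) s) (hV : HasDerivAt V (V' * d i s) s) :
    HasDerivAt (fun s => curFlux (ρ s) (W s) (V s) (u s) (v s) (fun j => x j s) (fun j => d j s) i)
      (curFluxDi γ (ρ s) (W s) (V s) V' (u s) (v s) (fun j => x j s) (fun j => d j s) dv h i) s := by
  have hA := hv.add (hρ.mul hu)
  have hS : HasDerivAt (fun s => ∑ j, x j s * d j s)
      (∑ j, ((if j = i then 1 else 0) * d j s + x j s * h j)) s :=
    HasDerivAt.fun_sum fun j _ => (hx j).mul (hd j)
  have hN : HasDerivAt (fun s => ∑ j, d j s ^ 2) (∑ j, 2 * d j s * h j) s :=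
    HasDerivAt.fun_sum fun j _ => by simpa using (hd j).fun_pow 2
  refine (((((hρ.mul hW).mul (((hN.div_const 2).add hV).sub ((hA.fun_pow 2).div_const 2))).mul
    (hx i)).sub ((hW.mul (hA.add (hρ.mul hS))).mul (hd i))).sub
      ((hv.const_mul 2).mul (hd i))).congr_deriv ?_
  simp only [Finset.sum_add_distrib, ite_mul, one_mul, zero_mul, Finset.sum_ite_eq',
    Finset.mem_univ, if_true, curFluxDi, Pi.add_apply, Pi.mul_apply, Fin.sum_univ_three]
  simp
  ring

theorem curDensityDt_add_sum_le {γ p ρ W V V' u v vt : ℝ} {x d dv : Fin 3 → ℝ}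
    {H : Fin 3 → Fin 3 → ℝ} (hsymm : ∀ i j, H i j = H j i) (hX : ρ ^ 2 * (∑ j, x j ^ 2) = 1)
    (heq : vt = (∑ i, H i i) - V') (hV : V' * u = (p + 1) * V) (hγ : 0 ≤ γ) (hγ2 : γ ≤ 2)
    (hp : γ ≤ p - 1) (hρ : 0 ≤ ρ) (hW : 0 ≤ W) (hV0 : 0 ≤ V) :
    curDensityDt ρ W V' u v vt x d dv + ∑ i, curFluxDi γ ρ W V V' u v x d dv (H i) i ≤ 0 := by
  have hS : ρ ^ 2 * (∑ j, x j * d j) ^ 2 ≤ ∑ j, d j ^ 2 := by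
    have := mul_le_mul_of_nonneg_left (Finset.sum_mul_sq_le_sq_mul_sq Finset.univ x d) (sq_nonneg ρ)
    rwa [← mul_assoc, hX, one_mul] at this
  have key : curDensityDt ρ W V' u v vt x d dv + ∑ i, curFluxDi γ ρ W V V' u v x d dv (H i) i =
      -(γ / 2 * (W * ρ) * (v + ρ * u + ρ * (∑ j, x j * d j)) ^ 2
        + (2 - γ) / 2 * (W * ρ) * ((∑ j, d j ^ 2) - ρ ^ 2 * (∑ j, x j * d j) ^ 2)
        + (p - 1 - γ) * (W * ρ) * V) := by
    have h01 := hsymm 0 1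
    have h02 := hsymm 0 2
    have h12 := hsymm 1 2
    simp only [curDensityDt, curFluxDi, Fin.sum_univ_three] at *
    rw [heq, h01, h02, h12]
    linear_combination ((γ - 1) * ρ * W * ((d 0 ^ 2 + d 1 ^ 2 + d 2 ^ 2) / 2 + V
      - (v + ρ * u) ^ 2 / 2) + ρ ^ 2 * W * (v + ρ * u) * u) * hX - W * ρ * hV
  rw [key]
  have h1 : 0 ≤ W * ρ := mul_nonneg hW hρ
  have h2 : 0 ≤ (∑ j, d j ^ 2) - ρ ^ 2 * (∑ j, x j * d j) ^ 2 := by linarith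
  have h3 : 0 ≤ p - 1 - γ := by linarith
  have h4 : 0 ≤ 2 - γ := by linarith
  have : 0 ≤ γ / 2 * (W * ρ) * (v + ρ * u + ρ * (∑ j, x j * d j)) ^ 2 := by positivity
  have : 0 ≤ (2 - γ) / 2 * (W * ρ) * ((∑ j, d j ^ 2) - ρ ^ 2 * (∑ j, x j * d j) ^ 2) := by positivity
  have : 0 ≤ (p - 1 - γ) * (W * ρ) * V := by positivity
  linarith

/-- Flux through a backward light cone with vertex direction `ω`. -/
theorem sum_curFlux_cone_le {ρ W V u v : ℝ} {x d ω : Fin 3 → ℝ} (hX : ρ ^ 2 * (∑ j, x j ^ 2) = 1)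
    (hω : ∑ j, ω j ^ 2 = 1) (hW : 0 ≤ W) :
    (W * (1 + ρ * ∑ j, x j * ω j) + 2) * V ≤
      curDensity ρ W V u v x d - ∑ i, curFlux ρ W V u v x d i * (-ω i) := by
  set A := v + ρ * u with hA
  set N := ∑ j, d j ^ 2 with hN
  set P := ρ * ∑ j, x j * d j with hP
  set σ := ∑ j, ω j * d j with hσ
  set τ := ρ * ∑ j, x j * ω j with hτ
  have e : curDensity ρ W V u v x d - ∑ i, curFlux ρ W V u v x d i * (-ω i) =
      (W * (1 + τ) + 2) * V + W * ((1 - τ) / 2 * A ^ 2 + A * (P - σ) + ((1 + τ) / 2 * N - P * σ))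
        + (v ^ 2 + N - 2 * v * σ) := by
    simp only [curDensity, curFlux, hA, hN, hP, hσ, hτ, Fin.sum_univ_three]
    ring
  have hgram : P ^ 2 + σ ^ 2 - 2 * τ * P * σ ≤ (1 - τ ^ 2) * N := by
    have : (1 - τ ^ 2) * N - (P ^ 2 + σ ^ 2 - 2 * τ * P * σ) =
        ρ ^ 2 * (x 0 * (ω 1 * d 2 - ω 2 * d 1) - x 1 * (ω 0 * d 2 - ω 2 * d 0)
          + x 2 * (ω 0 * d 1 - ω 1 * d 0)) ^ 2 := by
      simp only [hN, hP, hσ, hτ, Fin.sum_univ_three] at *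
      linear_combination (-(d 0 ^ 2 + d 1 ^ 2 + d 2 ^ 2)
        + (ω 0 * d 0 + ω 1 * d 1 + ω 2 * d 2) ^ 2) * hX
        + (-(ρ ^ 2 * (x 0 ^ 2 + x 1 ^ 2 + x 2 ^ 2)) * (d 0 ^ 2 + d 1 ^ 2 + d 2 ^ 2)
        + (ρ * (x 0 * d 0 + x 1 * d 1 + x 2 * d 2)) ^ 2) * hω
    have h2 : 0 ≤ ρ ^ 2 * (x 0 * (ω 1 * d 2 - ω 2 * d 1) - x 1 * (ω 0 * d 2 - ω 2 * d 0)
          + x 2 * (ω 0 * d 1 - ω 1 * d 0)) ^ 2 := by positivity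
    linarith
  have hσN : σ ^ 2 ≤ N := by
    have := Finset.sum_mul_sq_le_sq_mul_sq Finset.univ ω d
    rwa [hω, one_mul] at this
  have hPN : P ^ 2 ≤ N := by
    have := mul_le_mul_of_nonneg_left (Finset.sum_mul_sq_le_sq_mul_sq Finset.univ x d) (sq_nonneg ρ)
    rw [← mul_assoc, hX, one_mul] at this
    rw [hP, mul_pow]; exact this
  have hτ1 : τ ≤ 1 := by
    have h1 := mul_le_mul_of_nonneg_left (Finset.sum_mul_sq_le_sq_mul_sq Finset.univ x ω)
      (sq_nonneg ρ)
    rw [hω, mul_one, hX] at h1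
    have : τ ^ 2 ≤ 1 := by rw [hτ, mul_pow]; exact h1
    nlinarith
  have hq : 0 ≤ (1 - τ) / 2 * A ^ 2 + A * (P - σ) + ((1 + τ) / 2 * N - P * σ) := by
    rcases hτ1.lt_or_eq with h | h
    · have h1 : 0 ≤ 2 * (1 - τ) * ((1 - τ) / 2 * A ^ 2 + A * (P - σ) + ((1 + τ) / 2 * N - P * σ)) := by
        nlinarith [sq_nonneg ((1 - τ) * A + (P - σ))]
      exact nonneg_of_mul_nonneg_right h1 (by linarith)
    · rw [h] at hgram ⊢
      have : P - σ = 0 := by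
        have : (P - σ) ^ 2 ≤ 0 := by nlinarith
        exact pow_eq_zero_iff two_ne_zero |>.1 (le_antisymm this (sq_nonneg _))
      have h2 : P = σ := by linarith
      rw [h2]
      nlinarith
  have := mul_nonneg hW hq
  nlinarith [sq_nonneg (v - σ)]

/-- Flux through the outgoing cone `t = |x| - c`. -/
theorem sum_curFlux_radial_le {ρ W V u v : ℝ} {x d : Fin 3 → ℝ} (hX : ρ ^ 2 * (∑ j, x j ^ 2) = 1)
    (hW : 0 ≤ W) (hV : 0 ≤ V) :
    0 ≤ curDensity ρ W V u v x d - ∑ i, curFlux ρ W V u v x d i * (ρ * x i) := by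
  set A := v + ρ * u with hA
  set N := ∑ j, d j ^ 2 with hN
  set P := ρ * ∑ j, x j * d j with hP
  have e : curDensity ρ W V u v x d - ∑ i, curFlux ρ W V u v x d i * (ρ * x i) =
      W * (A + P) ^ 2 + (v ^ 2 + N + 2 * v * P) + 2 * V := by
    simp only [curDensity, curFlux, hA, hN, hP, Fin.sum_univ_three] at *
    linear_combination (-(W * ((d 0 ^ 2 + d 1 ^ 2 + d 2 ^ 2) / 2 + V - (v + ρ * u) ^ 2 / 2))) * hX
  have hPN : P ^ 2 ≤ N := by
    have := mul_le_mul_of_nonneg_left (Finset.sum_mul_sq_le_sq_mul_sq Finset.univ x d) (sq_nonneg ρ)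
    rw [← mul_assoc, hX, one_mul] at this
    rw [hP, mul_pow]; exact this
  rw [e]
  have : 0 ≤ W * (A + P) ^ 2 := by positivity
  nlinarith [sq_nonneg (v + P)]

theorem curDensity_le {ρ W V u v : ℝ} {x d : Fin 3 → ℝ} (hX : ρ ^ 2 * (∑ j, x j ^ 2) = 1)
    (hW : 1 ≤ W) (hV : 0 ≤ V) :
    curDensity ρ W V u v x d ≤
      3 * (W * (∑ j, d j ^ 2 + v ^ 2)) + 2 * (W * ρ ^ 2 * u ^ 2) + 3 * (W * V) := by
  set N := ∑ j, d j ^ 2 with hN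
  set P := ρ * ∑ j, x j * d j with hP
  have hPN : P ^ 2 ≤ N := by
    have := mul_le_mul_of_nonneg_left (Finset.sum_mul_sq_le_sq_mul_sq Finset.univ x d) (sq_nonneg ρ)
    rw [← mul_assoc, hX, one_mul] at this
    rw [hP, mul_pow]; exact this
  have hN0 : 0 ≤ N := (sq_nonneg P).trans hPN
  have e : curDensity ρ W V u v x d =
      W * ((v + ρ * u) ^ 2 / 2 + (v + ρ * u) * P + N / 2 + V) + (v ^ 2 + N + 2 * V) := by
    simp only [curDensity, hP]; ring
  have h1 : (v + ρ * u) ^ 2 / 2 + (v + ρ * u) * P + N / 2 + V ≤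
      2 * v ^ 2 + 2 * (ρ ^ 2 * u ^ 2) + N + V := by
    nlinarith [sq_nonneg (v + ρ * u - P), sq_nonneg (v - ρ * u)]
  have h2 := mul_le_mul_of_nonneg_left h1 (by linarith : 0 ≤ W)
  have h3 : v ^ 2 + N + 2 * V ≤ W * (v ^ 2 + N + 2 * V) :=
    le_mul_of_one_le_left (by positivity) hW
  have h4 : 0 ≤ W * N := by positivity
  rw [e]
  nlinarith

/-- A smooth positive function on `ℝ³` equal to `|x|²` for `|x| ≥ 2`. -/
def radSq (x : E3) : ℝ :=
  ‖x‖ ^ 2 + (⟨1, 2, one_pos, one_lt_two⟩ : ContDiffBump (0 : E3)) x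

theorem radSq_pos (x : E3) : 0 < radSq x := by
  unfold radSq
  by_cases h : ‖x‖ ≤ 1
  · rw [ContDiffBump.one_of_mem_closedBall]
    · positivity
    · simpa using h
  · have : 0 < ‖x‖ := by linarith
    have h2 := (⟨1, 2, one_pos, one_lt_two⟩ : ContDiffBump (0 : E3)).nonneg (x := x)
    positivity

theorem contDiff_radSq {n : ℕ∞} : ContDiff ℝ n radSq :=
  (contDiff_norm_sq ℝ).add (ContDiffBump.contDiff _)

theorem radSq_eq {x : E3} (hx : 2 ≤ ‖x‖) : radSq x = ‖x‖ ^ 2 := by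
  unfold radSq
  rw [ContDiffBump.zero_of_le_dist, add_zero]
  simpa using hx

/-- Smooth version of `|x|^k`. -/
def radPow (k : ℝ) (x : E3) : ℝ := radSq x ^ (k / 2)

theorem contDiff_radPow (k : ℝ) {n : ℕ∞} : ContDiff ℝ n (radPow k) :=
  contDiff_radSq.rpow_const_of_ne fun x => (radSq_pos x).ne'

theorem radPow_nonneg (k : ℝ) (x : E3) : 0 ≤ radPow k x := rpow_nonneg (radSq_pos x).le _

theorem radPow_eq (k : ℝ) {x : E3} (hx : 2 ≤ ‖x‖) : radPow k x = ‖x‖ ^ k := by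
  rw [radPow, radSq_eq hx, ← rpow_natCast, ← rpow_mul (norm_nonneg _)]
  congr 1
  push_cast
  ring

theorem hasDerivAt_radPow (k : ℝ) {x : E3} (hx : 2 < ‖x‖) (v : E3) :
    HasDerivAt (fun s : ℝ => radPow k (x + s • v)) (k * radPow (-1) x ^ 2 * radPow k x * ⟪x, v⟫_ℝ) 0 := by
  have hl : HasDerivAt (fun s : ℝ => x + s • v) v 0 := by
    simpa using ((hasDerivAt_id (0 : ℝ)).smul_const v).const_add x
  have h1 : HasDerivAt (fun s : ℝ => ‖x + s • v‖ ^ 2) (2 * ⟪x, v⟫_ℝ) 0 := by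
    have := hl.norm_sq
    simpa using this
  have hev : (fun s : ℝ => radSq (x + s • v)) =ᶠ[nhds 0] fun s : ℝ => ‖x + s • v‖ ^ 2 := by
    have hc : ContinuousAt (fun s : ℝ => ‖x + s • v‖) 0 := by fun_prop
    have : ∀ᶠ s in nhds (0 : ℝ), 2 < ‖x + s • v‖ :=
      hc.eventually (lt_mem_nhds (by simpa using hx))
    filter_upwards [this] with s hs using radSq_eq hs.le
  have h2 := (h1.congr_of_eventuallyEq hev).rpow_const (p := k / 2)
    (Or.inl (by simpa using (radSq_pos x).ne'))
  refine h2.congr_deriv ?_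
  have hp : 0 < ‖x‖ := by linarith
  simp only [zero_smul, add_zero]
  rw [radPow_eq _ hx.le, radPow_eq _ hx.le, radSq_eq hx.le, ← rpow_natCast ‖x‖ 2,
    ← rpow_mul hp.le, ← rpow_natCast, ← rpow_mul hp.le]
  have e : ‖x‖ ^ (((2 : ℕ) : ℝ) * (k / 2 - 1)) = ‖x‖ ^ (-1 * ((2 : ℕ) : ℝ)) * ‖x‖ ^ k := by
    rw [← rpow_add hp]; congr 1; push_cast; ring
  rw [e]
  ring

/-- The potential energy density. -/
def pot (p u : ℝ) : ℝ := |u| ^ (p + 1) / (p + 1)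

theorem hasDerivAt_pot {p : ℝ} (hp : 0 < p) (u : ℝ) : HasDerivAt (pot p) (|u| ^ (p - 1) * u) u := by
  have h := (hasDerivAt_abs_rpow u (p := p + 1) (by linarith)).div_const (p + 1)
  refine h.congr_deriv ?_
  rw [show p + 1 - 2 = p - 1 by ring]
  have : p + 1 ≠ 0 := by positivity
  field_simp

theorem contDiff_pot {p : ℝ} (hp : 0 < p) : ContDiff ℝ 1 (pot p) := by
  have := contDiff_norm_rpow (E := ℝ) (p := p + 1) (by linarith)
  exact this.div_const _

theorem pot_nonneg {p : ℝ} (hp : 0 < p) (u : ℝ) : 0 ≤ pot p u := by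
  unfold pot; positivity

theorem abs_rpow_mul_self {p : ℝ} (hp : 0 < p) (u : ℝ) :
    |u| ^ (p - 1) * u * u = (p + 1) * pot p u := by
  unfold pot
  have : p + 1 ≠ 0 := by positivity
  rw [mul_div_cancel₀ _ this, mul_assoc, ← abs_mul_abs_self u]
  by_cases hu : u = 0
  · simp [hu, zero_rpow this]
  · have h0 : 0 < |u| := abs_pos.2 hu
    rw [show p + 1 = (p - 1) + 1 + 1 by ring, rpow_add h0, rpow_add h0, rpow_one, mul_assoc]

theorem IsNLWSolution.contDiff {p : ℝ} {φ : ℝ → E3 → ℝ} (hφ : IsNLWSolution p φ) :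
    ContDiff ℝ 2 fun q : ℝ × E3 => φ q.1 q.2 :=
  hφ.1.of_le (by norm_cast)

/-- The energy density of a space-time function. -/
def solDensity (p γ : ℝ) (U : ℝ × E3 → ℝ) (z : ℝ × E3) : ℝ :=
  curDensity (radPow (-1) z.2) (radPow γ z.2) (pot p (U z)) (U z) (fderiv ℝ U z (1, 0))
    (fun j => z.2 j) (fun j => fderiv ℝ U z (0, EuclideanSpace.single j 1))

/-- The energy flux of a space-time function. -/
def solFlux (p γ : ℝ) (U : ℝ × E3 → ℝ) (i : Fin 3) (z : ℝ × E3) : ℝ :=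
  curFlux (radPow (-1) z.2) (radPow γ z.2) (pot p (U z)) (U z) (fderiv ℝ U z (1, 0))
    (fun j => z.2 j) (fun j => fderiv ℝ U z (0, EuclideanSpace.single j 1)) i

theorem contDiff_solFlux {p : ℝ} (hp : 0 < p) (γ : ℝ) {U : ℝ × E3 → ℝ} (hU : ContDiff ℝ 2 U)
    (i : Fin 3) : ContDiff ℝ 1 (solFlux p γ U i) := by
  have hd : ∀ v, ContDiff ℝ 1 fun z => fderiv ℝ U z v := fun v =>
    (hU.fderiv_right (m := 1) le_rfl).clm_apply contDiff_const
  have hU1 : ContDiff ℝ 1 U := hU.of_le one_le_two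
  have hV : ContDiff ℝ 1 fun z => pot p (U z) := (contDiff_pot hp).comp hU1
  have hW : ∀ k, ContDiff ℝ 1 fun z : ℝ × E3 => radPow k z.2 := fun k =>
    (contDiff_radPow k (n := 1)).comp contDiff_snd
  have hx : ∀ j, ContDiff ℝ 1 fun z : ℝ × E3 => z.2 j := fun j => by fun_prop
  have hS : ContDiff ℝ 1 fun z : ℝ × E3 =>
      ∑ j, z.2 j * fderiv ℝ U z (0, EuclideanSpace.single j 1) :=
    ContDiff.sum fun j _ => (hx j).mul (hd _)
  have hN : ContDiff ℝ 1 fun z : ℝ × E3 => ∑ j, fderiv ℝ U z (0, EuclideanSpace.single j 1) ^ 2 :=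
    ContDiff.sum fun j _ => (hd _).pow 2
  have hA := (hd (1, 0)).add ((hW (-1)).mul hU1)
  exact (((((hW (-1)).mul (hW γ)).mul (((hN.div_const 2).add hV).sub ((hA.pow 2).div_const 2))).mul
    (hx i)).sub (((hW γ).mul (hA.add ((hW (-1)).mul hS))).mul (hd _))).sub
      ((contDiff_const.mul (hd _)).mul (hd _))

theorem hasDerivAt_solDensity {p : ℝ} (hp : 0 < p) (γ : ℝ) {U : ℝ × E3 → ℝ} (hU : ContDiff ℝ 2 U)
    (t : ℝ) (x : E3) : HasDerivAt (fun t => solDensity p γ U (t, x))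
      (curDensityDt (radPow (-1) x) (radPow γ x) (|U (t, x)| ^ (p - 1) * U (t, x)) (U (t, x))
        (fderiv ℝ U (t, x) (1, 0)) (fderiv ℝ (fderiv ℝ U) (t, x) (1, 0) (1, 0)) (fun j => x j)
        (fun j => fderiv ℝ U (t, x) (0, EuclideanSpace.single j 1))
        (fun j => fderiv ℝ (fderiv ℝ U) (t, x) (1, 0) (0, EuclideanSpace.single j 1))) t := by
  have hl : HasDerivAt (fun s : ℝ => ((s, x) : ℝ × E3)) (1, 0) t :=
    (hasDerivAt_id t).prodMk (hasDerivAt_const t x)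
  have hu : HasDerivAt (fun s => U (s, x)) (fderiv ℝ U (t, x) (1, 0)) t :=
    (hU.differentiable two_ne_zero (t, x)).hasFDerivAt.comp_hasDerivAt t hl
  have hd : ∀ v, HasDerivAt (fun s => fderiv ℝ U (s, x) v)
      (fderiv ℝ (fderiv ℝ U) (t, x) (1, 0) v) t := fun v =>
    HasFDerivAt.comp_hasDerivAt (l := fun z => fderiv ℝ U z v)
      (l' := (fderiv ℝ (fderiv ℝ U) (t, x)).flip v) t (hasFDerivAt_fderiv_apply hU (t, x) v) hl
  exact hasDerivAt_curDensity (ρ := radPow (-1) x) (W := radPow γ x) (x := fun j => x j)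
    (V := fun s => pot p (U (s, x))) (u := fun s => U (s, x)) (v := fun s => fderiv ℝ U (s, x) (1, 0)) hu (hd _)
    (d := fun j s => fderiv ℝ U (s, x) (0, EuclideanSpace.single j 1)) (fun j => hd _)
    (HasDerivAt.comp t (hasDerivAt_pot hp _) hu)

theorem fderiv_solFlux {p : ℝ} (hp : 0 < p) (γ : ℝ) {U : ℝ × E3 → ℝ} (hU : ContDiff ℝ 2 U)
    (t : ℝ) {x : E3} (hx : 2 < ‖x‖) (i : Fin 3) :
    fderiv ℝ (solFlux p γ U i) (t, x) (0, EuclideanSpace.single i 1) =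
      curFluxDi γ (radPow (-1) x) (radPow γ x) (pot p (U (t, x)))
        (|U (t, x)| ^ (p - 1) * U (t, x)) (U (t, x))
        (fderiv ℝ U (t, x) (1, 0)) (fun j => x j)
        (fun j => fderiv ℝ U (t, x) (0, EuclideanSpace.single j 1))
        (fun j => fderiv ℝ (fderiv ℝ U) (t, x) (0, EuclideanSpace.single j 1) (1, 0))
        (fun j => fderiv ℝ (fderiv ℝ U) (t, x) (0, EuclideanSpace.single i 1)
          (0, EuclideanSpace.single j 1)) i := by
  set e : E3 := EuclideanSpace.single i 1 with he
  have hl' : HasDerivAt (fun s : ℝ => x + s • e) e 0 := by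
    simpa using ((hasDerivAt_id (0 : ℝ)).smul_const e).const_add x
  have hl : HasDerivAt (fun s : ℝ => ((t, x + s • e) : ℝ × E3)) (0, e) 0 :=
    (hasDerivAt_const _ _).prodMk hl'
  have hz : ((t, x + (0 : ℝ) • e) : ℝ × E3) = (t, x) := by simp
  have comp : ∀ {f : ℝ × E3 → ℝ} {f' : (ℝ × E3) →L[ℝ] ℝ}, HasFDerivAt f f' (t, x) →
      HasDerivAt (fun s : ℝ => f (t, x + s • e)) (f' (0, e)) 0 := by
    intro f f' hf
    rw [← hz] at hf
    exact hf.comp_hasDerivAt (0 : ℝ) hl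
  have hu := comp (hU.differentiable two_ne_zero (t, x)).hasFDerivAt
  have hd : ∀ v, HasDerivAt (fun s : ℝ => fderiv ℝ U (t, x + s • e) v)
      (fderiv ℝ (fderiv ℝ U) (t, x) (0, e) v) 0 := fun v =>
    comp (hasFDerivAt_fderiv_apply hU (t, x) v)
  have hxe : ⟪x, e⟫_ℝ = x i := by simp [he, EuclideanSpace.inner_single_right]
  have hρ := hasDerivAt_radPow (-1) hx e
  have hW := hasDerivAt_radPow γ hx e
  rw [hxe] at hρ hW
  have hx' : ∀ j, HasDerivAt (fun s : ℝ => (x + s • e) j) (if j = i then 1 else 0) 0 := by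
    intro j
    have : HasDerivAt (fun s : ℝ => x j + s * e j) (e j) 0 := by
      simpa using ((hasDerivAt_id (0 : ℝ)).mul_const (e j)).const_add (x j)
    refine this.congr_deriv ?_
    simp [he]
  have hV : HasDerivAt (fun s : ℝ => pot p (U (t, x + s • e)))
      (|U (t, x)| ^ (p - 1) * U (t, x) * fderiv ℝ U (t, x) (0, e)) 0 := by
    have h1 := hasDerivAt_pot hp (U (t, x))
    rw [← hz] at h1
    have h2 := h1.comp (0 : ℝ) hu
    rw [hz] at h2
    exact h2
  have key := hasDerivAt_curFlux (γ := γ) (i := i) (s := 0) (V := fun s => pot p (U (t, x + s • e)))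
    (u := fun s => U (t, x + s • e)) (v := fun s => fderiv ℝ U (t, x + s • e) (1, 0))
    (ρ := fun s => radPow (-1) (x + s • e)) (W := fun s => radPow γ (x + s • e))
    (x := fun j s => (x + s • e) j)
    (d := fun j s => fderiv ℝ U (t, x + s • e) (0, EuclideanSpace.single j 1))
    (V' := |U (t, x)| ^ (p - 1) * U (t, x))
    (dv := fun j => fderiv ℝ (fderiv ℝ U) (t, x) (0, EuclideanSpace.single j 1) (1, 0))
    (h := fun j => fderiv ℝ (fderiv ℝ U) (t, x) (0, e) (0, EuclideanSpace.single j 1))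
    (by simp only [zero_smul, add_zero]; exact hρ.congr_deriv (by ring))
    (by simpa only [zero_smul, add_zero] using hW) hx'
    (by simpa only [zero_smul, add_zero] using hu) (hd _) (fun j => hd _)
    (by simpa only [zero_smul, add_zero] using hV)
  have h2 := comp ((contDiff_solFlux hp γ hU i).differentiable one_ne_zero (t, x)).hasFDerivAt
  have := h2.unique key
  simpa only [zero_smul, add_zero] using this

theorem radPow_neg_one_sq_mul {x : E3} (hx : 2 ≤ ‖x‖) :
    radPow (-1) x ^ 2 * ∑ j, x j ^ 2 = 1 := by
  have h0 : 0 < ‖x‖ := by linarith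
  rw [radPow_eq _ hx, rpow_neg_one, ← EuclideanSpace.real_norm_sq_eq]
  field_simp

theorem divergence_sol_le {p γ : ℝ} (hp : 0 < p) (hγ : 0 ≤ γ) (hγ2 : γ ≤ 2) (hγp : γ ≤ p - 1)
    {φ : ℝ → E3 → ℝ} (hφ : IsNLWSolution p φ) {t : ℝ} (ht : 0 ≤ t) {x : E3} (hx : 2 < ‖x‖) :
    deriv (fun t => solDensity p γ (fun q => φ q.1 q.2) (t, x)) t +
      ∑ i, fderiv ℝ (solFlux p γ (fun q => φ q.1 q.2) i) (t, x) (0, EuclideanSpace.single i 1)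
        ≤ 0 := by
  have hU : ContDiff ℝ 2 fun q : ℝ × E3 => φ q.1 q.2 := hφ.contDiff
  have hsym : ∀ v w, fderiv ℝ (fderiv ℝ fun q : ℝ × E3 => φ q.1 q.2) (t, x) v w =
      fderiv ℝ (fderiv ℝ fun q : ℝ × E3 => φ q.1 q.2) (t, x) w v := fun v w =>
    (hU.contDiffAt.isSymmSndFDerivAt (by simp)) v w
  rw [(hasDerivAt_solDensity hp γ hU t x).deriv]
  simp_rw [fderiv_solFlux hp γ hU t hx]
  have hdv : (fun j : Fin 3 => fderiv ℝ (fderiv ℝ fun q : ℝ × E3 => φ q.1 q.2) (t, x) (1, 0)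
      (0, EuclideanSpace.single j 1)) = fun j => fderiv ℝ (fderiv ℝ fun q : ℝ × E3 => φ q.1 q.2)
        (t, x) (0, EuclideanSpace.single j 1) (1, 0) := funext fun j => hsym _ _
  rw [hdv]
  refine curDensityDt_add_sum_le (p := p) (V := pot p (φ t x))
    (H := fun i j => fderiv ℝ (fderiv ℝ fun q : ℝ × E3 => φ q.1 q.2) (t, x)
      (0, EuclideanSpace.single i 1) (0, EuclideanSpace.single j 1))
    (fun i j => hsym _ _) (radPow_neg_one_sq_mul hx.le) ?_ (abs_rpow_mul_self hp _) hγ hγ2 hγp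
    (radPow_nonneg _ _) (radPow_nonneg _ _) (pot_nonneg hp _)
  have h1 := hφ.2 t ht x
  rw [dtt_eq hU] at h1
  have h2 : lap3 (φ t) x = ∑ i : Fin 3, fderiv ℝ (fderiv ℝ fun q : ℝ × E3 => φ q.1 q.2) (t, x)
      (0, EuclideanSpace.single i 1) (0, EuclideanSpace.single i 1) := by
    unfold lap3
    refine Finset.sum_congr rfl fun i _ => ?_
    rw [der2_eq (contDiff_slice hU t), fderiv_fderiv_slice hU]
  rw [h2] at h1
  linarith

theorem fderiv_eq_of_touching {h g : E3 → ℝ} {g' : E3 →L[ℝ] ℝ} {x : E3}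
    (hh : DifferentiableAt ℝ h x) (hg : HasFDerivAt g g' x) (hle : ∀ᶠ y in nhds x, h y ≤ g y)
    (hx : h x = g x) : fderiv ℝ h x = g' := by
  have h1 : IsLocalMin (fun y => g y - h y) x := by
    filter_upwards [hle] with y hy
    linarith
  have h2 := h1.hasFDerivAt_eq_zero (hg.sub hh.hasFDerivAt)
  exact (sub_eq_zero.1 h2).symm

theorem sum_sq_apply_single_le (L : E3 →L[ℝ] ℝ) :
    ∑ j, L (EuclideanSpace.single j 1) ^ 2 ≤ ‖L‖ ^ 2 := by
  set y := (InnerProductSpace.toDual ℝ E3).symm L with hy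
  have h1 : ∀ j, L (EuclideanSpace.single j 1) = y j := fun j => by
    have := InnerProductSpace.toDual_symm_apply (𝕜 := ℝ) (x := EuclideanSpace.single j 1) (y := L)
    rw [← this, ← hy]
    simp [EuclideanSpace.inner_single_right]
  have h2 : ‖y‖ = ‖L‖ := by simp [hy]
  rw [← h2, EuclideanSpace.real_norm_sq_eq]
  simp [h1]

/-- The height function of the truncated backward cone. -/
def coneHeight (t₀ : ℝ) (x₀ x : E3) : ℝ := max 0 (min (t₀ - ‖x - x₀‖) (‖x‖ - 2))

theorem lipschitzWith_coneHeight (t₀ : ℝ) (x₀ : E3) : LipschitzWith 1 (coneHeight t₀ x₀) := by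
  have h1 : LipschitzWith 1 fun x : E3 => t₀ - ‖x - x₀‖ := by
    refine LipschitzWith.of_dist_le_mul fun x y => ?_
    rw [NNReal.coe_one, one_mul, dist_eq_norm, dist_eq_norm, Real.norm_eq_abs]
    have := abs_norm_sub_norm_le (y - x₀) (x - x₀)
    rw [show y - x₀ - (x - x₀) = y - x by abel, norm_sub_rev y x] at this
    rwa [show t₀ - ‖x - x₀‖ - (t₀ - ‖y - x₀‖) = ‖y - x₀‖ - ‖x - x₀‖ by ring]
  have h2 : LipschitzWith 1 fun x : E3 => ‖x‖ - 2 := by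
    refine LipschitzWith.of_dist_le_mul fun x y => ?_
    rw [NNReal.coe_one, one_mul, dist_eq_norm, dist_eq_norm, Real.norm_eq_abs]
    have := abs_norm_sub_norm_le x y
    rwa [show ‖x‖ - 2 - (‖y‖ - 2) = ‖x‖ - ‖y‖ by ring]
  have h3 := (h1.min h2).const_max 0
  rwa [max_self] at h3

theorem hasCompactSupport_coneHeight (t₀ : ℝ) (x₀ : E3) : HasCompactSupport (coneHeight t₀ x₀) := by
  refine HasCompactSupport.intro (isCompact_closedBall x₀ t₀) fun x hx => ?_
  rw [Metric.mem_closedBall, dist_eq_norm, not_le] at hx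
  unfold coneHeight
  exact max_eq_left ((min_le_left _ _).trans (by linarith))

/-- The weight in the flux through a backward light cone. -/
def coneWeight (γ : ℝ) (x₀ x : E3) : ℝ :=
  ‖x‖ ^ (γ - 1) * (((‖x‖ + ‖x - x₀‖) ^ 2 - ‖x₀‖ ^ 2) / (2 * ‖x - x₀‖)) + 1

theorem norm_mul_one_add_eq {x₀ x : E3} (hs : 0 < ‖x - x₀‖) :
    ((‖x‖ + ‖x - x₀‖) ^ 2 - ‖x₀‖ ^ 2) / (2 * ‖x - x₀‖) =
      ‖x‖ + ⟪x, x - x₀⟫_ℝ / ‖x - x₀‖ := by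
  have h1 : ‖x₀‖ ^ 2 = ‖x‖ ^ 2 - 2 * ⟪x, x - x₀⟫_ℝ + ‖x - x₀‖ ^ 2 := by
    rw [← norm_sub_sq_real]; simp
  rw [h1]
  field_simp
  ring

theorem coneWeight_pos {γ : ℝ} {x₀ x : E3} : 0 < coneWeight γ x₀ x := by
  unfold coneWeight
  have : 0 ≤ ((‖x‖ + ‖x - x₀‖) ^ 2 - ‖x₀‖ ^ 2) / (2 * ‖x - x₀‖) := by
    refine div_nonneg ?_ (by positivity)
    have h1 : ‖x₀‖ ≤ ‖x‖ + ‖x - x₀‖ := by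
      have := norm_sub_le x (x - x₀); simpa using this
    nlinarith [norm_nonneg x₀]
  positivity

/-- Part of the backward cone of `(t₀, x₀)` on which `|x| ≥ t + 2`. -/
def coneExt (t₀ : ℝ) (x₀ : E3) : Set E3 :=
  {x | 0 < ‖x - x₀‖ ∧ ‖x - x₀‖ < t₀ ∧ t₀ - ‖x - x₀‖ ≤ ‖x‖ - 2}

theorem measurableSet_coneExt (t₀ : ℝ) (x₀ : E3) : MeasurableSet (coneExt t₀ x₀) := by
  have h1 : MeasurableSet {x : E3 | 0 < ‖x - x₀‖} := measurableSet_lt (by fun_prop) (by fun_prop)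
  have h2 : MeasurableSet {x : E3 | ‖x - x₀‖ < t₀} := measurableSet_lt (by fun_prop) (by fun_prop)
  have h3 : MeasurableSet {x : E3 | t₀ - ‖x - x₀‖ ≤ ‖x‖ - 2} :=
    measurableSet_le (by fun_prop) (by fun_prop)
  exact h1.inter (h2.inter h3)

/-- Majorant of the initial energy density. -/
def initDensity (p γ : ℝ) (φ : ℝ → E3 → ℝ) (x : E3) : ℝ :=
  3 * (radPow γ x * (‖fderiv ℝ (φ 0) x‖ ^ 2 + dt1 φ 0 x ^ 2)) +
    2 * (radPow (γ - 2) x * φ 0 x ^ 2) + 3 * (radPow γ x * |φ 0 x| ^ (p + 1))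

theorem initDensity_nonneg (p γ : ℝ) (φ : ℝ → E3 → ℝ) (x : E3) : 0 ≤ initDensity p γ φ x := by
  unfold initDensity
  have := radPow_nonneg γ x
  have := radPow_nonneg (γ - 2) x
  positivity

theorem continuous_initDensity {p : ℝ} (hp : 0 < p) (γ : ℝ) {φ : ℝ → E3 → ℝ}
    (hφ : IsNLWSolution p φ) : Continuous (initDensity p γ φ) := by
  have h0 := contDiff_slice hφ.contDiff 0
  have h1 : Continuous (φ 0) := h0.continuous
  have h2 : Continuous (fderiv ℝ (φ 0)) := h0.continuous_fderiv two_ne_zero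
  have h3 : Continuous (dt1 φ 0) := (contDiff_dt1 (n := 1) (hφ.contDiff.of_le (by norm_num)) 0).continuous
  have h4 : ∀ k, Continuous (radPow k) := fun k => (contDiff_radPow k (n := 0)).continuous
  have h5 : Continuous fun x => |φ 0 x| ^ (p + 1) :=
    h1.abs.rpow_const fun x => Or.inr (by linarith)
  unfold initDensity
  exact (((continuous_const.mul ((h4 _).mul ((h2.norm.pow 2).add (h3.pow 2)))).add
    (continuous_const.mul ((h4 _).mul (h1.pow 2)))).add (continuous_const.mul ((h4 _).mul h5)))

theorem solDensity_le_initDensity {p γ : ℝ} (hp : 0 < p) (hγ : 0 ≤ γ) {φ : ℝ → E3 → ℝ}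
    (hφ : IsNLWSolution p φ) {x : E3} (hx : 2 < ‖x‖) :
    solDensity p γ (fun q => φ q.1 q.2) (0, x) ≤ initDensity p γ φ x := by
  have hd := hφ.contDiff.differentiable two_ne_zero
  have hW : 1 ≤ radPow γ x := by
    rw [radPow_eq _ hx.le]; exact one_le_rpow (by linarith) hγ
  have h0 : 0 < ‖x‖ := by linarith
  refine (curDensity_le (radPow_neg_one_sq_mul hx.le) hW (pot_nonneg hp _)).trans ?_
  have e1 : radPow γ x * radPow (-1) x ^ 2 = radPow (γ - 2) x := by
    rw [radPow_eq _ hx.le, radPow_eq _ hx.le, radPow_eq _ hx.le, ← rpow_natCast,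
      ← rpow_mul h0.le, ← rpow_add h0]
    norm_num [sub_eq_add_neg]
  have e2 : ∑ j, fderiv ℝ (fun q : ℝ × E3 => φ q.1 q.2) (0, x) (0, EuclideanSpace.single j 1) ^ 2
      ≤ ‖fderiv ℝ (φ 0) x‖ ^ 2 := by
    refine le_trans (le_of_eq ?_) (sum_sq_apply_single_le _)
    exact Finset.sum_congr rfl fun j _ => by rw [fderiv_slice hd]
  have e3 : pot p (φ 0 x) ≤ |φ 0 x| ^ (p + 1) := by
    unfold pot
    exact div_le_self (by positivity) (by linarith)
  unfold initDensity
  simp only [← dt1_eq hd, e1]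
  have := radPow_nonneg γ x
  gcongr

theorem lintegral_initDensity_le {p γ : ℝ} (hp : 0 < p) (hγ : 1 ≤ γ) {φ : ℝ → E3 → ℝ}
    (hφ : IsNLWSolution p φ) (hE : wEnergy p 0 γ φ ≠ ⊤) :
    ∫⁻ x in {x : E3 | 2 < ‖x‖}, ENNReal.ofReal (initDensity p γ φ x) ≤
      ENNReal.ofReal 8 * wEnergy p 0 γ φ := by
  have h0 := contDiff_slice hφ.contDiff 0
  have hpot := lintegral_potential_le_wEnergy p γ 0 φ
  have hkin := lintegral_le_wEnergy_zero p γ φ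
  have hhardy := lintegral_hardy_le (f := φ 0) (h0.of_le one_le_two) (q := p + 1) (by linarith) (γ := γ)
    (by
      refine ne_top_of_le_ne_top hE (le_trans ?_ hpot)
      refine lintegral_mono fun x => ?_
      rw [enorm_rpow_eq _ (by linarith)]
      refine ENNReal.ofReal_le_ofReal (le_mul_of_one_le_left (by positivity) ?_)
      exact one_le_rpow (by linarith [norm_nonneg x]) (by linarith)) hγ
  have hm : MeasurableSet {x : E3 | 2 < ‖x‖} := measurableSet_lt (by fun_prop) (by fun_prop)
  have hW : ∀ x : E3, 0 ≤ (1 + ‖x‖) ^ γ := fun x => by positivity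
  have hWle : ∀ x : E3, ‖x‖ ^ γ ≤ (1 + ‖x‖) ^ γ := fun x =>
    rpow_le_rpow (norm_nonneg _) (by linarith) (by linarith)
  set F1 : E3 → ℝ := fun x => (1 + ‖x‖) ^ γ * (‖fderiv ℝ (φ 0) x‖ ^ 2 + |dt1 φ 0 x| ^ 2) with hF1
  set F2 : E3 → ℝ := fun x => ‖x‖ ^ (γ - 2) * φ 0 x ^ 2 with hF2
  set F3 : E3 → ℝ := fun x => (1 + ‖x‖) ^ γ * |φ 0 x| ^ (p + 1) with hF3
  have hm2 : Measurable F2 := by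
    have := h0.continuous
    fun_prop
  have hm3 : Measurable F3 := by
    have := h0.continuous
    fun_prop
  have hF2' : ∫⁻ x, ENNReal.ofReal (F2 x) ≤ wEnergy p 0 γ φ := by
    refine hhardy.trans (le_trans (lintegral_mono fun x => ENNReal.ofReal_le_ofReal ?_) hkin)
    exact mul_le_mul (hWle x) (le_add_of_nonneg_right (by positivity)) (by positivity) (hW x)
  calc ∫⁻ x in {x : E3 | 2 < ‖x‖}, ENNReal.ofReal (initDensity p γ φ x)
      ≤ ∫⁻ x in {x : E3 | 2 < ‖x‖}, (ENNReal.ofReal 3 * ENNReal.ofReal (F1 x)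
        + ENNReal.ofReal 2 * ENNReal.ofReal (F2 x) + ENNReal.ofReal 3 * ENNReal.ofReal (F3 x)) := by
        refine setLIntegral_mono' hm fun x hx => ?_
        have hx2 : (2 : ℝ) < ‖x‖ := hx
        rw [← ENNReal.ofReal_mul (by norm_num), ← ENNReal.ofReal_mul (by norm_num),
          ← ENNReal.ofReal_mul (by norm_num), ← ENNReal.ofReal_add (by positivity) (by positivity),
          ← ENNReal.ofReal_add (by positivity) (by positivity)]
        refine ENNReal.ofReal_le_ofReal ?_
        unfold initDensity
        rw [radPow_eq _ hx2.le, radPow_eq _ hx2.le, hF1, hF2, hF3]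
        simp only [sq_abs]
        have := hWle x
        gcongr
    _ ≤ ∫⁻ x : E3, (ENNReal.ofReal 3 * ENNReal.ofReal (F1 x)
        + ENNReal.ofReal 2 * ENNReal.ofReal (F2 x) + ENNReal.ofReal 3 * ENNReal.ofReal (F3 x)) :=
        setLIntegral_le_lintegral _ _
    _ = ENNReal.ofReal 3 * (∫⁻ x, ENNReal.ofReal (F1 x))
        + ENNReal.ofReal 2 * (∫⁻ x, ENNReal.ofReal (F2 x))
        + ENNReal.ofReal 3 * (∫⁻ x, ENNReal.ofReal (F3 x)) := by
        rw [lintegral_add_right _ (hm3.ennreal_ofReal.const_mul _),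
          lintegral_add_right _ (hm2.ennreal_ofReal.const_mul _),
          lintegral_const_mul' _ _ ENNReal.ofReal_ne_top,
          lintegral_const_mul' _ _ ENNReal.ofReal_ne_top,
          lintegral_const_mul' _ _ ENNReal.ofReal_ne_top]
    _ ≤ ENNReal.ofReal 3 * wEnergy p 0 γ φ + ENNReal.ofReal 2 * wEnergy p 0 γ φ
        + ENNReal.ofReal 3 * wEnergy p 0 γ φ := by gcongr
    _ = ENNReal.ofReal 8 * wEnergy p 0 γ φ := by
        rw [← add_mul, ← add_mul, ← ENNReal.ofReal_add (by norm_num) (by norm_num),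
          ← ENNReal.ofReal_add (by norm_num) (by norm_num)]
        norm_num

/-- Weighted flux estimate through the exterior part of a backward light cone. -/
theorem lintegral_cone_le {p γ : ℝ} (hp : 0 < p) (hγ : 1 ≤ γ) (hγ2 : γ ≤ 2) (hγp : γ ≤ p - 1)
    {φ : ℝ → E3 → ℝ} (hφ : IsNLWSolution p φ) (hE : wEnergy p 0 γ φ ≠ ⊤) (t₀ : ℝ) (x₀ : E3) :
    ∫⁻ x in coneExt t₀ x₀,
      ENNReal.ofReal (coneWeight γ x₀ x * |φ (t₀ - ‖x - x₀‖) x| ^ (p + 1)) ≤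
        ENNReal.ofReal (8 * (p + 1)) * wEnergy p 0 γ φ := by
  set U : ℝ × E3 → ℝ := fun q => φ q.1 q.2 with hU
  have hU2 : ContDiff ℝ 2 U := hφ.contDiff
  set h := coneHeight t₀ x₀ with hh
  have hL : LipschitzWith 1 h := lipschitzWith_coneHeight t₀ x₀
  have hpos2 : ∀ x, 0 < h x → 0 < min (t₀ - ‖x - x₀‖) (‖x‖ - 2) := fun x hx =>
    (lt_max_iff.1 hx).resolve_left (lt_irrefl _)
  have hmin : ∀ x, 0 < h x → h x = min (t₀ - ‖x - x₀‖) (‖x‖ - 2) := fun x hx =>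
    max_eq_right (hpos2 x hx).le
  have hgt2 : ∀ x, 0 < h x → 2 < ‖x‖ := fun x hx => by
    have := (lt_min_iff.1 (hpos2 x hx)).2; linarith
  obtain ⟨D, hDi, hD0, hD⟩ := exists_divergence_le (J := solFlux p γ U)
    (J0 := fun t x => solDensity p γ U (t, x))
    (J0' := fun t x => deriv (fun t => solDensity p γ U (t, x)) t)
    (fun i => contDiff_solFlux hp γ hU2 i) hL (hasCompactSupport_coneHeight t₀ x₀)
    (fun x => le_max_left _ _)
    (fun x _ t _ => (hasDerivAt_solDensity hp γ hU2 t x).differentiableAt.hasDerivAt)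
    (fun x hx t ht => divergence_sol_le hp (by linarith) hγ2 hγp hφ ht (hgt2 x hx))
  set f : E3 → ℝ := (coneExt t₀ x₀).indicator fun x =>
    coneWeight γ x₀ x * |φ (t₀ - ‖x - x₀‖) x| ^ (p + 1) / (p + 1) with hf
  set g : E3 → ℝ := {x : E3 | 0 < h x}.indicator (initDensity p γ φ) with hg
  have hmh : MeasurableSet {x : E3 | 0 < h x} :=
    measurableSet_lt measurable_const hL.continuous.measurable
  have hgi : Integrable g := by
    refine IntegrableOn.integrable_indicator ?_ hmh
    refine (((continuous_initDensity hp γ hφ).continuousOn.integrableOn_compact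
      (isCompact_closedBall x₀ t₀))).mono_set fun x hx => ?_
    have := (lt_min_iff.1 (hpos2 x hx)).1
    rw [Metric.mem_closedBall, dist_eq_norm]
    linarith
  have hg0 : ∀ x, 0 ≤ g x := fun x => Set.indicator_nonneg (fun x _ => initDensity_nonneg p γ φ x) x
  have hne : ∀ᵐ x : E3, x ≠ x₀ := by simp [ae_iff]
  have key : ∀ᵐ x, f x ≤ g x - D x := by
    filter_upwards [hD, hne] with x hx hxne
    obtain ⟨hdiff, hz, hp0⟩ := hx
    have hs : 0 < ‖x - x₀‖ := norm_pos_iff.2 (sub_ne_zero.2 hxne)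
    have hh0 : 0 ≤ h x := le_max_left _ _
    rcases hh0.eq_or_lt with h0 | h0
    · have hxC : x ∉ coneExt t₀ x₀ := fun hxC => by
        have h1 : 0 < min (t₀ - ‖x - x₀‖) (‖x‖ - 2) := by
          rw [min_eq_left hxC.2.2]; linarith [hxC.2.1]
        have : 0 < h x := lt_max_of_lt_right h1
        linarith
      rw [hz h0.symm, hf, Set.indicator_of_notMem hxC]
      linarith [hg0 x]
    have hx2 := hgt2 x h0
    have hxne0 : x ≠ 0 := norm_pos_iff.1 (by linarith)
    have hX := radPow_neg_one_sq_mul hx2.le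
    have hgx : g x = initDensity p γ φ x := Set.indicator_of_mem (s := {x : E3 | 0 < h x}) h0 _
    have hinit := solDensity_le_initDensity hp (by linarith) hφ hx2 (γ := γ)
    have hDx := hp0 h0
    rw [hgx]
    have hev : ∀ᶠ y in nhds x, h y = min (t₀ - ‖y - x₀‖) (‖y‖ - 2) := by
      filter_upwards [hL.continuous.continuousAt.eventually (lt_mem_nhds h0)] with y hy using hmin y hy
    by_cases hxC : x ∈ coneExt t₀ x₀
    · have hhx : h x = t₀ - ‖x - x₀‖ := by rw [hmin x h0, min_eq_left hxC.2.2]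
      have hgrad : HasFDerivAt (fun y : E3 => t₀ - ‖y - x₀‖)
          (-(‖x - x₀‖⁻¹ • innerSL ℝ (x - x₀))) x := by
        have h1 := hasFDerivAt_norm_E3 (sub_ne_zero.2 hxne)
        have h2 := (h1.comp x ((hasFDerivAt_id x).sub_const x₀)).const_sub t₀
        simpa using! h2
      have hfd := fderiv_eq_of_touching hdiff hgrad
        (hev.mono fun y hy => by rw [hy]; exact min_le_left _ _) hhx
      set ω : Fin 3 → ℝ := fun i => ‖x - x₀‖⁻¹ * (x - x₀) i with hω
      have hfi : ∀ i, fderiv ℝ h x (EuclideanSpace.single i 1) = -ω i := fun i => by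
        rw [hfd]
        simp [hω, EuclideanSpace.inner_single_right]
      have hω1 : ∑ j, ω j ^ 2 = 1 := by
        simp only [hω, mul_pow]
        rw [← Finset.mul_sum, ← EuclideanSpace.real_norm_sq_eq]
        field_simp
      have hc := sum_curFlux_cone_le (V := pot p (U (h x, x))) (u := U (h x, x))
        (v := fderiv ℝ U (h x, x) (1, 0))
        (d := fun j => fderiv ℝ U (h x, x) (0, EuclideanSpace.single j 1)) hX hω1
        (radPow_nonneg γ x)
      have hsum : ∑ i, solFlux p γ U i (h x, x) * fderiv ℝ h x (EuclideanSpace.single i 1) =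
          ∑ i, solFlux p γ U i (h x, x) * (-ω i) :=
        Finset.sum_congr rfl fun i _ => by rw [hfi]
      have hfx : f x ≤ (radPow γ x * (1 + radPow (-1) x * ∑ j, x j * ω j) + 2) * pot p (U (h x, x)) := by
        rw [hf, Set.indicator_of_mem hxC]
        have e1 : ∑ j, x j * ω j = ⟪x, x - x₀⟫_ℝ / ‖x - x₀‖ := by
          rw [PiLp.inner_apply, Finset.sum_div]
          refine Finset.sum_congr rfl fun j _ => ?_
          simp [hω]
          ring
        have e2 : radPow γ x * (1 + radPow (-1) x * ∑ j, x j * ω j) + 1 = coneWeight γ x₀ x := by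
          have h0' : 0 < ‖x‖ := by linarith
          rw [coneWeight, norm_mul_one_add_eq hs, e1, radPow_eq _ hx2.le, radPow_eq _ hx2.le,
            rpow_neg_one, rpow_sub_one h0'.ne']
          field_simp
        have e3 : |φ (t₀ - ‖x - x₀‖) x| ^ (p + 1) / (p + 1) = pot p (U (h x, x)) := by
          rw [hhx, pot]
        show coneWeight γ x₀ x * |φ (t₀ - ‖x - x₀‖) x| ^ (p + 1) / (p + 1) ≤ _
        rw [mul_div_assoc, e3, ← e2]
        have := pot_nonneg hp (U (h x, x))
        nlinarith
      rw [hsum] at hDx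
      change _ ≤ solDensity p γ U (h x, x) - ∑ i, solFlux p γ U i (h x, x) * (-ω i) at hc
      linarith
    · have hlt : ‖x‖ - 2 < t₀ - ‖x - x₀‖ := by
        by_contra hcon
        exact hxC ⟨hs, by linarith [(lt_min_iff.1 (hpos2 x h0)).1], not_lt.1 hcon⟩
      have hhx : h x = ‖x‖ - 2 := by rw [hmin x h0, min_eq_right hlt.le]
      have hgrad : HasFDerivAt (fun y : E3 => ‖y‖ - 2) (‖x‖⁻¹ • innerSL ℝ x) x :=
        (hasFDerivAt_norm_E3 hxne0).sub_const 2
      have hfd := fderiv_eq_of_touching hdiff hgrad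
        (hev.mono fun y hy => by rw [hy]; exact min_le_right _ _) hhx
      have hfi : ∀ i, fderiv ℝ h x (EuclideanSpace.single i 1) = radPow (-1) x * x i := fun i => by
        rw [hfd, radPow_eq _ hx2.le, rpow_neg_one]
        simp [EuclideanSpace.inner_single_right]
      have hc := sum_curFlux_radial_le (u := U (h x, x))
        (v := fderiv ℝ U (h x, x) (1, 0))
        (d := fun j => fderiv ℝ U (h x, x) (0, EuclideanSpace.single j 1)) hX
        (radPow_nonneg γ x) (pot_nonneg hp (U (h x, x)))
      have hsum : ∑ i, solFlux p γ U i (h x, x) * fderiv ℝ h x (EuclideanSpace.single i 1) =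
          ∑ i, solFlux p γ U i (h x, x) * (radPow (-1) x * x i) :=
        Finset.sum_congr rfl fun i _ => by rw [hfi]
      rw [hsum] at hDx
      change 0 ≤ solDensity p γ U (h x, x) -
        ∑ i, solFlux p γ U i (h x, x) * (radPow (-1) x * x i) at hc
      rw [hf, Set.indicator_of_notMem hxC]
      linarith
  have hf0 : ∀ x, 0 ≤ f x := fun x => Set.indicator_nonneg (fun x _ => by
    have := (coneWeight_pos (γ := γ) (x₀ := x₀) (x := x)).le
    positivity) x
  have hfle : ∫⁻ x, ENNReal.ofReal (f x) ≤ ENNReal.ofReal 8 * wEnergy p 0 γ φ := by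
    calc ∫⁻ x, ENNReal.ofReal (f x) ≤ ∫⁻ x, ENNReal.ofReal (g x - D x) :=
          lintegral_mono_ae (key.mono fun x hx => ENNReal.ofReal_le_ofReal hx)
      _ = ENNReal.ofReal (∫ x, (g x - D x)) :=
          (ofReal_integral_eq_lintegral_ofReal (hgi.sub hDi)
            (key.mono fun x hx => (hf0 x).trans hx)).symm
      _ = ENNReal.ofReal (∫ x, g x) := by rw [integral_sub hgi hDi, hD0, sub_zero]
      _ = ∫⁻ x, ENNReal.ofReal (g x) :=
          ofReal_integral_eq_lintegral_ofReal hgi (Filter.Eventually.of_forall hg0)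
      _ = ∫⁻ x in {x : E3 | 0 < h x}, ENNReal.ofReal (initDensity p γ φ x) := by
          rw [← lintegral_indicator hmh]
          refine lintegral_congr fun x => ?_
          by_cases hx : x ∈ {x : E3 | 0 < h x}
          · rw [hg, Set.indicator_of_mem hx, Set.indicator_of_mem hx]
          · rw [hg, Set.indicator_of_notMem hx, Set.indicator_of_notMem hx, ENNReal.ofReal_zero]
      _ ≤ ∫⁻ x in {x : E3 | 2 < ‖x‖}, ENNReal.ofReal (initDensity p γ φ x) :=
          lintegral_mono_set fun x hx => hgt2 x hx
      _ ≤ _ := lintegral_initDensity_le hp hγ hφ hE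
  have hp1 : (0 : ℝ) < p + 1 := by linarith
  calc ∫⁻ x in coneExt t₀ x₀,
      ENNReal.ofReal (coneWeight γ x₀ x * |φ (t₀ - ‖x - x₀‖) x| ^ (p + 1))
      = ∫⁻ x, ENNReal.ofReal (p + 1) * ENNReal.ofReal (f x) := by
        rw [← lintegral_indicator (measurableSet_coneExt t₀ x₀)]
        refine lintegral_congr fun x => ?_
        rw [← ENNReal.ofReal_mul hp1.le]
        by_cases hx : x ∈ coneExt t₀ x₀
        · rw [hf, Set.indicator_of_mem hx, Set.indicator_of_mem hx, mul_div_cancel₀ _ hp1.ne']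
        · rw [hf, Set.indicator_of_notMem hx, Set.indicator_of_notMem hx, mul_zero,
            ENNReal.ofReal_zero]
    _ = ENNReal.ofReal (p + 1) * ∫⁻ x, ENNReal.ofReal (f x) :=
        lintegral_const_mul' _ _ ENNReal.ofReal_ne_top
    _ ≤ ENNReal.ofReal (p + 1) * (ENNReal.ofReal 8 * wEnergy p 0 γ φ) := by gcongr
    _ = _ := by rw [← mul_assoc, ← ENNReal.ofReal_mul hp1.le, mul_comm (p + 1)]

theorem lintegral_rpow_Ioc_zero {k R : ℝ} (hk : -1 < k) (hR : 0 ≤ R) :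
    ∫⁻ s in Set.Ioc 0 R, ENNReal.ofReal (s ^ k) = ENNReal.ofReal (R ^ (k + 1) / (k + 1)) := by
  rw [← ofReal_integral_eq_lintegral_ofReal, ← intervalIntegral.integral_of_le hR,
    integral_rpow (Or.inl hk), zero_rpow (by linarith), sub_zero]
  · exact (intervalIntegral.intervalIntegrable_rpow' hk).1
  · filter_upwards [ae_restrict_mem measurableSet_Ioc] with s hs using rpow_nonneg hs.1.le _

theorem lintegral_rpow_Ici {k δ : ℝ} (hk : k < -1) (hδ : 0 < δ) :
    ∫⁻ s in Set.Ici δ, ENNReal.ofReal (s ^ k) = ENNReal.ofReal (-δ ^ (k + 1) / (k + 1)) := by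
  rw [setLIntegral_congr Ioi_ae_eq_Ici.symm, ← ofReal_integral_eq_lintegral_ofReal,
    integral_Ioi_rpow_of_lt hk hδ]
  · exact integrableOn_Ioi_rpow_of_lt hk hδ
  · filter_upwards [ae_restrict_mem measurableSet_Ioi] with s hs
    exact rpow_nonneg (hδ.le.trans (le_of_lt hs)) _

theorem antitoneOn_abs_rpow {κ U P : ℝ} (hκ : 0 < κ) (hU : 0 ≤ U) (hP : 0 ≤ P) :
    AntitoneOn (fun y : ℝ => |κ * y + U| ^ (-P)) (Set.Ioc 0 2) := by
  intro y hy y' hy' hyy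
  have h1 : 0 < κ * y := mul_pos hκ hy.1
  have h2 : 0 < κ * y' := mul_pos hκ hy'.1
  show |κ * y' + U| ^ (-P) ≤ |κ * y + U| ^ (-P)
  rw [abs_of_pos (by linarith), abs_of_pos (by linarith)]
  exact rpow_le_rpow_of_nonpos (by linarith) (by nlinarith) (by linarith)

theorem lintegral_sphere_rpow_le {e : E3} (he : ‖e‖ = 1) {κ U P : ℝ} (hκ : 0 < κ) (hU : 0 ≤ U)
    (hP : 0 ≤ P) :
    ∫⁻ ω, ENNReal.ofReal ((κ * (1 + ⟪(ω : E3), e⟫_ℝ) + U) ^ (-P)) ∂sphereMeasure ≤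
      48 * ∫⁻ y in Set.Ioc (0 : ℝ) 2, ENNReal.ofReal ((κ * y + U) ^ (-P)) := by
  have h := lintegral_sphere_antitone_le he (g := fun y : ℝ => |κ * y + U| ^ (-P))
    (fun y => by positivity) (by fun_prop) (antitoneOn_abs_rpow hκ hU hP)
  refine le_trans (le_of_eq (lintegral_congr fun ω => ?_)) (h.trans (le_of_eq ?_))
  · have := mul_nonneg hκ.le (one_add_inner_mem he ω).1
    rw [abs_of_nonneg (by linarith)]
  · rw [setLIntegral_congr_fun measurableSet_Ioc fun y hy => ?_]
    have := mul_nonneg hκ.le hy.1.le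
    rw [abs_of_nonneg (by linarith)]

theorem lintegral_sphere_shift_rpow_le {e : E3} (he : ‖e‖ = 1) {κ U P : ℝ} (hκ : 0 < κ)
    (hU : 0 < U) (hP : 1 < P) :
    ∫⁻ ω, ENNReal.ofReal ((κ * (1 + ⟪(ω : E3), e⟫_ℝ) + U) ^ (-P)) ∂sphereMeasure ≤
      ENNReal.ofReal (48 / (P - 1) * κ⁻¹ * U ^ (1 - P)) := by
  refine (lintegral_sphere_rpow_le he hκ hU.le (by linarith)).trans ?_
  have hpos : ∀ y ∈ Set.Icc (0 : ℝ) 2, 0 < κ * y + U := fun y hy => by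
    have := mul_nonneg hκ.le hy.1; linarith
  have hint : IntervalIntegrable (fun y : ℝ => (κ * y + U) ^ (-P)) volume 0 2 := by
    refine ContinuousOn.intervalIntegrable ?_
    rw [Set.uIcc_of_le zero_le_two]
    exact ContinuousOn.rpow_const (by fun_prop) fun y hy => Or.inl (hpos y hy).ne'
  have hval : ∫ y in (0 : ℝ)..2, (κ * y + U) ^ (-P) =
      -(κ⁻¹ * (P - 1)⁻¹ * (κ * 2 + U) ^ (1 - P)) - -(κ⁻¹ * (P - 1)⁻¹ * (κ * 0 + U) ^ (1 - P)) := by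
    refine intervalIntegral.integral_eq_sub_of_hasDerivAt
      (f := fun y => -(κ⁻¹ * (P - 1)⁻¹ * (κ * y + U) ^ (1 - P))) (fun y hy => ?_) hint
    rw [Set.uIcc_of_le zero_le_two] at hy
    have h1 : HasDerivAt (fun y : ℝ => κ * y + U) κ y := by
      simpa using ((hasDerivAt_id y).const_mul κ).add_const U
    have h2 := ((h1.rpow_const (p := 1 - P) (Or.inl (hpos y hy).ne')).const_mul
      (κ⁻¹ * (P - 1)⁻¹)).fun_neg
    convert h2 using 1
    have : P - 1 ≠ 0 := by linarith
    rw [show 1 - P - 1 = -P by ring]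
    field_simp
    ring
  rw [← ofReal_integral_eq_lintegral_ofReal hint.1, ← intervalIntegral.integral_of_le zero_le_two,
    hval, show (48 : ℝ≥0∞) = ENNReal.ofReal 48 by simp, ← ENNReal.ofReal_mul (by norm_num)]
  · refine ENNReal.ofReal_le_ofReal ?_
    have h3 : 0 ≤ κ⁻¹ * (P - 1)⁻¹ * (κ * 2 + U) ^ (1 - P) := by
      have : 0 < P - 1 := by linarith
      positivity
    rw [mul_zero, zero_add, div_eq_mul_inv]
    nlinarith
  · filter_upwards [ae_restrict_mem measurableSet_Ioc] with y hy
    exact rpow_nonneg (hpos y (Set.Ioc_subset_Icc_self hy)).le _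

theorem lintegral_sphere_one_rpow_le {e : E3} (he : ‖e‖ = 1) {κ q : ℝ} (hκ : 0 < κ)
    (hq : 0 ≤ q) (hq1 : q < 1) :
    ∫⁻ ω, ENNReal.ofReal ((κ * (1 + ⟪(ω : E3), e⟫_ℝ) + 1) ^ (-q)) ∂sphereMeasure ≤
      ENNReal.ofReal (48 * (2 ^ (1 - q) / (1 - q)) * κ ^ (-q)) := by
  refine (lintegral_sphere_rpow_le he hκ zero_le_one hq).trans ?_
  calc 48 * ∫⁻ y in Set.Ioc (0 : ℝ) 2, ENNReal.ofReal ((κ * y + 1) ^ (-q))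
      ≤ 48 * ∫⁻ y in Set.Ioc (0 : ℝ) 2, ENNReal.ofReal (κ ^ (-q)) * ENNReal.ofReal (y ^ (-q)) := by
        gcongr 48 * ?_
        refine setLIntegral_mono' measurableSet_Ioc fun y hy => ?_
        rw [← ENNReal.ofReal_mul (by positivity), ← mul_rpow hκ.le hy.1.le]
        have := mul_pos hκ hy.1
        exact ENNReal.ofReal_le_ofReal (rpow_le_rpow_of_nonpos this (by linarith) (by linarith))
    _ = _ := by
        rw [lintegral_const_mul' _ _ ENNReal.ofReal_ne_top,
          lintegral_rpow_Ioc_zero (by linarith) zero_le_two,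
          show (48 : ℝ≥0∞) = ENNReal.ofReal 48 by simp, ← ENNReal.ofReal_mul (by positivity),
          ← ENNReal.ofReal_mul (by norm_num)]
        congr 1
        rw [show -q + 1 = 1 - q by ring]
        ring

theorem setLIntegral_polar_le {S : Set E3} (hS : MeasurableSet S) {f : E3 → ℝ} (hf : Measurable f)
    (c : E3) {I : Set ℝ} (hI : MeasurableSet I) (hI0 : I ⊆ Set.Ioi 0) {A cb : ℝ → ℝ}
    {g : ℝ → Metric.sphere (0 : E3) 1 → ℝ} (hA : ∀ s ∈ I, 0 ≤ A s)
    (h : ∀ s, 0 < s → ∀ ω : Metric.sphere (0 : E3) 1, c + s • (ω : E3) ∈ S →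
      s ∈ I ∧ f (c + s • (ω : E3)) ≤ A s * g s ω)
    (hcb : ∀ s ∈ I, ∫⁻ ω, ENNReal.ofReal (g s ω) ∂sphereMeasure ≤ ENNReal.ofReal (cb s)) :
    ∫⁻ x in S, ENNReal.ofReal (f x) ≤ ∫⁻ s in I, ENNReal.ofReal (s ^ 2 * (A s * cb s)) := by
  rw [← lintegral_indicator hS, lintegral_polar c (hf.ennreal_ofReal.indicator hS),
    ← Set.inter_eq_left.2 hI0, ← Measure.restrict_restrict hI, ← lintegral_indicator hI]
  refine setLIntegral_mono' measurableSet_Ioi fun s hs => ?_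
  by_cases hsI : s ∈ I
  · rw [Set.indicator_of_mem hsI]
    calc ∫⁻ ω : Metric.sphere (0 : E3) 1, ENNReal.ofReal (s ^ 2) *
          S.indicator (fun x => ENNReal.ofReal (f x)) (c + s • (ω : E3)) ∂sphereMeasure
        ≤ ∫⁻ ω : Metric.sphere (0 : E3) 1, ENNReal.ofReal (s ^ 2 * A s) *
            ENNReal.ofReal (g s ω) ∂sphereMeasure := by
          refine lintegral_mono fun ω => ?_
          by_cases hx : c + s • (ω : E3) ∈ S
          · rw [Set.indicator_of_mem hx, ENNReal.ofReal_mul (sq_nonneg s), mul_assoc,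
              ← ENNReal.ofReal_mul (hA s hsI)]
            gcongr
            exact (h s hs ω hx).2
          · rw [Set.indicator_of_notMem hx, mul_zero]; exact zero_le
      _ = ENNReal.ofReal (s ^ 2 * A s) * ∫⁻ ω : Metric.sphere (0 : E3) 1,
            ENNReal.ofReal (g s ω) ∂sphereMeasure :=
          lintegral_const_mul' _ _ ENNReal.ofReal_ne_top
      _ ≤ ENNReal.ofReal (s ^ 2 * A s) * ENNReal.ofReal (cb s) := by gcongr; exact hcb s hsI
      _ = _ := by
          rw [← ENNReal.ofReal_mul (mul_nonneg (sq_nonneg s) (hA s hsI)), mul_assoc]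
  · rw [Set.indicator_of_notMem hsI]
    refine le_of_eq (lintegral_eq_zero_of_ae_eq_zero (Filter.Eventually.of_forall fun ω => ?_))
    have : c + s • (ω : E3) ∉ S := fun hx => hsI (h s hs ω hx).1
    simp [Set.indicator_of_notMem this]

theorem norm_inv_smul_self {x₀ : E3} (h : 0 < ‖x₀‖) : ‖‖x₀‖⁻¹ • x₀‖ = 1 := by
  rw [norm_smul, norm_inv, norm_norm, inv_mul_cancel₀ h.ne']

theorem norm_add_smul_sub {x₀ : E3} {s : ℝ} (hs : 0 ≤ s) (ω : Metric.sphere (0 : E3) 1) :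
    ‖x₀ + s • (ω : E3) - x₀‖ = s := by
  rw [add_sub_cancel_left, norm_sphere_smul hs]

theorem mul_one_add_inner_le_center {x₀ : E3} (h : 0 < ‖x₀‖) {s : ℝ} (hs : 0 ≤ s)
    (ω : Metric.sphere (0 : E3) 1) :
    s * (1 + ⟪(ω : E3), ‖x₀‖⁻¹ • x₀⟫_ℝ) ≤
      ‖x₀ + s • (ω : E3)‖ + ‖x₀ + s • (ω : E3) - x₀‖ - ‖x₀‖ := by
  have h1 := real_inner_le_norm (x₀ + s • (ω : E3)) (‖x₀‖⁻¹ • x₀)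
  rw [norm_inv_smul_self h, mul_one, inner_add_left, real_inner_smul_left, inner_smul_right,
    real_inner_self_eq_norm_sq] at h1
  have h2 : ‖x₀‖⁻¹ * ‖x₀‖ ^ 2 = ‖x₀‖ := by field_simp
  rw [norm_add_smul_sub hs]
  linarith

theorem mul_one_add_inner_le_origin {x₀ : E3} (h : 0 < ‖x₀‖) {r : ℝ} (hr : 0 ≤ r)
    (ω : Metric.sphere (0 : E3) 1) :
    r * (1 + ⟪(ω : E3), -(‖x₀‖⁻¹ • x₀)⟫_ℝ) ≤
      ‖(0 : E3) + r • (ω : E3)‖ + ‖(0 : E3) + r • (ω : E3) - x₀‖ - ‖x₀‖ := by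
  have h1 := real_inner_le_norm (r • (ω : E3) - x₀) (-(‖x₀‖⁻¹ • x₀))
  rw [norm_neg, norm_inv_smul_self h, mul_one, inner_sub_left, real_inner_smul_left,
    inner_neg_right (x := x₀), inner_smul_right (x := x₀), real_inner_self_eq_norm_sq] at h1
  have h2 : ‖x₀‖⁻¹ * ‖x₀‖ ^ 2 = ‖x₀‖ := by field_simp
  rw [zero_add, norm_sphere_smul hr]
  linarith

theorem coneWeight_ge {γ ρ ζ m : ℝ} {x₀ x : E3} (hγ : 1 ≤ γ) (hs : 0 < ‖x - x₀‖) (hρ : 0 ≤ ρ)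
    (hρx : ρ ≤ ‖x‖) (hζ : 0 ≤ ζ) (hζx : ζ ≤ ‖x‖ + ‖x - x₀‖ - ‖x₀‖) (hm : 0 ≤ m)
    (hmx : m ≤ ‖x‖ + ‖x - x₀‖ + ‖x₀‖) :
    ρ ^ (γ - 1) * (ζ * m / (2 * ‖x - x₀‖)) + 1 ≤ coneWeight γ x₀ x := by
  unfold coneWeight
  rw [show (‖x‖ + ‖x - x₀‖) ^ 2 - ‖x₀‖ ^ 2 =
    (‖x‖ + ‖x - x₀‖ - ‖x₀‖) * (‖x‖ + ‖x - x₀‖ + ‖x₀‖) by ring]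
  have h1 : ρ ^ (γ - 1) ≤ ‖x‖ ^ (γ - 1) := rpow_le_rpow hρ hρx (by linarith)
  have h2 : 0 ≤ ‖x‖ + ‖x - x₀‖ - ‖x₀‖ := hζ.trans hζx
  gcongr

theorem norm_center_le (x x₀ : E3) : ‖x₀‖ ≤ ‖x‖ + ‖x - x₀‖ := by
  have := norm_sub_le x (x - x₀)
  simpa using this

theorem coneWeight_ge_center {γ : ℝ} {x₀ : E3} (hγ : 1 ≤ γ) (h : 0 < ‖x₀‖) {s : ℝ} (hs : 0 < s)
    (hsr : s ≤ ‖x₀‖ / 2) (ω : Metric.sphere (0 : E3) 1) :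
    (‖x₀‖ / 2) ^ (γ - 1) * ‖x₀‖ * (1 + ⟪(ω : E3), ‖x₀‖⁻¹ • x₀⟫_ℝ) + 1 ≤
      coneWeight γ x₀ (x₀ + s • (ω : E3)) := by
  have e := norm_add_smul_sub (x₀ := x₀) hs.le ω
  have hz := mul_one_add_inner_le_center h hs.le ω
  have ht := norm_center_le (x₀ + s • (ω : E3)) x₀
  have hY := (one_add_inner_mem (norm_inv_smul_self h) ω).1
  have hzs := mul_nonneg hs.le hY
  refine le_trans (le_of_eq ?_) (coneWeight_ge (ρ := ‖x₀‖ / 2)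
    (ζ := s * (1 + ⟪(ω : E3), ‖x₀‖⁻¹ • x₀⟫_ℝ)) (m := 2 * ‖x₀‖) hγ (by rwa [e]) (by positivity)
    (by linarith) hzs hz (by positivity) (by linarith))
  rw [e]
  field_simp

theorem coneWeight_ge_origin {γ : ℝ} {x₀ : E3} (hγ : 1 ≤ γ) (h : 0 < ‖x₀‖) {r : ℝ} (hr : 0 < r)
    (ω : Metric.sphere (0 : E3) 1) (hs : 0 < ‖(0 : E3) + r • (ω : E3) - x₀‖)
    (hsr : ‖(0 : E3) + r • (ω : E3) - x₀‖ ≤ ‖x₀‖) :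
    r ^ γ * (1 + ⟪(ω : E3), -(‖x₀‖⁻¹ • x₀)⟫_ℝ) + 1 ≤ coneWeight γ x₀ ((0 : E3) + r • (ω : E3)) := by
  have e : ‖(0 : E3) + r • (ω : E3)‖ = r := by rw [zero_add, norm_sphere_smul hr.le]
  have hz := mul_one_add_inner_le_origin h hr.le ω
  have ht := norm_center_le ((0 : E3) + r • (ω : E3)) x₀
  have hY := (one_add_inner_mem (by rw [norm_neg, norm_inv_smul_self h]) ω :
    0 ≤ 1 + ⟪(ω : E3), -(‖x₀‖⁻¹ • x₀)⟫_ℝ ∧ _).1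
  have hzs := mul_nonneg hr.le hY
  refine le_trans ?_ (coneWeight_ge (ρ := r)
    (ζ := r * (1 + ⟪(ω : E3), -(‖x₀‖⁻¹ • x₀)⟫_ℝ)) (m := 2 * ‖x₀‖) hγ hs hr.le
    e.ge hzs hz (by positivity) (by linarith))
  have h1 : 1 ≤ 2 * ‖x₀‖ / (2 * ‖(0 : E3) + r • (ω : E3) - x₀‖) := by
    rw [one_le_div (by positivity)]; linarith
  have h2 : r ^ γ = r ^ (γ - 1) * r := by
    rw [← rpow_add_one hr.ne']; congr 1; ring
  rw [mul_div_assoc, ← mul_assoc, h2, mul_assoc _ r, add_le_add_iff_right]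
  exact le_mul_of_one_le_right (by positivity) h1

theorem measurable_coneWeight (γ : ℝ) (x₀ : E3) : Measurable (coneWeight γ x₀) := by
  unfold coneWeight
  fun_prop

theorem measurableSet_norm_sub_mem (x₀ : E3) {I : Set ℝ} (hI : MeasurableSet I) :
    MeasurableSet {x : E3 | ‖x - x₀‖ ∈ I} :=
  hI.preimage (f := fun x : E3 => ‖x - x₀‖) (by fun_prop)

theorem half_rpow_mul {r γ : ℝ} (hr : 0 < r) :
    (r / 2) ^ (γ - 1) * r = (1 / 2) ^ (γ - 1) * r ^ γ := by
  rw [div_eq_mul_one_div, mul_rpow hr.le (by norm_num), rpow_sub_one hr.ne']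
  field_simp

theorem lintegral_far_inner_le {p γ : ℝ} (hp : 2 < p) (hγ : 1 < γ) : ∃ C : ℝ, 0 < C ∧
    ∀ x₀ : E3, 0 < ‖x₀‖ → ∀ δ : ℝ, 0 < δ →
      ∫⁻ x in {x : E3 | ‖x - x₀‖ ∈ Set.Icc δ (‖x₀‖ / 2)},
        ENNReal.ofReal (‖x - x₀‖ ^ (-(p + 1)) * coneWeight γ x₀ x ^ (-p)) ≤
          ENNReal.ofReal (C * (‖x₀‖ ^ (-γ) * δ ^ (2 - p))) := by
  have hp1 : 0 < p - 1 := by linarith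
  have hp2 : 0 < p - 2 := by linarith
  refine ⟨48 / (p - 1) * ((1 / 2) ^ (γ - 1))⁻¹ / (p - 2), by positivity, fun x₀ h δ hδ => ?_⟩
  set κ := (‖x₀‖ / 2) ^ (γ - 1) * ‖x₀‖ with hκ
  have hκ0 : 0 < κ := by positivity
  have hmw := measurable_coneWeight γ x₀
  calc _ ≤ ∫⁻ s in Set.Ici δ, ENNReal.ofReal (s ^ 2 * (s ^ (-(p + 1)) *
        (48 / (p - 1) * κ⁻¹ * 1 ^ (1 - p)))) := by
        refine setLIntegral_polar_le (measurableSet_norm_sub_mem x₀ measurableSet_Icc)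
          (by fun_prop) x₀ measurableSet_Ici (fun s hs => hδ.trans_le hs)
          (A := fun s => s ^ (-(p + 1))) (cb := fun s => 48 / (p - 1) * κ⁻¹ * 1 ^ (1 - p))
          (g := fun s ω => (κ * (1 + ⟪(ω : E3), ‖x₀‖⁻¹ • x₀⟫_ℝ) + 1) ^ (-p))
          (fun s hs => rpow_nonneg (hδ.le.trans hs) _) (fun s hs ω hx => ?_)
          (fun s _ => lintegral_sphere_shift_rpow_le (norm_inv_smul_self h) hκ0 one_pos (by linarith))
        rw [Set.mem_ofPred_eq, norm_add_smul_sub hs.le] at hx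
        refine ⟨hx.1, ?_⟩
        rw [norm_add_smul_sub hs.le]
        refine mul_le_mul_of_nonneg_left ?_ (by positivity)
        have hY := mul_nonneg hκ0.le (one_add_inner_mem (norm_inv_smul_self h) ω).1
        exact rpow_le_rpow_of_nonpos (by linarith) (coneWeight_ge_center hγ.le h hs hx.2 ω)
          (by linarith)
    _ = ∫⁻ s in Set.Ici δ, ENNReal.ofReal (48 / (p - 1) * κ⁻¹) * ENNReal.ofReal (s ^ (1 - p)) := by
        refine setLIntegral_congr_fun measurableSet_Ici fun s hs => ?_
        have hs0 : 0 < s := hδ.trans_le hs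
        rw [← ENNReal.ofReal_mul (by positivity), one_rpow, mul_one, ← mul_assoc, ← rpow_natCast,
          ← rpow_add hs0, mul_comm]
        norm_num
        ring_nf
    _ = _ := by
        rw [lintegral_const_mul' _ _ ENNReal.ofReal_ne_top, lintegral_rpow_Ici (by linarith) hδ,
          ← ENNReal.ofReal_mul (by positivity), hκ, half_rpow_mul h, mul_inv, rpow_neg h.le,
          show 1 - p + 1 = 2 - p by ring, neg_div, ← div_neg, neg_sub]
        congr 1
        ring

theorem lintegral_far_outer_le {p γ : ℝ} (hp : 2 < p) (hγ : 1 < γ) (hγ3 : γ < 3) :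
    ∃ C : ℝ, 0 < C ∧ ∀ x₀ : E3, 0 < ‖x₀‖ →
      ∫⁻ x in {x : E3 | ‖x - x₀‖ ∈ Set.Ioc (‖x₀‖ / 2) ‖x₀‖},
        ENNReal.ofReal (‖x - x₀‖ ^ (-(p + 1)) * coneWeight γ x₀ x ^ (-p)) ≤
          ENNReal.ofReal (C * ‖x₀‖ ^ (2 - p - γ)) := by
  have hp1 : 0 < p - 1 := by linarith
  have hγ3' : 0 < 3 - γ := by linarith
  refine ⟨(1 / 2) ^ (-(p + 1)) * (48 / (p - 1)) * 2 ^ (3 - γ) / (3 - γ), by positivity,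
    fun x₀ h => ?_⟩
  have hmw := measurable_coneWeight γ x₀
  calc _ ≤ ∫⁻ r in Set.Ioc 0 (2 * ‖x₀‖), ENNReal.ofReal (r ^ 2 * ((‖x₀‖ / 2) ^ (-(p + 1)) *
        (48 / (p - 1) * (r ^ γ)⁻¹ * 1 ^ (1 - p)))) := by
        refine setLIntegral_polar_le (measurableSet_norm_sub_mem x₀ measurableSet_Ioc)
          (by fun_prop) 0 measurableSet_Ioc (fun s hs => hs.1)
          (A := fun s => (‖x₀‖ / 2) ^ (-(p + 1)))
          (cb := fun r => 48 / (p - 1) * (r ^ γ)⁻¹ * 1 ^ (1 - p))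
          (g := fun r ω => (r ^ γ * (1 + ⟪(ω : E3), -(‖x₀‖⁻¹ • x₀)⟫_ℝ) + 1) ^ (-p))
          (fun s hs => by positivity) (fun r hr ω hx => ?_)
          (fun r hr => lintegral_sphere_shift_rpow_le (by rw [norm_neg, norm_inv_smul_self h])
            (rpow_pos_of_pos hr.1 _) one_pos (by linarith))
        rw [Set.mem_ofPred_eq] at hx
        have e : ‖(0 : E3) + r • (ω : E3)‖ = r := by rw [zero_add, norm_sphere_smul hr.le]
        have hs0 : 0 < ‖(0 : E3) + r • (ω : E3) - x₀‖ := by have := hx.1; linarith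
        refine ⟨⟨hr, ?_⟩, ?_⟩
        · have := norm_sub_norm_le ((0 : E3) + r • (ω : E3)) x₀
          rw [e] at this
          linarith [hx.2]
        have hY := (one_add_inner_mem (by rw [norm_neg, norm_inv_smul_self h]) ω :
          0 ≤ 1 + ⟪(ω : E3), -(‖x₀‖⁻¹ • x₀)⟫_ℝ ∧ _).1
        have hrY := mul_nonneg (rpow_nonneg hr.le γ) hY
        refine mul_le_mul ?_ ?_ (rpow_nonneg coneWeight_pos.le _) (by positivity)
        · exact rpow_le_rpow_of_nonpos (by positivity) hx.1.le (by linarith)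
        · exact rpow_le_rpow_of_nonpos (by linarith) (coneWeight_ge_origin hγ.le h hr ω hs0 hx.2)
            (by linarith)
    _ = ∫⁻ r in Set.Ioc 0 (2 * ‖x₀‖), ENNReal.ofReal ((‖x₀‖ / 2) ^ (-(p + 1)) * (48 / (p - 1))) *
          ENNReal.ofReal (r ^ (2 - γ)) := by
        refine setLIntegral_congr_fun measurableSet_Ioc fun r hr => ?_
        rw [← ENNReal.ofReal_mul (by positivity), one_rpow, mul_one, rpow_sub hr.1]
        congr 1
        norm_num
        ring
    _ = _ := by
        rw [lintegral_const_mul' _ _ ENNReal.ofReal_ne_top,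
          lintegral_rpow_Ioc_zero (by linarith) (by positivity),
          ← ENNReal.ofReal_mul (by positivity), show 2 - γ + 1 = 3 - γ by ring,
          mul_rpow zero_le_two h.le, div_eq_mul_one_div ‖x₀‖, mul_rpow h.le (by norm_num),
          show 2 - p - γ = -(p + 1) + (3 - γ) by ring, rpow_add h]
        congr 1
        ring

/-- Contribution of the far part of the cone to the Hölder weight. -/
theorem lintegral_far_le {p γ : ℝ} (hp : 2 < p) (hγ : 1 < γ) (hγ3 : γ < 3) :
    ∃ C : ℝ, 0 < C ∧ ∀ x₀ : E3, 0 < ‖x₀‖ → ∀ δ : ℝ, 0 < δ → δ ≤ ‖x₀‖ →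
      ∫⁻ x in {x : E3 | ‖x - x₀‖ ∈ Set.Icc δ ‖x₀‖},
        ENNReal.ofReal (‖x - x₀‖ ^ (-(p + 1)) * coneWeight γ x₀ x ^ (-p)) ≤
          ENNReal.ofReal (C * (‖x₀‖ ^ (-γ) * δ ^ (2 - p))) := by
  obtain ⟨C1, h1, H1⟩ := lintegral_far_inner_le hp hγ
  obtain ⟨C2, h2, H2⟩ := lintegral_far_outer_le hp hγ hγ3
  refine ⟨C1 + C2, by positivity, fun x₀ h δ hδ hδr => ?_⟩
  calc _ ≤ ∫⁻ x in {x : E3 | ‖x - x₀‖ ∈ Set.Icc δ (‖x₀‖ / 2)} ∪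
          {x : E3 | ‖x - x₀‖ ∈ Set.Ioc (‖x₀‖ / 2) ‖x₀‖},
          ENNReal.ofReal (‖x - x₀‖ ^ (-(p + 1)) * coneWeight γ x₀ x ^ (-p)) := by
        refine lintegral_mono_set fun x hx => ?_
        rcases le_or_gt ‖x - x₀‖ (‖x₀‖ / 2) with h' | h'
        · exact Or.inl ⟨hx.1, h'⟩
        · exact Or.inr ⟨h', hx.2⟩
    _ ≤ _ := lintegral_union_le _ _ _
    _ ≤ _ := add_le_add (H1 x₀ h δ hδ) (H2 x₀ h)
    _ ≤ _ := by
        rw [← ENNReal.ofReal_add (by positivity) (by positivity)]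
        refine ENNReal.ofReal_le_ofReal ?_
        have h3 : ‖x₀‖ ^ (2 - p - γ) ≤ ‖x₀‖ ^ (-γ) * δ ^ (2 - p) := by
          rw [show 2 - p - γ = -γ + (2 - p) by ring, rpow_add h]
          gcongr ?_ * ?_
          exact rpow_le_rpow_of_nonpos hδ hδr (by linarith)
        nlinarith

/-- Contribution of the near part of the cone to the Hölder weight. -/
theorem lintegral_near_le {p γ : ℝ} (hp : 1 < p) (hp3 : p < 3) (hγ : 1 < γ) : ∃ C : ℝ, 0 < C ∧
    ∀ x₀ : E3, 0 < ‖x₀‖ → ∀ δ : ℝ, 0 < δ → δ ≤ ‖x₀‖ / 2 →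
      ∫⁻ x in {x : E3 | ‖x - x₀‖ ∈ Set.Ioo 0 δ},
        ENNReal.ofReal (‖x - x₀‖ ^ (-((p + 1) / 2)) * coneWeight γ x₀ x ^ (-((p - 1) / 2))) ≤
          ENNReal.ofReal (C * (‖x₀‖ ^ (-(γ * ((p - 1) / 2))) * δ ^ ((5 - p) / 2))) := by
  set q := (p - 1) / 2 with hq
  have hq0 : 0 < q := by rw [hq]; linarith
  have hq1 : 0 < 1 - q := by rw [hq]; linarith
  have h5 : 0 < (5 - p) / 2 := by linarith
  refine ⟨48 * (2 ^ (1 - q) / (1 - q)) * ((1 / 2) ^ (γ - 1)) ^ (-q) / ((5 - p) / 2), by positivity,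
    fun x₀ h δ hδ hδr => ?_⟩
  set κ := (‖x₀‖ / 2) ^ (γ - 1) * ‖x₀‖ with hκ
  have hκ0 : 0 < κ := by positivity
  have hmw := measurable_coneWeight γ x₀
  calc _ ≤ ∫⁻ s in Set.Ioc 0 δ, ENNReal.ofReal (s ^ 2 * (s ^ (-((p + 1) / 2)) *
        (48 * (2 ^ (1 - q) / (1 - q)) * κ ^ (-q)))) := by
        refine setLIntegral_polar_le (measurableSet_norm_sub_mem x₀ measurableSet_Ioo)
          (by fun_prop) x₀ measurableSet_Ioc (fun s hs => hs.1)
          (A := fun s => s ^ (-((p + 1) / 2)))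
          (cb := fun s => 48 * (2 ^ (1 - q) / (1 - q)) * κ ^ (-q))
          (g := fun s ω => (κ * (1 + ⟪(ω : E3), ‖x₀‖⁻¹ • x₀⟫_ℝ) + 1) ^ (-q))
          (fun s hs => rpow_nonneg hs.1.le _) (fun s hs ω hx => ?_)
          (fun s _ => lintegral_sphere_one_rpow_le (norm_inv_smul_self h) hκ0 hq0.le (by linarith))
        rw [Set.mem_ofPred_eq, norm_add_smul_sub hs.le] at hx
        refine ⟨Set.Ioo_subset_Ioc_self hx, ?_⟩
        rw [norm_add_smul_sub hs.le]
        refine mul_le_mul_of_nonneg_left ?_ (by positivity)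
        have hY := mul_nonneg hκ0.le (one_add_inner_mem (norm_inv_smul_self h) ω).1
        exact rpow_le_rpow_of_nonpos (by linarith)
          (coneWeight_ge_center hγ.le h hs (hx.2.le.trans hδr) ω) (by linarith)
    _ = ∫⁻ s in Set.Ioc 0 δ, ENNReal.ofReal (48 * (2 ^ (1 - q) / (1 - q)) * κ ^ (-q)) *
          ENNReal.ofReal (s ^ ((3 - p) / 2)) := by
        refine setLIntegral_congr_fun measurableSet_Ioc fun s hs => ?_
        rw [← ENNReal.ofReal_mul (by positivity), ← mul_assoc, ← rpow_natCast, ← rpow_add hs.1,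
          mul_comm]
        norm_num
        ring_nf
    _ = _ := by
        rw [lintegral_const_mul' _ _ ENNReal.ofReal_ne_top,
          lintegral_rpow_Ioc_zero (by linarith) hδ.le,
          ← ENNReal.ofReal_mul (by positivity), hκ, half_rpow_mul h,
          mul_rpow (by positivity) (by positivity), ← rpow_mul h.le,
          show (3 - p) / 2 + 1 = (5 - p) / 2 by ring, mul_neg]
        congr 1
        ring

/-- Part of the backward cone of `(t₀, x₀)` lying outside of `Dset`, up to enlargement. -/
def coneOut (t₀ : ℝ) (x₀ : E3) : Set E3 :=
  {x | 0 < ‖x - x₀‖ ∧ ‖x - x₀‖ < t₀ ∧ t₀ - ‖x - x₀‖ ≤ ‖x‖ - 23 / 10}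

theorem measurableSet_coneOut (t₀ : ℝ) (x₀ : E3) : MeasurableSet (coneOut t₀ x₀) := by
  have h1 : MeasurableSet {x : E3 | 0 < ‖x - x₀‖} := measurableSet_lt (by fun_prop) (by fun_prop)
  have h2 : MeasurableSet {x : E3 | ‖x - x₀‖ < t₀} := measurableSet_lt (by fun_prop) (by fun_prop)
  have h3 : MeasurableSet {x : E3 | t₀ - ‖x - x₀‖ ≤ ‖x‖ - 23 / 10} :=
    measurableSet_le (by fun_prop) (by fun_prop)
  exact h1.inter (h2.inter h3)

theorem coneOut_subset (t₀ : ℝ) (x₀ : E3) : coneOut t₀ x₀ ⊆ coneExt t₀ x₀ := fun _ hx =>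
  ⟨hx.1, hx.2.1, hx.2.2.trans (by linarith)⟩

theorem rpow_mul_coneWeight_le {p γ ρ ζ m : ℝ} {x₀ x : E3} (hp : 0 < p) (hγ : 1 ≤ γ)
    (hs : 0 < ‖x - x₀‖) (hρ : 0 < ρ) (hρx : ρ ≤ ‖x‖) (hζ : 0 < ζ)
    (hζx : ζ ≤ ‖x‖ + ‖x - x₀‖ - ‖x₀‖) (hm : 0 < m) (hmx : m ≤ ‖x‖ + ‖x - x₀‖ + ‖x₀‖) :
    ‖x - x₀‖ ^ (-(p + 1)) * coneWeight γ x₀ x ^ (-p) ≤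
      2 ^ p * ‖x - x₀‖⁻¹ * m ^ (-p) * ρ ^ (-((γ - 1) * p)) * ζ ^ (-p) := by
  have h1 := coneWeight_ge hγ hs hρ.le hρx hζ.le hζx hm.le hmx
  have h2 : coneWeight γ x₀ x ^ (-p) ≤ (ρ ^ (γ - 1) * (ζ * m / (2 * ‖x - x₀‖))) ^ (-p) :=
    rpow_le_rpow_of_nonpos (by positivity) (by linarith) (by linarith)
  refine (mul_le_mul_of_nonneg_left h2 (by positivity)).trans (le_of_eq ?_)
  set s := ‖x - x₀‖
  rw [mul_rpow (by positivity) (by positivity), ← rpow_mul hρ.le, div_rpow (by positivity)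
    (by positivity), mul_rpow hζ.le hm.le, mul_rpow zero_le_two hs.le, rpow_neg hs.le (p + 1),
    rpow_add_one hs.ne', rpow_neg zero_le_two, rpow_neg hs.le p, mul_neg]
  field_simp

theorem coneOut_bounds {t₀ : ℝ} {x₀ x : E3} (hr₀ : ‖x₀‖ < t₀ + 2) (hx : x ∈ coneOut t₀ x₀) :
    (1 + |‖x₀‖ - t₀|) / 10 ≤ ‖x‖ + ‖x - x₀‖ - ‖x₀‖ ∧
      2 + t₀ + ‖x₀‖ ≤ ‖x‖ + ‖x - x₀‖ + ‖x₀‖ ∧ 0 < ‖x‖ ∧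
      t₀ + 23 / 10 - ‖x₀‖ ≤ ‖x‖ + ‖x - x₀‖ - ‖x₀‖ := by
  obtain ⟨h1, h2, h3⟩ := hx
  refine ⟨?_, by linarith, by linarith, by linarith⟩
  rcases abs_cases (‖x₀‖ - t₀) with h | h <;> linarith

theorem lintegral_coneOut_small_le {p γ : ℝ} (hp : 1 < p) (hγ : 1 < γ) :
    ∃ C : ℝ, 0 < C ∧ ∀ t₀ : ℝ, 0 ≤ t₀ → ∀ x₀ : E3, ‖x₀‖ < t₀ + 2 →
      ‖x₀‖ ≤ (2 + t₀ + ‖x₀‖) / 8 →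
      ∫⁻ x in coneOut t₀ x₀,
        ENNReal.ofReal (‖x - x₀‖ ^ (-(p + 1)) * coneWeight γ x₀ x ^ (-p)) ≤
          ENNReal.ofReal (C * ((2 + t₀ + ‖x₀‖) ^ (1 - γ * p) * (1 + |‖x₀‖ - t₀|) ^ (1 - p))) := by
  set V : ℝ := (volume (Metric.ball (0 : E3) 1)).toReal with hV
  have hVtop : volume (Metric.ball (0 : E3) 1) ≠ ⊤ := measure_ball_lt_top.ne
  have hVpos : 0 < V := ENNReal.toReal_pos (Metric.measure_ball_pos _ _ one_pos).ne' hVtop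
  set c := 2 ^ p * (3 / 8)⁻¹ * (1 / 4) ^ (-((γ - 1) * p)) * (3 / 4 : ℝ) ^ (-p) with hc
  have hc0 : 0 < c := by positivity
  refine ⟨c * V, by positivity, fun t₀ ht₀ x₀ hr₀ hM8 => ?_⟩
  set M := 2 + t₀ + ‖x₀‖ with hM
  have hM0 : 0 < M := by positivity
  have hu : 0 < 1 + |‖x₀‖ - t₀| := by positivity
  have huM : 1 + |‖x₀‖ - t₀| ≤ M := by
    rcases abs_cases (‖x₀‖ - t₀) with h | h <;> linarith [norm_nonneg x₀]
  calc _ ≤ ∫⁻ x in coneOut t₀ x₀, ENNReal.ofReal (c * M ^ (-1 - p - γ * p)) := by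
        refine setLIntegral_mono' (measurableSet_coneOut t₀ x₀) fun x hx => ?_
        obtain ⟨h1, h2, h3, h4⟩ := coneOut_bounds hr₀ hx
        refine ENNReal.ofReal_le_ofReal ?_
        have hz : 3 / 4 * M ≤ ‖x‖ + ‖x - x₀‖ - ‖x₀‖ := by linarith
        have hxs : ‖x‖ ≤ ‖x - x₀‖ + ‖x₀‖ := by simpa using norm_add_le (x - x₀) x₀
        have hsx := norm_sub_le x x₀
        have hs : 3 / 8 * M ≤ ‖x - x₀‖ := by linarith
        have hr : 1 / 4 * M ≤ ‖x‖ := by linarith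
        refine (rpow_mul_coneWeight_le (by linarith) hγ.le hx.1 (ρ := 1 / 4 * M) (by positivity) hr
          (ζ := 3 / 4 * M) (by positivity) hz hM0 h2).trans ?_
        have : ‖x - x₀‖⁻¹ ≤ (3 / 8 * M)⁻¹ := inv_anti₀ (by positivity) hs
        calc _ ≤ 2 ^ p * (3 / 8 * M)⁻¹ * M ^ (-p) * (1 / 4 * M) ^ (-((γ - 1) * p)) *
              (3 / 4 * M) ^ (-p) := by gcongr
          _ = _ := by
            rw [mul_rpow (by norm_num) hM0.le, mul_rpow (by norm_num) hM0.le, mul_inv,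
              show -1 - p - γ * p = -1 + -p + -((γ - 1) * p) + -p by ring, rpow_add hM0,
              rpow_add hM0, rpow_add hM0, rpow_neg_one]
            ring
    _ = ENNReal.ofReal (c * M ^ (-1 - p - γ * p)) * volume (coneOut t₀ x₀) :=
        setLIntegral_const _ _
    _ ≤ ENNReal.ofReal (c * M ^ (-1 - p - γ * p)) * volume (Metric.ball x₀ M) := by
        gcongr
        intro x hx
        rw [Metric.mem_ball, dist_eq_norm]
        linarith [hx.2.1, norm_nonneg x₀]
    _ = ENNReal.ofReal (c * M ^ (-1 - p - γ * p) * (M ^ 3 * V)) := by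
        rw [Measure.addHaar_ball _ _ hM0.le, ← ENNReal.ofReal_toReal hVtop, ← hV,
          ← ENNReal.ofReal_mul (by positivity), ← ENNReal.ofReal_mul (by positivity)]
        simp
    _ ≤ _ := by
        refine ENNReal.ofReal_le_ofReal ?_
        have h1 : M ^ (1 - p) ≤ (1 + |‖x₀‖ - t₀|) ^ (1 - p) :=
          rpow_le_rpow_of_nonpos hu huM (by linarith)
        have h2 : M ^ (-1 - p - γ * p) * M ^ 3 = M ^ (1 - γ * p) * M ^ (1 - p) := by
          rw [← rpow_natCast, ← rpow_add hM0, ← rpow_add hM0]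
          norm_num
          ring_nf
        calc _ = c * V * (M ^ (-1 - p - γ * p) * M ^ 3) := by ring
          _ = c * V * (M ^ (1 - γ * p) * M ^ (1 - p)) := by rw [h2]
          _ ≤ _ := by gcongr

theorem half_add_le {a b z : ℝ} (ha : a ≤ z) (hb : b ≤ z) : a / 2 + b / 2 ≤ z := by linarith

theorem lintegral_coneOut_near_le {p γ : ℝ} (hp : 1 < p) (hγ : 1 < γ) :
    ∃ C : ℝ, 0 < C ∧ ∀ t₀ : ℝ, 0 ≤ t₀ → ∀ x₀ : E3, ‖x₀‖ < t₀ + 2 →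
      (2 + t₀ + ‖x₀‖) / 8 < ‖x₀‖ →
      ∫⁻ x in coneOut t₀ x₀ ∩ {x | ‖x - x₀‖ ∈ Set.Iic (‖x₀‖ / 2)},
        ENNReal.ofReal (‖x - x₀‖ ^ (-(p + 1)) * coneWeight γ x₀ x ^ (-p)) ≤
          ENNReal.ofReal (C * ((2 + t₀ + ‖x₀‖) ^ (1 - γ * p) * (1 + |‖x₀‖ - t₀|) ^ (1 - p))) := by
  have hp1 : 0 < p - 1 := by linarith
  refine ⟨2 ^ p * (1 / 16) ^ (-((γ - 1) * p)) * (48 / (p - 1) * 2 * (1 / 20) ^ (1 - p)),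
    by positivity, fun t₀ ht₀ x₀ hr₀ hM8 => ?_⟩
  set M := 2 + t₀ + ‖x₀‖ with hM
  set u := 1 + |‖x₀‖ - t₀| with hu'
  have hM0 : 0 < M := by positivity
  have hu : 0 < u := by positivity
  have h : 0 < ‖x₀‖ := by linarith
  have hmw := measurable_coneWeight γ x₀
  set K := 2 ^ p * M ^ (-p) * (1 / 16 * M) ^ (-((γ - 1) * p)) with hK
  have hK0 : 0 < K := by positivity
  calc _ ≤ ∫⁻ s in Set.Ioc 0 M, ENNReal.ofReal (s ^ 2 * (K * s⁻¹ *
        (48 / (p - 1) * (s / 2)⁻¹ * (u / 20) ^ (1 - p)))) := by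
        refine setLIntegral_polar_le ((measurableSet_coneOut t₀ x₀).inter
          (measurableSet_norm_sub_mem x₀ measurableSet_Iic))
          (by fun_prop) x₀ measurableSet_Ioc (fun s hs => hs.1)
          (A := fun s => K * s⁻¹) (cb := fun s => 48 / (p - 1) * (s / 2)⁻¹ * (u / 20) ^ (1 - p))
          (g := fun s ω => (s / 2 * (1 + ⟪(ω : E3), ‖x₀‖⁻¹ • x₀⟫_ℝ) + u / 20) ^ (-p))
          (fun s hs => mul_nonneg hK0.le (inv_nonneg.2 hs.1.le)) (fun s hs ω hx => ?_)
          (fun s hs => lintegral_sphere_shift_rpow_le (norm_inv_smul_self h) (half_pos hs.1)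
            (by positivity) hp)
        obtain ⟨hx, hx2⟩ := hx
        have e := norm_add_smul_sub (x₀ := x₀) hs.le ω
        rw [Set.mem_ofPred_eq, e] at hx2
        obtain ⟨h1, h2, h3, h4⟩ := coneOut_bounds hr₀ hx
        have hxt := hx.2.1
        rw [e] at hxt
        refine ⟨⟨hs, by linarith⟩, ?_⟩
        have hY := (one_add_inner_mem (norm_inv_smul_self h) ω).1
        have hz := mul_one_add_inner_le_center h hs.le ω
        have ht := norm_center_le (x₀ + s • (ω : E3)) x₀
        rw [e] at ht
        have hx2' : s ≤ ‖x₀‖ / 2 := hx2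
        refine (rpow_mul_coneWeight_le (by linarith) hγ.le hx.1 (ρ := 1 / 16 * M) (by positivity)
          (by linarith) (ζ := s / 2 * (1 + ⟪(ω : E3), ‖x₀‖⁻¹ • x₀⟫_ℝ) + u / 20) (by positivity)
          (by linarith [half_add_le hz h1]) hM0 h2).trans (le_of_eq ?_)
        rw [e, hK]
        ring
    _ = ∫⁻ s in Set.Ioc 0 M, ENNReal.ofReal (K * (48 / (p - 1) * 2 * (u / 20) ^ (1 - p))) := by
        refine setLIntegral_congr_fun measurableSet_Ioc fun s hs => ?_
        have := hs.1
        congr 1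
        field_simp
    _ = _ := by
        rw [setLIntegral_const, Real.volume_Ioc, ← ENNReal.ofReal_mul (by positivity), hK,
          div_eq_mul_one_div u, mul_rpow hu.le (by norm_num), mul_rpow (by norm_num) hM0.le,
          show 1 - γ * p = -p + -((γ - 1) * p) + 1 by ring, rpow_add hM0, rpow_add hM0, rpow_one]
        congr 1
        ring

theorem lintegral_coneOut_far_le {p γ : ℝ} (hp : 1 < p) (hγ : 1 < γ) (hγp : (γ - 1) * p < 2) :
    ∃ C : ℝ, 0 < C ∧ ∀ t₀ : ℝ, 0 ≤ t₀ → ∀ x₀ : E3, ‖x₀‖ < t₀ + 2 →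
      (2 + t₀ + ‖x₀‖) / 8 < ‖x₀‖ →
      ∫⁻ x in coneOut t₀ x₀ ∩ {x | ‖x - x₀‖ ∈ Set.Ioi (‖x₀‖ / 2)},
        ENNReal.ofReal (‖x - x₀‖ ^ (-(p + 1)) * coneWeight γ x₀ x ^ (-p)) ≤
          ENNReal.ofReal (C * ((2 + t₀ + ‖x₀‖) ^ (1 - γ * p) * (1 + |‖x₀‖ - t₀|) ^ (1 - p))) := by
  have hp1 : 0 < p - 1 := by linarith
  set k := (γ - 1) * p with hk
  have hk2 : 0 < 2 - k := by linarith
  refine ⟨2 ^ p * 16 * (48 / (p - 1) * 2 * (1 / 20) ^ (1 - p)) * (2 ^ (2 - k) / (2 - k)),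
    by positivity, fun t₀ ht₀ x₀ hr₀ hM8 => ?_⟩
  set M := 2 + t₀ + ‖x₀‖ with hM
  set u := 1 + |‖x₀‖ - t₀| with hu'
  have hM0 : 0 < M := by positivity
  have hu : 0 < u := by positivity
  have h : 0 < ‖x₀‖ := by linarith
  have hmw := measurable_coneWeight γ x₀
  set K := 2 ^ p * (16 * M⁻¹) * M ^ (-p) with hK
  have hK0 : 0 < K := by positivity
  have he : ‖-(‖x₀‖⁻¹ • x₀)‖ = 1 := by rw [norm_neg, norm_inv_smul_self h]
  calc _ ≤ ∫⁻ r in Set.Ioc 0 (2 * M), ENNReal.ofReal (r ^ 2 * (K * r ^ (-k) *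
        (48 / (p - 1) * (r / 2)⁻¹ * (u / 20) ^ (1 - p)))) := by
        refine setLIntegral_polar_le ((measurableSet_coneOut t₀ x₀).inter
          (measurableSet_norm_sub_mem x₀ measurableSet_Ioi))
          (by fun_prop) 0 measurableSet_Ioc (fun s hs => hs.1)
          (A := fun r => K * r ^ (-k)) (cb := fun r => 48 / (p - 1) * (r / 2)⁻¹ * (u / 20) ^ (1 - p))
          (g := fun r ω => (r / 2 * (1 + ⟪(ω : E3), -(‖x₀‖⁻¹ • x₀)⟫_ℝ) + u / 20) ^ (-p))
          (fun s hs => mul_nonneg hK0.le (rpow_nonneg hs.1.le _)) (fun r hr ω hx => ?_)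
          (fun r hr => lintegral_sphere_shift_rpow_le he (half_pos hr.1) (by positivity) hp)
        obtain ⟨hx, hx2⟩ := hx
        have e : ‖(0 : E3) + r • (ω : E3)‖ = r := by rw [zero_add, norm_sphere_smul hr.le]
        rw [Set.mem_ofPred_eq] at hx2
        have hx2' : ‖x₀‖ / 2 < ‖(0 : E3) + r • (ω : E3) - x₀‖ := hx2
        obtain ⟨h1, h2, h3, h4⟩ := coneOut_bounds hr₀ hx
        have hxt := hx.2.1
        have hxs := norm_add_le ((0 : E3) + r • (ω : E3) - x₀) x₀
        rw [sub_add_cancel, e] at hxs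
        refine ⟨⟨hr, by linarith⟩, ?_⟩
        have hY := (one_add_inner_mem he ω).1
        have hz := mul_one_add_inner_le_origin h hr.le ω
        refine (rpow_mul_coneWeight_le (by linarith) hγ.le hx.1 (ρ := r) hr
          e.ge (ζ := r / 2 * (1 + ⟪(ω : E3), -(‖x₀‖⁻¹ • x₀)⟫_ℝ) + u / 20) (by positivity)
          (by linarith [half_add_le hz h1]) hM0 h2).trans ?_
        have h5 : ‖(0 : E3) + r • (ω : E3) - x₀‖⁻¹ ≤ 16 * M⁻¹ := by
          rw [← div_eq_mul_inv, inv_le_comm₀ hx.1 (by positivity), inv_div]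
          linarith
        rw [hK]
        gcongr
    _ = ∫⁻ r in Set.Ioc 0 (2 * M), ENNReal.ofReal (K * (48 / (p - 1) * 2 * (u / 20) ^ (1 - p))) *
          ENNReal.ofReal (r ^ (1 - k)) := by
        refine setLIntegral_congr_fun measurableSet_Ioc fun r hr => ?_
        have hr0 := hr.1
        rw [← ENNReal.ofReal_mul (by positivity), rpow_sub hr0, rpow_one, rpow_neg hr0.le]
        congr 1
        field_simp
    _ = _ := by
        rw [lintegral_const_mul' _ _ ENNReal.ofReal_ne_top,
          lintegral_rpow_Ioc_zero (by linarith) (by positivity),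
          ← ENNReal.ofReal_mul (by positivity), hK, show 1 - k + 1 = 2 - k by ring,
          mul_rpow zero_le_two hM0.le,
          div_eq_mul_one_div u, mul_rpow hu.le (by norm_num),
          show 1 - γ * p = -1 + -p + (2 - k) by rw [hk]; ring, rpow_add hM0, rpow_add hM0,
          rpow_neg_one]
        congr 1
        ring

/-- The Hölder weight of the exterior source seen from a point with `|x₀| < t₀ + 2`. -/
theorem lintegral_coneOut_le {p γ : ℝ} (hp : 1 < p) (hγ : 1 < γ) (hγp : (γ - 1) * p < 2) :
    ∃ C : ℝ, 0 < C ∧ ∀ t₀ : ℝ, 0 ≤ t₀ → ∀ x₀ : E3, ‖x₀‖ < t₀ + 2 →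
      ∫⁻ x in coneOut t₀ x₀,
        ENNReal.ofReal (‖x - x₀‖ ^ (-(p + 1)) * coneWeight γ x₀ x ^ (-p)) ≤
          ENNReal.ofReal (C * ((2 + t₀ + ‖x₀‖) ^ (1 - γ * p) * (1 + |‖x₀‖ - t₀|) ^ (1 - p))) := by
  obtain ⟨C1, h1, H1⟩ := lintegral_coneOut_small_le hp hγ
  obtain ⟨C2, h2, H2⟩ := lintegral_coneOut_near_le hp hγ
  obtain ⟨C3, h3, H3⟩ := lintegral_coneOut_far_le hp hγ hγp
  refine ⟨C1 + (C2 + C3), by positivity, fun t₀ ht₀ x₀ hr₀ => ?_⟩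
  set Q := (2 + t₀ + ‖x₀‖) ^ (1 - γ * p) * (1 + |‖x₀‖ - t₀|) ^ (1 - p) with hQ
  have hQ0 : 0 ≤ Q := by positivity
  rcases le_or_gt ‖x₀‖ ((2 + t₀ + ‖x₀‖) / 8) with h | h
  · refine (H1 t₀ ht₀ x₀ hr₀ h).trans (ENNReal.ofReal_le_ofReal ?_)
    gcongr
    linarith
  · rw [← lintegral_inter_add_sdiff _ (coneOut t₀ x₀)
      (measurableSet_norm_sub_mem x₀ (measurableSet_Iic (a := ‖x₀‖ / 2)))]
    have hsub : coneOut t₀ x₀ \ {x | ‖x - x₀‖ ∈ Set.Iic (‖x₀‖ / 2)} ⊆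
        coneOut t₀ x₀ ∩ {x | ‖x - x₀‖ ∈ Set.Ioi (‖x₀‖ / 2)} := fun x hx =>
      by
      have h' : ‖x₀‖ / 2 < ‖x - x₀‖ := not_le.1 fun hle => hx.2 hle
      exact ⟨hx.1, h'⟩
    refine (add_le_add (H2 t₀ ht₀ x₀ hr₀ h)
      ((lintegral_mono_set hsub).trans (H3 t₀ ht₀ x₀ hr₀ h))).trans ?_
    rw [← ENNReal.ofReal_add (by positivity) (by positivity), ← add_mul]
    refine ENNReal.ofReal_le_ofReal ?_
    exact mul_le_mul_of_nonneg_right (by linarith) hQ0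

theorem setLIntegral_ofReal_holder {S : Set E3} (hS : MeasurableSet S) {F f g : E3 → ℝ} {θ : ℝ}
    (hθ : 0 ≤ θ) (hθ1 : θ ≤ 1) (hf : Measurable f) (hg : Measurable g)
    (hf0 : ∀ x ∈ S, 0 ≤ f x) (hg0 : ∀ x ∈ S, 0 ≤ g x)
    (h : ∀ x ∈ S, F x ≤ f x ^ θ * g x ^ (1 - θ)) :
    ∫⁻ x in S, ENNReal.ofReal (F x) ≤
      (∫⁻ x in S, ENNReal.ofReal (f x)) ^ θ * (∫⁻ x in S, ENNReal.ofReal (g x)) ^ (1 - θ) := by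
  refine le_trans (setLIntegral_mono' hS fun x hx => ?_)
    (ENNReal.lintegral_mul_norm_pow_le hf.ennreal_ofReal.aemeasurable
      hg.ennreal_ofReal.aemeasurable hθ (sub_nonneg.2 hθ1) (by ring))
  rw [ENNReal.ofReal_rpow_of_nonneg (hf0 x hx) hθ,
    ENNReal.ofReal_rpow_of_nonneg (hg0 x hx) (sub_nonneg.2 hθ1),
    ← ENNReal.ofReal_mul (rpow_nonneg (hf0 x hx) _)]
  exact ENNReal.ofReal_le_ofReal (h x hx)

/-- The Duhamel source on the backward cone. -/
def coneSource (p : ℝ) (φ : ℝ → E3 → ℝ) (t₀ : ℝ) (x₀ x : E3) : ℝ :=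
  ‖x - x₀‖⁻¹ * |φ (t₀ - ‖x - x₀‖) x| ^ p

theorem measurable_slice_cone {φ : ℝ → E3 → ℝ} (hφ : Continuous fun q : ℝ × E3 => φ q.1 q.2)
    (t₀ : ℝ) (x₀ : E3) : Measurable fun x => φ (t₀ - ‖x - x₀‖) x :=
  (hφ.comp (by fun_prop : Continuous fun x : E3 => (t₀ - ‖x - x₀‖, x))).measurable

theorem measurable_coneSource (p : ℝ) {φ : ℝ → E3 → ℝ}
    (hφ : Continuous fun q : ℝ × E3 => φ q.1 q.2) (t₀ : ℝ) (x₀ : E3) :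
    Measurable (coneSource p φ t₀ x₀) := by
  have := measurable_slice_cone hφ t₀ x₀
  unfold coneSource
  fun_prop

theorem lintegral_coneSource_le {p γ : ℝ} (hp : 0 < p) (hγ : 1 ≤ γ) (hγ2 : γ ≤ 2) (hγp : γ ≤ p - 1)
    {φ : ℝ → E3 → ℝ} (hφ : IsNLWSolution p φ) (hE : wEnergy p 0 γ φ ≠ ⊤) (t₀ : ℝ) (x₀ : E3)
    {S : Set E3} (hS : MeasurableSet S) (hSc : S ⊆ coneExt t₀ x₀) {T : ℝ} (hT0 : 0 ≤ T)
    (hT : ∫⁻ x in S, ENNReal.ofReal (‖x - x₀‖ ^ (-(p + 1)) * coneWeight γ x₀ x ^ (-p)) ≤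
      ENNReal.ofReal T) :
    ∫⁻ x in S, ENNReal.ofReal (coneSource p φ t₀ x₀ x) ≤
      ENNReal.ofReal ((8 * (p + 1) * (wEnergy p 0 γ φ).toReal) ^ (p / (p + 1)) *
        T ^ (1 / (p + 1))) := by
  have hm := measurable_slice_cone hφ.contDiff.continuous t₀ x₀
  have hmw := measurable_coneWeight γ x₀
  have hp1 : 0 < p + 1 := by linarith
  have hθ : 1 - p / (p + 1) = 1 / (p + 1) := by field_simp; ring
  have hθ0 : 0 ≤ p / (p + 1) := by positivity
  have hE0 : 0 ≤ (wEnergy p 0 γ φ).toReal := ENNReal.toReal_nonneg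
  refine (setLIntegral_ofReal_holder hS (f := fun x => coneWeight γ x₀ x *
    |φ (t₀ - ‖x - x₀‖) x| ^ (p + 1)) (g := fun x => ‖x - x₀‖ ^ (-(p + 1)) *
      coneWeight γ x₀ x ^ (-p)) (θ := p / (p + 1)) hθ0 (by rw [div_le_one hp1]; linarith)
    (hmw.mul ((measurable_norm.comp hm).pow_const _)) (by fun_prop)
    (fun x _ => mul_nonneg coneWeight_pos.le (by positivity))
    (fun x _ => mul_nonneg (by positivity) (rpow_nonneg coneWeight_pos.le _)) fun x hx => ?_).trans ?_
  · have hs : 0 < ‖x - x₀‖ := (hSc hx).1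
    have hw : 0 < coneWeight γ x₀ x := coneWeight_pos
    rw [hθ, mul_rpow hw.le (by positivity), mul_rpow (by positivity) (by positivity),
      ← rpow_mul (abs_nonneg _), ← rpow_mul hs.le, ← rpow_mul hw.le,
      show (p + 1) * (p / (p + 1)) = p by field_simp,
      show -(p + 1) * (1 / (p + 1)) = -1 by field_simp,
      show -p * (1 / (p + 1)) = -(p / (p + 1)) by ring, rpow_neg_one, rpow_neg hw.le]
    refine le_of_eq ?_
    unfold coneSource
    have : coneWeight γ x₀ x ^ (p / (p + 1)) ≠ 0 := (rpow_pos_of_pos hw _).ne'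
    field_simp
  · rw [ENNReal.ofReal_mul (by positivity), ← ENNReal.ofReal_rpow_of_nonneg (by positivity) hθ0,
      ← ENNReal.ofReal_rpow_of_nonneg hT0 (by positivity), hθ]
    gcongr
    refine ((lintegral_mono_set hSc).trans
      (lintegral_cone_le hp hγ hγ2 hγp hφ hE t₀ x₀)).trans (le_of_eq ?_)
    rw [ENNReal.ofReal_mul (p := 8 * (p + 1)) (by positivity), ENNReal.ofReal_toReal hE]

theorem lintegral_coneSource_le_of_bound {p γ : ℝ} (hp : 1 < p) (hγ : 1 ≤ γ) (hγ2 : γ ≤ 2)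
    (hγp : γ ≤ p - 1)
    {φ : ℝ → E3 → ℝ} (hφ : IsNLWSolution p φ) (hE : wEnergy p 0 γ φ ≠ ⊤) (t₀ : ℝ) (x₀ : E3)
    {S : Set E3} (hS : MeasurableSet S) (hSc : S ⊆ coneExt t₀ x₀) {T K : ℝ} (hT0 : 0 ≤ T)
    (hT : ∫⁻ x in S, ENNReal.ofReal (‖x - x₀‖ ^ (-((p + 1) / 2)) *
      coneWeight γ x₀ x ^ (-((p - 1) / 2))) ≤ ENNReal.ofReal T) (hK0 : 0 ≤ K)
    (hK : ∀ x ∈ S, |φ (t₀ - ‖x - x₀‖) x| ≤ K) :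
    ∫⁻ x in S, ENNReal.ofReal (coneSource p φ t₀ x₀ x) ≤
      ENNReal.ofReal ((8 * (p + 1) * (wEnergy p 0 γ φ).toReal) ^ ((p - 1) / (p + 1)) *
        (T ^ (2 / (p + 1)) * K)) := by
  have hm := measurable_slice_cone hφ.contDiff.continuous t₀ x₀
  have hmw := measurable_coneWeight γ x₀
  have hp1 : 0 < p + 1 := by linarith
  have hp2 : 0 < p - 1 := by linarith
  have hθ : 1 - (p - 1) / (p + 1) = 2 / (p + 1) := by field_simp; ring
  have hθ0 : 0 ≤ (p - 1) / (p + 1) := by positivity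
  have hE0 : 0 ≤ (wEnergy p 0 γ φ).toReal := ENNReal.toReal_nonneg
  refine (setLIntegral_ofReal_holder hS (f := fun x => coneWeight γ x₀ x *
    |φ (t₀ - ‖x - x₀‖) x| ^ (p + 1)) (g := fun x => K ^ ((p + 1) / 2) *
      (‖x - x₀‖ ^ (-((p + 1) / 2)) * coneWeight γ x₀ x ^ (-((p - 1) / 2))))
    (θ := (p - 1) / (p + 1)) hθ0 (by rw [div_le_one hp1]; linarith)
    (hmw.mul ((measurable_norm.comp hm).pow_const _)) (by fun_prop)
    (fun x _ => mul_nonneg coneWeight_pos.le (by positivity))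
    (fun x _ => mul_nonneg (by positivity) (mul_nonneg (by positivity)
      (rpow_nonneg coneWeight_pos.le _))) fun x hx => ?_).trans ?_
  · have hs : 0 < ‖x - x₀‖ := (hSc hx).1
    have hw : 0 < coneWeight γ x₀ x := coneWeight_pos
    rw [hθ, mul_rpow hw.le (by positivity), mul_rpow (by positivity) (by positivity),
      mul_rpow (by positivity) (by positivity),
      ← rpow_mul (abs_nonneg _), ← rpow_mul hs.le, ← rpow_mul hw.le, ← rpow_mul hK0,
      show (p + 1) * ((p - 1) / (p + 1)) = p - 1 by field_simp,
      show (p + 1) / 2 * (2 / (p + 1)) = 1 by field_simp,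
      show -((p + 1) / 2) * (2 / (p + 1)) = -1 by field_simp,
      show -((p - 1) / 2) * (2 / (p + 1)) = -((p - 1) / (p + 1)) by field_simp,
      rpow_neg_one, rpow_neg hw.le, rpow_one]
    have h1 : |φ (t₀ - ‖x - x₀‖) x| ^ p ≤ |φ (t₀ - ‖x - x₀‖) x| ^ (p - 1) * K := by
      calc _ = |φ (t₀ - ‖x - x₀‖) x| ^ (p - 1) * |φ (t₀ - ‖x - x₀‖) x| := by
            rw [← rpow_add_one' (abs_nonneg _) (by linarith), sub_add_cancel]
        _ ≤ _ := by gcongr; exact hK x hx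
    unfold coneSource
    have h0 : coneWeight γ x₀ x ^ ((p - 1) / (p + 1)) ≠ 0 := (rpow_pos_of_pos hw _).ne'
    calc _ ≤ ‖x - x₀‖⁻¹ * (|φ (t₀ - ‖x - x₀‖) x| ^ (p - 1) * K) := by gcongr
      _ = _ := by field_simp
  · rw [ENNReal.ofReal_mul (by positivity), ← ENNReal.ofReal_rpow_of_nonneg (by positivity) hθ0, hθ]
    gcongr
    · refine ((lintegral_mono_set hSc).trans
        (lintegral_cone_le (by linarith) hγ hγ2 hγp hφ hE t₀ x₀)).trans (le_of_eq ?_)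
      rw [ENNReal.ofReal_mul (p := 8 * (p + 1)) (by positivity), ENNReal.ofReal_toReal hE]
    · calc _ = (ENNReal.ofReal (K ^ ((p + 1) / 2)) * ∫⁻ x in S, ENNReal.ofReal
            (‖x - x₀‖ ^ (-((p + 1) / 2)) * coneWeight γ x₀ x ^ (-((p - 1) / 2)))) ^ (2 / (p + 1)) := by
            rw [← lintegral_const_mul' _ _ ENNReal.ofReal_ne_top]
            simp only [ENNReal.ofReal_mul (show 0 ≤ K ^ ((p + 1) / 2) by positivity)]
        _ ≤ (ENNReal.ofReal (K ^ ((p + 1) / 2)) * ENNReal.ofReal T) ^ (2 / (p + 1)) := by gcongr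
        _ = _ := by
            rw [← ENNReal.ofReal_mul (by positivity),
              ENNReal.ofReal_rpow_of_nonneg (by positivity) (by positivity),
              mul_rpow (by positivity) hT0, ← rpow_mul hK0,
              show (p + 1) / 2 * (2 / (p + 1)) = 1 by field_simp, rpow_one, mul_comm]

theorem enorm_duhamel_le {p : ℝ} {φ : ℝ → E3 → ℝ}
    (hφ : Continuous fun q : ℝ × E3 => φ q.1 q.2) (t₀ : ℝ) (x₀ : E3) {S : Set E3}
    (hS : MeasurableSet S) {H : ℝ → E3 → ℝ}
    (h : ∀ s, 0 < s → s < t₀ → ∀ ω : Metric.sphere (0 : E3) 1,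
      |H (t₀ - s) (x₀ + s • (ω : E3))| ≤ |φ (t₀ - s) (x₀ + s • (ω : E3))| ^ p ∧
        (x₀ + s • (ω : E3) ∉ S → H (t₀ - s) (x₀ + s • (ω : E3)) = 0)) :
    ‖∫ s in Set.Ioc 0 t₀, s * ∫ ω : Metric.sphere (0 : E3) 1,
        H (t₀ - s) (x₀ + s • (ω : E3)) ∂sphereMeasure‖ₑ ≤
      ∫⁻ x in S, ENNReal.ofReal (coneSource p φ t₀ x₀ x) := by
  rw [integral_Ioc_eq_integral_Ioo, ← lintegral_indicator hS,
    lintegral_polar x₀ ((measurable_coneSource p hφ t₀ x₀).ennreal_ofReal.indicator hS)]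
  refine (enorm_integral_le_lintegral_enorm _).trans ?_
  refine le_trans (setLIntegral_mono' measurableSet_Ioo fun s hs => ?_)
    (lintegral_mono_set (fun s (hs : s ∈ Set.Ioo 0 t₀) => hs.1))
  rw [enorm_mul]
  calc _ ≤ ‖s‖ₑ * ∫⁻ ω : Metric.sphere (0 : E3) 1,
        ‖H (t₀ - s) (x₀ + s • (ω : E3))‖ₑ ∂sphereMeasure := by
        gcongr
        exact enorm_integral_le_lintegral_enorm _
    _ = ∫⁻ ω : Metric.sphere (0 : E3) 1,
        ‖s‖ₑ * ‖H (t₀ - s) (x₀ + s • (ω : E3))‖ₑ ∂sphereMeasure :=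
        (lintegral_const_mul' _ _ enorm_ne_top).symm
    _ ≤ _ := lintegral_mono fun ω => ?_
  obtain ⟨h1, h2⟩ := h s hs.1 hs.2 ω
  by_cases hx : x₀ + s • (ω : E3) ∈ S
  · rw [Set.indicator_of_mem hx, ← enorm_mul, Real.enorm_eq_ofReal_abs,
      ← ENNReal.ofReal_mul (sq_nonneg s), abs_mul, abs_of_pos hs.1]
    refine ENNReal.ofReal_le_ofReal ?_
    unfold coneSource
    rw [norm_add_smul_sub hs.1.le, ← mul_assoc, show s ^ 2 * s⁻¹ = s by have := hs.1; field_simp]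
    exact mul_le_mul_of_nonneg_left h1 hs.1.le
  · rw [h2 hx]
    simp

theorem abs_le_of_enorm_le {x y : ℝ} (hy : 0 ≤ y) (h : ‖x‖ₑ ≤ ENNReal.ofReal y) : |x| ≤ y := by
  rw [Real.enorm_eq_ofReal_abs] at h
  exact (ENNReal.ofReal_le_ofReal_iff hy).1 h

theorem abs_linPart_le {p γ : ℝ} {φ : ℝ → E3 → ℝ} (hp : 0 ≤ p) (hγ : 0 ≤ γ)
    (hφ : IsNLWSolution p φ) (hE : wEnergy p 1 γ φ < ⊤) {t₀ : ℝ} (ht₀ : 0 ≤ t₀) {x₀ : E3} {L : ℝ}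
    (hL0 : 0 ≤ L) (hL : linKernel γ t₀ x₀ ≤ ENNReal.ofReal L) :
    |linPart φ t₀ x₀| ≤ 3 * √2 * L ^ (1 / 2 : ℝ) * √(wEnergy p 1 γ φ).toReal := by
  refine abs_le_of_enorm_le (by positivity)
    ((enorm_linPart_le_linKernel hp hγ hφ.contDiff hE ht₀ x₀).trans ?_)
  have hE0 : 0 ≤ (wEnergy p 1 γ φ).toReal := ENNReal.toReal_nonneg
  calc _ ≤ 3 * (ENNReal.ofReal L ^ (1 / 2 : ℝ) *
        (2 * ENNReal.ofReal (wEnergy p 1 γ φ).toReal) ^ (1 / 2 : ℝ)) := by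
        rw [ENNReal.ofReal_toReal hE.ne]
        gcongr
    _ = _ := by
        rw [two_mul_ofReal, ENNReal.ofReal_rpow_of_nonneg hL0 (by norm_num),
          ENNReal.ofReal_rpow_of_nonneg (by positivity) (by norm_num),
          show (3 : ℝ≥0∞) = ENNReal.ofReal 3 by simp, ← ENNReal.ofReal_mul (by positivity),
          ← ENNReal.ofReal_mul (by norm_num), ← Real.sqrt_eq_rpow (2 * _),
          Real.sqrt_mul zero_le_two]
        congr 1
        ring

theorem abs_linPart_exterior_le {p γ : ℝ} (hp : 0 ≤ p) (hγ : 1 < γ) : ∃ C : ℝ, 0 < C ∧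
    ∀ φ : ℝ → E3 → ℝ, IsNLWSolution p φ → wEnergy p 1 γ φ < ⊤ → ∀ t₀ : ℝ, 0 ≤ t₀ → ∀ x₀ : E3,
      2 ≤ ‖x₀‖ → |linPart φ t₀ x₀| ≤ C * ‖x₀‖⁻¹ * √(wEnergy p 1 γ φ).toReal := by
  obtain ⟨C, hC, H⟩ := linKernel_exterior hγ
  refine ⟨3 * √2 * C ^ (1 / 2 : ℝ), by positivity, fun φ hφ hE t₀ ht₀ x₀ hx₀ => ?_⟩
  have h0 : 0 < ‖x₀‖ := by linarith
  refine (abs_linPart_le hp (by linarith) hφ hE ht₀ (by positivity) (H t₀ x₀ hx₀)).trans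
    (le_of_eq ?_)
  rw [mul_rpow hC.le (by positivity), ← rpow_mul h0.le,
    show (-2 : ℝ) * (1 / 2) = -1 by norm_num, rpow_neg_one]
  ring

theorem abs_linPart_interior_le {p γ : ℝ} (hp : 0 ≤ p) (hγ : 1 < γ) : ∃ C : ℝ, 0 < C ∧
    ∀ φ : ℝ → E3 → ℝ, IsNLWSolution p φ → wEnergy p 1 γ φ < ⊤ → ∀ t₀ : ℝ, 0 ≤ t₀ → ∀ x₀ : E3,
      ‖x₀‖ ≤ t₀ + 2 → |linPart φ t₀ x₀| ≤ C * ((2 + t₀ + ‖x₀‖) ^ (-1 : ℝ) *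
        (1 + |‖x₀‖ - t₀|) ^ (-((γ - 1) / 4))) * √(wEnergy p 1 γ φ).toReal := by
  obtain ⟨C, hC, H⟩ := linKernel_interior hγ
  refine ⟨3 * √2 * C ^ (1 / 2 : ℝ), by positivity, fun φ hφ hE t₀ ht₀ x₀ hx₀ => ?_⟩
  have hM : 0 < 2 + t₀ + ‖x₀‖ := by positivity
  have hu : 0 < 1 + |‖x₀‖ - t₀| := by positivity
  refine (abs_linPart_le hp (by linarith) hφ hE ht₀ (by positivity) (H t₀ ht₀ x₀ hx₀)).trans
    (le_of_eq ?_)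
  rw [mul_rpow hC.le (by positivity), mul_rpow (by positivity) (by positivity), ← rpow_mul hM.le,
    ← rpow_mul hu.le, show (-2 : ℝ) * (1 / 2) = -1 by norm_num,
    show -((γ - 1) / 2) * (1 / 2) = -((γ - 1) / 4) by ring]
  ring

/-- The exponent `α_p`. -/
def decayExp (p : ℝ) : ℝ := (3 + (p - 2) ^ 2) / ((p + 1) * (5 - p))

theorem decayExp_pos {p : ℝ} (hp2 : 2 < p) (hp4 : p ^ 2 ≤ p + 4) : 0 < decayExp p := by
  have : p < 3 := by nlinarith
  have : 0 < 5 - p := by linarith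
  unfold decayExp
  positivity

theorem decayExp_mul_le_one {p γ : ℝ} (hp2 : 2 < p) (hp4 : p ^ 2 ≤ p + 4) (hγ2 : γ < p - 1) :
    decayExp p * γ ≤ 1 := by
  have hp3 : p < 3 := by nlinarith
  refine (mul_le_mul_of_nonneg_left hγ2.le (decayExp_pos hp2 hp4).le).trans ?_
  unfold decayExp
  rw [div_mul_eq_mul_div, div_le_one (by nlinarith)]
  nlinarith [mul_pos (sub_pos.2 hp3) (by nlinarith : 0 < p ^ 2 - p + 4)]

theorem abs_abs_rpow_sub_one_mul {p y : ℝ} (hp : 0 < p) : |(|y| ^ (p - 1) * y)| = |y| ^ p := by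
  rw [abs_mul, abs_of_nonneg (rpow_nonneg (abs_nonneg y) _),
    ← rpow_add_one' (abs_nonneg _) (by linarith), sub_add_cancel]

/-- Source estimate in the exterior region, given pointwise decay in the backward cone. -/
theorem lintegral_coneSource_exterior_le {p γ : ℝ} (hp2 : 2 < p) (hp4 : p ^ 2 ≤ p + 4)
    (hγ1 : 1 < γ) (hγ2 : γ < p - 1) : ∃ C : ℝ, 0 < C ∧ ∀ ε : ℝ, 0 < ε → ε ≤ 1 / 2 →
    ∀ φ : ℝ → E3 → ℝ, IsNLWSolution p φ → wEnergy p 0 γ φ ≠ ⊤ → ∀ t₀ : ℝ, 0 ≤ t₀ → ∀ x₀ : E3,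
      t₀ + 2 ≤ ‖x₀‖ → ∀ A : ℝ, 0 ≤ A →
      (∀ t x, 0 ≤ t → ‖x - x₀‖ ≤ t₀ - t → |φ t x| ≤ A * ‖x‖ ^ (-(decayExp p * γ))) →
      ∫⁻ x in coneExt t₀ x₀, ENNReal.ofReal (coneSource p φ t₀ x₀ x) ≤
        ENNReal.ofReal (C * ‖x₀‖ ^ (-(decayExp p * γ)) *
          (ε ^ (-((p - 2) / (p + 1))) * (wEnergy p 0 γ φ).toReal ^ (p / (p + 1)) +
            ε ^ ((5 - p) / (p + 1)) * (wEnergy p 0 γ φ).toReal ^ ((p - 1) / (p + 1)) * A)) := by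
  have hp3 : p < 3 := by nlinarith
  have hp1 : 0 < p + 1 := by linarith
  have hp5 : 0 < 5 - p := by linarith
  set a := decayExp p * γ with ha
  have ha0 : 0 < a := mul_pos (decayExp_pos hp2 hp4) (by linarith)
  obtain ⟨C1, hC1, H1⟩ := lintegral_far_le hp2 hγ1 (by linarith)
  obtain ⟨C2, hC2, H2⟩ := lintegral_near_le (p := p) (by linarith) hp3 hγ1
  set c1 := (8 * (p + 1)) ^ (p / (p + 1)) * C1 ^ (1 / (p + 1)) with hc1
  set c2 := (8 * (p + 1)) ^ ((p - 1) / (p + 1)) * C2 ^ (2 / (p + 1)) * 2 ^ a with hc2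
  have hc1' : 0 < c1 := by positivity
  have hc2' : 0 < c2 := by positivity
  refine ⟨c1 + c2, by positivity, fun ε hε hε2 φ hφ hE t₀ ht₀ x₀ hx₀ A hA0 hA => ?_⟩
  set E := (wEnergy p 0 γ φ).toReal with hE'
  have hE0 : 0 ≤ E := ENNReal.toReal_nonneg
  have hr1 : 1 ≤ ‖x₀‖ := by linarith
  have hr : 0 < ‖x₀‖ := by linarith
  set l := γ * (p - 1) / (5 - p) with hl
  have hl1 : l ≤ 1 := by
    rw [hl, div_le_one hp5]; nlinarith
  have hlr : ‖x₀‖ ^ l ≤ ‖x₀‖ := by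
    simpa using rpow_le_rpow_of_exponent_le hr1 hl1
  set δ := ε * ‖x₀‖ ^ l with hδ
  have hδ0 : 0 < δ := by positivity
  have hδr : δ ≤ ‖x₀‖ / 2 := by
    calc δ ≤ 1 / 2 * ‖x₀‖ := mul_le_mul hε2 hlr (by positivity) (by norm_num)
      _ = _ := by ring
  set S1 := coneExt t₀ x₀ ∩ {x | ‖x - x₀‖ ∈ Set.Ioo 0 δ} with hS1
  set S2 := coneExt t₀ x₀ ∩ {x | ‖x - x₀‖ ∈ Set.Icc δ ‖x₀‖} with hS2
  have hfar := lintegral_coneSource_le (by linarith) hγ1.le (by linarith) hγ2.le hφ hE t₀ x₀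
    (S := S2) ((measurableSet_coneExt t₀ x₀).inter (measurableSet_norm_sub_mem x₀ measurableSet_Icc))
    Set.inter_subset_left (by positivity)
    ((lintegral_mono_set Set.inter_subset_right).trans (H1 x₀ hr δ hδ0 (by linarith)))
  have hnear := lintegral_coneSource_le_of_bound (by linarith) hγ1.le (by linarith) hγ2.le hφ hE t₀ x₀
    (S := S1) ((measurableSet_coneExt t₀ x₀).inter (measurableSet_norm_sub_mem x₀ measurableSet_Ioo))
    Set.inter_subset_left (by positivity)
    ((lintegral_mono_set Set.inter_subset_right).trans (H2 x₀ hr δ hδ0 hδr))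
    (K := A * (‖x₀‖ / 2) ^ (-a)) (by positivity) (fun x hx => by
      obtain ⟨hx1, hx2⟩ := hx
      have hx3 : ‖x - x₀‖ < δ := hx2.2
      have := norm_center_le x x₀
      refine (hA _ x (by linarith [hx1.2.1]) (by linarith)).trans ?_
      gcongr A * ?_
      exact rpow_le_rpow_of_nonpos (by positivity) (by linarith) (by linarith))
  have hsub : coneExt t₀ x₀ ⊆ S1 ∪ S2 := fun x hx => by
    rcases lt_or_ge ‖x - x₀‖ δ with h | h
    · exact Or.inl ⟨hx, hx.1, h⟩
    · exact Or.inr ⟨hx, h, by linarith [hx.2.1]⟩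
  have e1 : (C1 * (‖x₀‖ ^ (-γ) * δ ^ (2 - p))) ^ (1 / (p + 1)) =
      C1 ^ (1 / (p + 1)) * (‖x₀‖ ^ (-a) * ε ^ (-((p - 2) / (p + 1)))) := by
    rw [hδ, mul_rpow hε.le (by positivity), ← rpow_mul hr.le, mul_rpow hC1.le (by positivity),
      mul_left_comm, mul_rpow (by positivity) (by positivity), ← rpow_mul hε.le, ← rpow_add hr,
      ← rpow_mul hr.le, mul_comm (ε ^ _)]
    congr 3
    · rw [ha, hl, decayExp]
      field_simp
      ring
    · ring
  have e2 : (C2 * (‖x₀‖ ^ (-(γ * ((p - 1) / 2))) * δ ^ ((5 - p) / 2))) ^ (2 / (p + 1)) =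
      C2 ^ (2 / (p + 1)) * ε ^ ((5 - p) / (p + 1)) := by
    rw [hδ, mul_rpow hε.le (by positivity), ← rpow_mul hr.le, mul_rpow hC2.le (by positivity),
      mul_left_comm, ← rpow_add hr, show -(γ * ((p - 1) / 2)) + l * ((5 - p) / 2) = 0 by
        rw [hl]; field_simp; ring, rpow_zero, mul_one, ← rpow_mul hε.le]
    congr 2
    field_simp
  refine ((lintegral_mono_set hsub).trans ((lintegral_union_le _ _ _).trans
    (add_le_add hnear hfar))).trans ?_
  rw [← ENNReal.ofReal_add (by positivity) (by positivity), e1, e2,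
    div_eq_mul_one_div ‖x₀‖, mul_rpow hr.le (by norm_num), one_div 2, inv_rpow zero_le_two,
    rpow_neg zero_le_two, inv_inv, mul_rpow (by positivity) hE0, mul_rpow (by positivity) hE0]
  refine ENNReal.ofReal_le_ofReal ?_
  set X := ‖x₀‖ ^ (-a) * (ε ^ (-((p - 2) / (p + 1))) * E ^ (p / (p + 1))) with hX
  set Y := ‖x₀‖ ^ (-a) * (ε ^ ((5 - p) / (p + 1)) * E ^ ((p - 1) / (p + 1)) * A) with hY
  have hX0 : 0 ≤ X := by positivity
  have hY0 : 0 ≤ Y := by positivity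
  calc _ = c2 * Y + c1 * X := by rw [hc1, hc2, hX, hY]; ring
    _ ≤ (c1 + c2) * Y + (c1 + c2) * X := by gcongr <;> linarith
    _ = _ := by rw [hX, hY]; ring

theorem abs_solution_mul_le {p : ℝ} (hp : 0 < p) {φ : ℝ → E3 → ℝ} (hφ : IsNLWSolution p φ) {t₀ : ℝ}
    (ht₀ : 0 ≤ t₀) {x₀ : E3} (hx₀ : t₀ + 2 ≤ ‖x₀‖) {N : ℝ} (hN : 0 ≤ N)
    (h : ∫⁻ x in coneExt t₀ x₀, ENNReal.ofReal (coneSource p φ t₀ x₀ x) ≤ ENNReal.ofReal N) :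
    sphereMeasure.real Set.univ * |φ t₀ x₀| ≤ |linPart φ t₀ x₀| + N := by
  have hk := kirchhoff (G := fun t x => |φ t x| ^ (p - 1) * φ t x) hφ.contDiff
    (fun t ht x => hφ.2 t ht x) ht₀ x₀
  rw [intervalIntegral.integral_of_le ht₀] at hk
  have hd := enorm_duhamel_le (p := p) (H := fun t x => |φ t x| ^ (p - 1) * φ t x)
    hφ.contDiff.continuous t₀ x₀ (measurableSet_coneExt t₀ x₀) (fun s hs hst ω => by
      refine ⟨(abs_abs_rpow_sub_one_mul hp).le, fun hn => absurd ?_ hn⟩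
      have h1 := norm_add_smul_sub (x₀ := x₀) hs.le ω
      have h2 := norm_center_le (x₀ + s • (ω : E3)) x₀
      refine ⟨?_, ?_, ?_⟩ <;> linarith)
  have hd' := abs_le_of_enorm_le hN (hd.trans h)
  calc sphereMeasure.real Set.univ * |φ t₀ x₀| = |sphereMeasure.real Set.univ * φ t₀ x₀| := by
        rw [abs_mul, abs_of_pos sphereMeasure_real_univ_pos]
    _ ≤ _ := by
        rw [hk]
        exact (abs_sub _ _).trans (by gcongr)

theorem isCompact_backwardCone (t₀ : ℝ) (x₀ : E3) :
    IsCompact {q : ℝ × E3 | 0 ≤ q.1 ∧ ‖q.2 - x₀‖ ≤ t₀ - q.1} := by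
  refine (isCompact_Icc.prod (isCompact_closedBall x₀ t₀) :
    IsCompact (Set.Icc 0 t₀ ×ˢ Metric.closedBall x₀ t₀)).of_isClosed_subset ?_ ?_
  · exact (isClosed_le continuous_const continuous_fst).inter
      (isClosed_le (continuous_snd.sub continuous_const).norm (continuous_const.sub continuous_fst))
  · rintro ⟨t, x⟩ ⟨h1, h2⟩
    simp only at h1 h2
    have := norm_nonneg (x - x₀)
    refine ⟨⟨h1, by simp only; linarith⟩, ?_⟩
    rw [mem_closedBall_iff_norm]
    simp only
    linarith

theorem exists_max_backwardCone {φ : ℝ → E3 → ℝ} (hφ : Continuous fun q : ℝ × E3 => φ q.1 q.2)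
    {a t₀ : ℝ} (ha : 0 ≤ a) (ht₀ : 0 ≤ t₀) (x₀ : E3) : ∃ t x, 0 ≤ t ∧ ‖x - x₀‖ ≤ t₀ - t ∧
      ∀ s y, 0 ≤ s → ‖y - x₀‖ ≤ t₀ - s → ‖y‖ ^ a * |φ s y| ≤ ‖x‖ ^ a * |φ t x| := by
  have hc : Continuous fun q : ℝ × E3 => ‖q.2‖ ^ a * |φ q.1 q.2| :=
    ((continuous_norm.comp continuous_snd).rpow_const fun _ => Or.inr ha).mul hφ.abs
  obtain ⟨q, hq, hmax⟩ := (isCompact_backwardCone t₀ x₀).exists_isMaxOn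
    ⟨(t₀, x₀), by simp [ht₀]⟩ hc.continuousOn
  refine ⟨q.1, q.2, hq.1, hq.2, fun s y hs hy => ?_⟩
  have h' : 0 ≤ (s, y).1 ∧ ‖(s, y).2 - x₀‖ ≤ t₀ - (s, y).1 := ⟨hs, hy⟩
  exact isMaxOn_iff.1 hmax (s, y) h'

theorem exists_pos_mul_rpow_le {K κ δ : ℝ} (hK : 0 ≤ K) (hκ : 0 < κ) (hδ : 0 < δ) :
    ∃ ε : ℝ, 0 < ε ∧ ε ≤ 1 / 2 ∧ K * ε ^ κ ≤ δ := by
  have hc : 0 < δ / (K + 1) := by positivity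
  refine ⟨min (1 / 2) ((δ / (K + 1)) ^ κ⁻¹), by positivity, min_le_left _ _, ?_⟩
  have h1 : (min (1 / 2) ((δ / (K + 1)) ^ κ⁻¹)) ^ κ ≤ δ / (K + 1) := by
    refine (rpow_le_rpow (by positivity) (min_le_right _ _) hκ.le).trans ?_
    rw [← rpow_mul hc.le, inv_mul_cancel₀ hκ.ne', rpow_one]
  calc K * _ ≤ (K + 1) * (δ / (K + 1)) := by gcongr; linarith
    _ = δ := by field_simp

theorem rpow_le_mul_sqrt {e E B k : ℝ} (he : 0 ≤ e) (heB : e ≤ B) (heE : e ≤ E) (hk : 1 / 2 ≤ k) :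
    e ^ k ≤ B ^ (k - 1 / 2) * √E := by
  have : e ^ k = e ^ (k - 1 / 2) * √e := by
    rw [sqrt_eq_rpow, ← rpow_add_of_nonneg he (by linarith) (by norm_num), sub_add_cancel]
  rw [this]
  have : 0 ≤ k - 1 / 2 := by linarith
  have : 0 ≤ B := he.trans heB
  gcongr

/-- Pointwise decay of the solution, and of its Duhamel integral, in the exterior region. -/
theorem exterior_decay {p γ B : ℝ} (hp2 : 2 < p) (hp4 : p ^ 2 ≤ p + 4)
    (hγ1 : 1 < γ) (hγ2 : γ < p - 1) (hB : 0 < B) : ∃ C : ℝ, 0 < C ∧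
    ∀ φ : ℝ → E3 → ℝ, IsNLWSolution p φ → wEnergy p 0 γ φ ≤ ENNReal.ofReal B →
      wEnergy p 1 γ φ < ⊤ → ∀ t₀ : ℝ, 0 ≤ t₀ → ∀ x₀ : E3, t₀ + 2 ≤ ‖x₀‖ →
      ‖x₀‖ ^ (decayExp p * γ) * |φ t₀ x₀| ≤ C * √(wEnergy p 1 γ φ).toReal := by
  have hp0 : 0 < p := by linarith
  have hp5 : 0 < 5 - p := by nlinarith
  have ha : 0 < decayExp p * γ := mul_pos (decayExp_pos hp2 hp4) (by linarith)
  have ha1 := decayExp_mul_le_one hp2 hp4 hγ2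
  obtain ⟨C₁, hC₁, h₁⟩ := abs_linPart_exterior_le hp0.le hγ1
  obtain ⟨C₂, hC₂, h₂⟩ := lintegral_coneSource_exterior_le hp2 hp4 hγ1 hγ2
  set σ := sphereMeasure.real Set.univ with hσdef
  have hσ : 0 < σ := sphereMeasure_real_univ_pos
  obtain ⟨ε, hε, hε2, hεσ⟩ := exists_pos_mul_rpow_le (K := C₂ * B ^ ((p - 1) / (p + 1)))
    (κ := (5 - p) / (p + 1)) (δ := σ / 2) (by positivity) (by positivity) (by positivity)
  refine ⟨(C₁ + C₂ * ε ^ (-((p - 2) / (p + 1))) * B ^ (p / (p + 1) - 1 / 2)) * (2 / σ),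
    by positivity, fun φ hφ hE0 hE1 t₀ ht₀ x₀ hx₀ => ?_⟩
  set E := √(wEnergy p 1 γ φ).toReal with hEdef
  have hE : 0 ≤ E := sqrt_nonneg _
  set e := (wEnergy p 0 γ φ).toReal with hedef
  have he : 0 ≤ e := ENNReal.toReal_nonneg
  have heB : e ≤ B := ENNReal.toReal_le_of_le_ofReal hB.le hE0
  have heE : e ^ (p / (p + 1)) ≤ B ^ (p / (p + 1) - 1 / 2) * E :=
    rpow_le_mul_sqrt he heB (ENNReal.toReal_mono hE1.ne (wEnergy_zero_le_one p γ φ))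
      (by rw [div_le_div_iff₀ (by norm_num) (by linarith)]; linarith)
  have heB' : e ^ ((p - 1) / (p + 1)) ≤ B ^ ((p - 1) / (p + 1)) :=
    rpow_le_rpow he heB (div_nonneg (by linarith) (by linarith))
  obtain ⟨t, x, ht, hx, hmax'⟩ := exists_max_backwardCone hφ.contDiff.continuous ha.le ht₀ x₀
  set A := ‖x‖ ^ (decayExp p * γ) * |φ t x| with hAdef
  have hA : 0 ≤ A := by positivity
  have hxx : t + 2 ≤ ‖x‖ := by linarith [norm_center_le x x₀]
  have hx0 : 0 < ‖x‖ := by linarith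
  have hcone : ∀ s y, 0 ≤ s → ‖y - x‖ ≤ t - s → |φ s y| ≤ A * ‖y‖ ^ (-(decayExp p * γ)) := by
    intro s y hs hy
    have hy0 : 0 < ‖y‖ := by linarith [norm_center_le y x]
    rw [rpow_neg hy0.le, ← div_eq_mul_inv, le_div_iff₀ (by positivity), mul_comm]
    refine hmax' s y hs ?_
    have := norm_add_le (y - x) (x - x₀)
    rw [sub_add_sub_cancel] at this
    linarith
  have hS := h₂ ε hε hε2 φ hφ (ne_top_of_le_ne_top ENNReal.ofReal_ne_top hE0) t ht x hxx A hA hcone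
  have hP := abs_solution_mul_le hp0 hφ ht hxx (by positivity) hS
  have hL := h₁ φ hφ hE1 t ht x (by linarith)
  have hinv : ‖x‖⁻¹ ≤ ‖x‖ ^ (-(decayExp p * γ)) := by
    rw [← rpow_neg_one]
    exact rpow_le_rpow_of_exponent_le (by linarith) (by linarith)
  have hσA : σ * A ≤ C₁ * E + C₂ * (ε ^ (-((p - 2) / (p + 1))) * e ^ (p / (p + 1)) +
      ε ^ ((5 - p) / (p + 1)) * e ^ ((p - 1) / (p + 1)) * A) := by
    have hcancel : ‖x‖ ^ (decayExp p * γ) * ‖x‖ ^ (-(decayExp p * γ)) = 1 := by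
      rw [← rpow_add hx0, add_neg_cancel, rpow_zero]
    calc σ * A = ‖x‖ ^ (decayExp p * γ) * (σ * |φ t x|) := by rw [hAdef]; ring
      _ ≤ ‖x‖ ^ (decayExp p * γ) * (C₁ * ‖x‖ ^ (-(decayExp p * γ)) * E + _) :=
          mul_le_mul_of_nonneg_left (hP.trans (add_le_add_left (hL.trans (by gcongr)) _))
            (by positivity)
      _ = (‖x‖ ^ (decayExp p * γ) * ‖x‖ ^ (-(decayExp p * γ))) * (C₁ * E +
          C₂ * (ε ^ (-((p - 2) / (p + 1))) * e ^ (p / (p + 1)) +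
          ε ^ ((5 - p) / (p + 1)) * e ^ ((p - 1) / (p + 1)) * A)) := by ring
      _ = _ := by rw [hcancel, one_mul]
  have habs : σ * A ≤ (C₁ + C₂ * ε ^ (-((p - 2) / (p + 1))) * B ^ (p / (p + 1) - 1 / 2)) * E
      + σ / 2 * A := by
    refine hσA.trans ?_
    have k1 : C₂ * ε ^ (-((p - 2) / (p + 1))) * e ^ (p / (p + 1)) ≤
        C₂ * ε ^ (-((p - 2) / (p + 1))) * (B ^ (p / (p + 1) - 1 / 2) * E) := by gcongr
    have k2 : C₂ * (ε ^ ((5 - p) / (p + 1)) * e ^ ((p - 1) / (p + 1)) * A) ≤ σ / 2 * A := by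
      calc _ ≤ C₂ * (ε ^ ((5 - p) / (p + 1)) * B ^ ((p - 1) / (p + 1)) * A) := by gcongr
        _ = C₂ * B ^ ((p - 1) / (p + 1)) * ε ^ ((5 - p) / (p + 1)) * A := by ring
        _ ≤ _ := mul_le_mul_of_nonneg_right hεσ hA
    linarith
  refine (hmax' t₀ x₀ ht₀ (by simp)).trans ?_
  rw [mul_right_comm, mul_div_assoc', le_div_iff₀ hσ]
  linarith

/-- Decay of the Duhamel integral in the exterior region. -/
theorem exterior_source_decay {p γ B : ℝ} (hp2 : 2 < p) (hp4 : p ^ 2 ≤ p + 4)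
    (hγ1 : 1 < γ) (hγ2 : γ < p - 1) (hB : 0 < B) : ∃ C : ℝ, 0 < C ∧
    ∀ φ : ℝ → E3 → ℝ, IsNLWSolution p φ → wEnergy p 0 γ φ ≤ ENNReal.ofReal B →
      wEnergy p 1 γ φ < ⊤ → ∀ t₀ : ℝ, 0 ≤ t₀ → ∀ x₀ : E3, t₀ + 2 ≤ ‖x₀‖ →
      ∫⁻ x in coneExt t₀ x₀, ENNReal.ofReal (coneSource p φ t₀ x₀ x) ≤
        ENNReal.ofReal (C * ‖x₀‖ ^ (-(decayExp p * γ)) * √(wEnergy p 1 γ φ).toReal) := by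
  have hp5 : 0 < 5 - p := by nlinarith
  obtain ⟨C₁, hC₁, h₁⟩ := exterior_decay hp2 hp4 hγ1 hγ2 hB
  obtain ⟨C₂, hC₂, h₂⟩ := lintegral_coneSource_exterior_le hp2 hp4 hγ1 hγ2
  refine ⟨C₂ * ((1 / 2) ^ (-((p - 2) / (p + 1))) * B ^ (p / (p + 1) - 1 / 2) +
    (1 / 2) ^ ((5 - p) / (p + 1)) * B ^ ((p - 1) / (p + 1)) * C₁), by positivity,
    fun φ hφ hE0 hE1 t₀ ht₀ x₀ hx₀ => ?_⟩
  set E := √(wEnergy p 1 γ φ).toReal with hEdef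
  have hE : 0 ≤ E := sqrt_nonneg _
  set e := (wEnergy p 0 γ φ).toReal with hedef
  have he : 0 ≤ e := ENNReal.toReal_nonneg
  have heB : e ≤ B := ENNReal.toReal_le_of_le_ofReal hB.le hE0
  have heE : e ^ (p / (p + 1)) ≤ B ^ (p / (p + 1) - 1 / 2) * E :=
    rpow_le_mul_sqrt he heB (ENNReal.toReal_mono hE1.ne (wEnergy_zero_le_one p γ φ))
      (by rw [div_le_div_iff₀ (by norm_num) (by linarith)]; linarith)
  have heB' : e ^ ((p - 1) / (p + 1)) ≤ B ^ ((p - 1) / (p + 1)) :=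
    rpow_le_rpow he heB (div_nonneg (by linarith) (by linarith))
  refine (h₂ (1 / 2) (by norm_num) le_rfl φ hφ (ne_top_of_le_ne_top ENNReal.ofReal_ne_top hE0)
    t₀ ht₀ x₀ hx₀ (C₁ * E) (by positivity) ?_).trans (ENNReal.ofReal_le_ofReal ?_)
  · intro s y hs hy
    have hyy : s + 2 ≤ ‖y‖ := by linarith [norm_center_le y x₀]
    have hy0 : 0 < ‖y‖ := by linarith
    rw [rpow_neg hy0.le, ← div_eq_mul_inv, le_div_iff₀ (by positivity), mul_comm]
    exact h₁ φ hφ hE0 hE1 s hs y hyy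
  · calc _ ≤ C₂ * ‖x₀‖ ^ (-(decayExp p * γ)) *
        ((1 / 2) ^ (-((p - 2) / (p + 1))) * (B ^ (p / (p + 1) - 1 / 2) * E) +
        (1 / 2) ^ ((5 - p) / (p + 1)) * B ^ ((p - 1) / (p + 1)) * (C₁ * E)) := by gcongr
      _ = _ := by ring

theorem abs_Fext_le {p : ℝ} (hp : 0 < p) (φ : ℝ → E3 → ℝ) (t : ℝ) (x : E3) :
    |Fext p φ t x| ≤ |φ t x| ^ p := by
  unfold Fext
  split_ifs
  · rw [abs_neg, abs_abs_rpow_sub_one_mul hp]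
  · rw [abs_zero]
    positivity

theorem add_le_norm_of_Fext_ne_zero {p : ℝ} {φ : ℝ → E3 → ℝ} {t : ℝ} {x : E3}
    (h : Fext p φ t x ≠ 0) : t + 23 / 10 ≤ ‖x‖ := by
  unfold Fext at h
  obtain ⟨ht, hD⟩ : 0 ≤ t ∧ (t, x) ∉ Dset := by
    by_contra hn
    exact h (if_neg hn)
  have hD' : (t + 3) ^ 2 - ‖x‖ ^ 2 < 6 / 5 * (t + 3) := not_le.1 hD
  nlinarith [norm_nonneg x]

theorem norm_le_of_mem_Dset {t : ℝ} {x : E3} (ht : 0 ≤ t) (h : (t, x) ∈ Dset) :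
    ‖x‖ ≤ t + 12 / 5 := by
  have h' : 6 / 5 * (t + 3) ≤ (t + 3) ^ 2 - ‖x‖ ^ 2 := h
  nlinarith [norm_nonneg x]

theorem abs_psiLin_le {p : ℝ} (hp : 0 < p) {φ : ℝ → E3 → ℝ} (hφ : IsNLWSolution p φ) {t₀ : ℝ}
    {x₀ : E3} {S : Set E3} (hS : MeasurableSet S) (hSc : coneOut t₀ x₀ ⊆ S) {N : ℝ} (hN : 0 ≤ N)
    (h : ∫⁻ x in S, ENNReal.ofReal (coneSource p φ t₀ x₀ x) ≤ ENNReal.ofReal N) :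
    |psiLin p φ t₀ x₀| ≤ |linPart φ t₀ x₀| + N := by
  have hd := abs_le_of_enorm_le hN ((enorm_duhamel_le (p := p) (H := Fext p φ)
    hφ.contDiff.continuous t₀ x₀ hS fun s hs hst ω => by
      refine ⟨abs_Fext_le hp φ _ _, fun hn => ?_⟩
      by_contra hF
      have h1 := norm_add_smul_sub (x₀ := x₀) hs.le ω
      have h2 := add_le_norm_of_Fext_ne_zero hF
      refine hn (hSc ⟨?_, ?_, ?_⟩) <;> linarith).trans h)
  rw [psiLin_eq (hφ.contDiff.of_le (by norm_num)), abs_mul]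
  have hπ : |1 / (4 * π)| ≤ 1 := by
    rw [abs_of_pos (by positivity), div_le_one (by positivity)]
    linarith [pi_gt_three]
  calc _ ≤ 1 * |_| := mul_le_mul_of_nonneg_right hπ (abs_nonneg _)
    _ ≤ _ := by
      rw [one_mul]
      exact (abs_add_le _ _).trans (by gcongr)

theorem rpow_mul_rpow_le {M u k c a b : ℝ} (hu : 1 ≤ u) (huM : u ≤ M) (hk : a ≤ k)
    (hkc : a + b ≤ k + c) : M ^ (-k) * u ^ (-c) ≤ M ^ (-a) * u ^ (-b) := by
  have hu0 : 0 < u := by linarith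
  have hM0 : 0 < M := by linarith
  calc M ^ (-k) * u ^ (-c) = M ^ (-a) * (M ^ (-(k - a)) * u ^ (-c)) := by
        rw [← mul_assoc, ← rpow_add hM0]
        congr 2
        ring
    _ ≤ M ^ (-a) * (u ^ (-(k - a)) * u ^ (-c)) := by
        have := rpow_le_rpow_of_nonpos hu0 huM (by linarith : -(k - a) ≤ 0)
        gcongr
    _ ≤ M ^ (-a) * u ^ (-b) := by
        rw [← rpow_add hu0]
        exact mul_le_mul_of_nonneg_left (rpow_le_rpow_of_exponent_le hu (by linarith))
          (by positivity)

theorem decayExp_le_source {p γ : ℝ} (hp2 : 2 < p) (hp4 : p ^ 2 ≤ p + 4) (hγ1 : 1 < γ) :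
    decayExp p * γ ≤ (γ * p - 1) / (p + 1) := by
  have hp3 : p < 3 := by nlinarith
  have h5 : 0 < 5 - p := by linarith
  unfold decayExp
  rw [div_mul_eq_mul_div, div_le_div_iff₀ (by nlinarith) (by linarith)]
  have h1 : 0 ≤ (γ - 1) * ((p - 1) * (7 - 2 * p)) :=
    mul_nonneg (by linarith) (mul_nonneg (by linarith) (by linarith))
  have h2 : 0 ≤ (p - 2) * (3 - p) := mul_nonneg (by linarith) (by linarith)
  have h3 : 0 ≤ γ * ((p - 1) * (7 - 2 * p)) - (5 - p) := by nlinarith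
  nlinarith [mul_nonneg h3 (by linarith : 0 ≤ p + 1)]

theorem decayExp_add_le {p γ : ℝ} (hp2 : 2 < p) (hp4 : p ^ 2 ≤ p + 4) (hγ1 : 1 < γ)
    (hγ2 : γ < p - 1) : decayExp p * γ + γ / (p + 1) ≤ 1 + (γ - 1) / 4 := by
  have hp3 : p < 3 := by nlinarith
  have h5 : 0 < 5 - p := by linarith
  have h6 : 0 < p + 1 := by linarith
  have hd : 0 < 4 * ((p + 1) * (5 - p)) := by positivity
  have : decayExp p * γ + γ / (p + 1) = 4 * γ * (12 - 5 * p + p ^ 2) / (4 * ((p + 1) * (5 - p))) := by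
    unfold decayExp
    field_simp
    ring
  rw [this, div_le_iff₀ hd]
  have hp' : p < 13 / 5 := by nlinarith
  have at_one : 4 * (12 - 5 * p + p ^ 2) ≤ 4 * ((p + 1) * (5 - p)) := by
    nlinarith [mul_nonneg (by linarith : 0 ≤ p - 1) (by linarith : 0 ≤ 7 - 2 * p)]
  have at_top : 4 * (p - 1) * (12 - 5 * p + p ^ 2) ≤ (p + 2) * ((p + 1) * (5 - p)) := by
    obtain ⟨d, rfl⟩ : ∃ d, p = 2 + d := ⟨p - 2, by ring⟩
    have hd0 : 0 < d := by linarith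
    have hd1 : d < 3 / 5 := by linarith
    have hd2 : d ^ 2 ≤ 9 / 25 := by nlinarith
    have hd3 : d ^ 3 ≤ 27 / 125 := by nlinarith
    nlinarith
  have hcomb := add_le_add
    (mul_le_mul_of_nonneg_left at_one (by linarith : 0 ≤ p - 1 - γ))
    (mul_le_mul_of_nonneg_left at_top (by linarith : 0 ≤ γ - 1))
  refine le_of_mul_le_mul_left ?_ (by linarith : 0 < p - 2)
  linarith

/-- Decay in the part of `D` near the light cone lying in the exterior region. -/
theorem psiLin_decay_exterior {p γ B : ℝ} (hp2 : 2 < p) (hp4 : p ^ 2 ≤ p + 4)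
    (hγ1 : 1 < γ) (hγ2 : γ < p - 1) (hB : 0 < B) : ∃ C : ℝ, 0 < C ∧
    ∀ φ : ℝ → E3 → ℝ, IsNLWSolution p φ → wEnergy p 0 γ φ ≤ ENNReal.ofReal B →
      wEnergy p 1 γ φ < ⊤ → ∀ t₀ : ℝ, 0 ≤ t₀ → ∀ x₀ : E3, (t₀, x₀) ∈ Dset → t₀ + 2 ≤ ‖x₀‖ →
      |psiLin p φ t₀ x₀| ≤ C * ((2 + t₀ + ‖x₀‖) ^ (-(decayExp p * γ)) *
        (1 + |‖x₀‖ - t₀|) ^ (-(γ / (p + 1)))) * √(wEnergy p 1 γ φ).toReal := by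
  have hp0 : 0 < p := by linarith
  have ha : 0 < decayExp p * γ := mul_pos (decayExp_pos hp2 hp4) (by linarith)
  have ha1 := decayExp_mul_le_one hp2 hp4 hγ2
  have hb : 0 ≤ γ / (p + 1) := by positivity
  obtain ⟨C₁, hC₁, h₁⟩ := abs_linPart_exterior_le hp0.le hγ1
  obtain ⟨C₂, hC₂, h₂⟩ := exterior_source_decay hp2 hp4 hγ1 hγ2 hB
  refine ⟨(C₁ + C₂) * (2 ^ (decayExp p * γ) * (17 / 5) ^ (γ / (p + 1))), by positivity,
    fun φ hφ hE0 hE1 t₀ ht₀ x₀ hD hx₀ => ?_⟩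
  have hE : 0 ≤ √(wEnergy p 1 γ φ).toReal := sqrt_nonneg _
  have hx1 := norm_le_of_mem_Dset ht₀ hD
  have hx0 : 0 < ‖x₀‖ := by linarith
  have hinv : ‖x₀‖⁻¹ ≤ ‖x₀‖ ^ (-(decayExp p * γ)) := by
    rw [← rpow_neg_one]
    exact rpow_le_rpow_of_exponent_le (by linarith) (by linarith)
  have hu : 1 + |‖x₀‖ - t₀| ≤ 17 / 5 := by
    rw [abs_of_nonneg (by linarith)]
    linarith
  have hu0 : 0 < 1 + |‖x₀‖ - t₀| := by positivity
  have hu1 : 1 ≤ (17 / 5 : ℝ) ^ (γ / (p + 1)) * (1 + |‖x₀‖ - t₀|) ^ (-(γ / (p + 1))) := by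
    rw [rpow_neg hu0.le, ← div_eq_mul_inv, le_div_iff₀ (by positivity), one_mul]
    exact rpow_le_rpow hu0.le hu hb
  have hM : ‖x₀‖ ^ (-(decayExp p * γ)) ≤
      2 ^ (decayExp p * γ) * (2 + t₀ + ‖x₀‖) ^ (-(decayExp p * γ)) := by
    rw [rpow_neg (by positivity), rpow_neg (by positivity), ← div_eq_mul_inv,
      le_div_iff₀ (by positivity), inv_mul_le_iff₀ (by positivity),
      ← mul_rpow hx0.le (by norm_num)]
    exact rpow_le_rpow (by positivity) (by linarith) ha.le
  calc |psiLin p φ t₀ x₀| ≤ |linPart φ t₀ x₀| +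
        C₂ * ‖x₀‖ ^ (-(decayExp p * γ)) * √(wEnergy p 1 γ φ).toReal :=
        abs_psiLin_le hp0 hφ (measurableSet_coneExt t₀ x₀) (coneOut_subset t₀ x₀) (by positivity)
          (h₂ φ hφ hE0 hE1 t₀ ht₀ x₀ hx₀)
    _ ≤ C₁ * ‖x₀‖ ^ (-(decayExp p * γ)) * √(wEnergy p 1 γ φ).toReal +
        C₂ * ‖x₀‖ ^ (-(decayExp p * γ)) * √(wEnergy p 1 γ φ).toReal := by
        refine add_le_add_left ((h₁ φ hφ hE1 t₀ ht₀ x₀ (by linarith)).trans ?_) _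
        gcongr
    _ = (C₁ + C₂) * (‖x₀‖ ^ (-(decayExp p * γ)) * 1) * √(wEnergy p 1 γ φ).toReal := by ring
    _ ≤ (C₁ + C₂) * (2 ^ (decayExp p * γ) * (2 + t₀ + ‖x₀‖) ^ (-(decayExp p * γ)) *
        ((17 / 5 : ℝ) ^ (γ / (p + 1)) * (1 + |‖x₀‖ - t₀|) ^ (-(γ / (p + 1))))) *
        √(wEnergy p 1 γ φ).toReal := by
        refine mul_le_mul_of_nonneg_right (mul_le_mul_of_nonneg_left ?_ (by positivity)) hE
        exact mul_le_mul hM hu1 zero_le_one (by positivity)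
    _ = _ := by ring

/-- Decay in the region `|x| < t + 2`. -/
theorem psiLin_decay_interior {p γ B : ℝ} (hp2 : 2 < p) (hp4 : p ^ 2 ≤ p + 4)
    (hγ1 : 1 < γ) (hγ2 : γ < p - 1) (hB : 0 < B) : ∃ C : ℝ, 0 < C ∧
    ∀ φ : ℝ → E3 → ℝ, IsNLWSolution p φ → wEnergy p 0 γ φ ≤ ENNReal.ofReal B →
      wEnergy p 1 γ φ < ⊤ → ∀ t₀ : ℝ, 0 ≤ t₀ → ∀ x₀ : E3, ‖x₀‖ < t₀ + 2 →
      |psiLin p φ t₀ x₀| ≤ C * ((2 + t₀ + ‖x₀‖) ^ (-(decayExp p * γ)) *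
        (1 + |‖x₀‖ - t₀|) ^ (-(γ / (p + 1)))) * √(wEnergy p 1 γ φ).toReal := by
  have hp0 : 0 < p := by linarith
  have hp3 : p < 3 := by nlinarith
  have hp1 : 0 < p + 1 := by linarith
  have ha1 := decayExp_mul_le_one hp2 hp4 hγ2
  obtain ⟨C₁, hC₁, h₁⟩ := abs_linPart_interior_le hp0.le hγ1
  obtain ⟨C₂, hC₂, h₂⟩ := lintegral_coneOut_le (p := p) (γ := γ) (by linarith) hγ1 (by nlinarith)
  refine ⟨C₁ + (8 * (p + 1)) ^ (p / (p + 1)) * B ^ (p / (p + 1) - 1 / 2) * C₂ ^ (1 / (p + 1)),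
    by positivity, fun φ hφ hE0 hE1 t₀ ht₀ x₀ hx₀ => ?_⟩
  have hM0 : 0 < 2 + t₀ + ‖x₀‖ := by positivity
  have hu1 : 1 ≤ 1 + |‖x₀‖ - t₀| := by linarith [abs_nonneg (‖x₀‖ - t₀)]
  have hu0 : 0 < 1 + |‖x₀‖ - t₀| := by linarith
  have huM : 1 + |‖x₀‖ - t₀| ≤ 2 + t₀ + ‖x₀‖ := by
    have := abs_le.2 (⟨by linarith [norm_nonneg x₀], by linarith⟩ :
      -(t₀ + ‖x₀‖) ≤ ‖x₀‖ - t₀ ∧ ‖x₀‖ - t₀ ≤ t₀ + ‖x₀‖)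
    linarith
  set M := 2 + t₀ + ‖x₀‖ with hMdef
  set u := 1 + |‖x₀‖ - t₀| with hudef
  set E := √(wEnergy p 1 γ φ).toReal with hEdef
  have hE : 0 ≤ E := sqrt_nonneg _
  set e := (wEnergy p 0 γ φ).toReal with hedef
  have he : 0 ≤ e := ENNReal.toReal_nonneg
  have heE : e ^ (p / (p + 1)) ≤ B ^ (p / (p + 1) - 1 / 2) * E :=
    rpow_le_mul_sqrt he (ENNReal.toReal_le_of_le_ofReal hB.le hE0)
      (ENNReal.toReal_mono hE1.ne (wEnergy_zero_le_one p γ φ))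
      (by rw [div_le_div_iff₀ (by norm_num) (by linarith)]; linarith)
  have hT : (C₂ * (M ^ (1 - γ * p) * u ^ (1 - p))) ^ (1 / (p + 1)) ≤
      C₂ ^ (1 / (p + 1)) * (M ^ (-(decayExp p * γ)) * u ^ (-(γ / (p + 1)))) := by
    rw [mul_rpow hC₂.le (by positivity), mul_rpow (by positivity) (by positivity),
      ← rpow_mul hM0.le, ← rpow_mul hu0.le]
    have e1 : (1 - γ * p) * (1 / (p + 1)) = -((γ * p - 1) / (p + 1)) := by ring
    have e2 : (1 - p) * (1 / (p + 1)) = -((p - 1) / (p + 1)) := by ring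
    have hb : γ / (p + 1) ≤ (p - 1) / (p + 1) := by gcongr
    rw [e1, e2]
    have hs := decayExp_le_source hp2 hp4 hγ1
    exact mul_le_mul_of_nonneg_left (rpow_mul_rpow_le hu1 huM hs (by linarith)) (by positivity)
  have hL : M ^ (-1 : ℝ) * u ^ (-((γ - 1) / 4)) ≤ M ^ (-(decayExp p * γ)) * u ^ (-(γ / (p + 1))) :=
    rpow_mul_rpow_le hu1 huM ha1 (decayExp_add_le hp2 hp4 hγ1 hγ2)
  have hN := lintegral_coneSource_le hp0 hγ1.le (by linarith) hγ2.le hφ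
    (ne_top_of_le_ne_top ENNReal.ofReal_ne_top hE0) t₀ x₀ (measurableSet_coneOut t₀ x₀)
    (coneOut_subset t₀ x₀) (by positivity) (h₂ t₀ ht₀ x₀ hx₀)
  calc |psiLin p φ t₀ x₀| ≤ |linPart φ t₀ x₀| + (8 * (p + 1) * e) ^ (p / (p + 1)) *
        (C₂ * (M ^ (1 - γ * p) * u ^ (1 - p))) ^ (1 / (p + 1)) :=
        abs_psiLin_le hp0 hφ (measurableSet_coneOut t₀ x₀) subset_rfl (by positivity) hN
    _ ≤ C₁ * (M ^ (-(decayExp p * γ)) * u ^ (-(γ / (p + 1)))) * E +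
        (8 * (p + 1)) ^ (p / (p + 1)) * (B ^ (p / (p + 1) - 1 / 2) * E) *
        (C₂ ^ (1 / (p + 1)) * (M ^ (-(decayExp p * γ)) * u ^ (-(γ / (p + 1))))) := by
        refine add_le_add ((h₁ φ hφ hE1 t₀ ht₀ x₀ (by linarith)).trans ?_) ?_
        · exact mul_le_mul_of_nonneg_right (mul_le_mul_of_nonneg_left hL hC₁.le) hE
        · rw [mul_rpow (by positivity) he]
          exact mul_le_mul (mul_le_mul_of_nonneg_left heE (by positivity)) hT (by positivity)
            (by positivity)
    _ = _ := by ring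

/-- Pointwise decay inside the hyperboloidal region `D` for the
evolution `ψ` which is linear inside `D`, in the range `2 < p ≤ (1+√17)/2`,
`1 < γ₀ < p−1`, with `α_p = (3+(p−2)²)/((p+1)(5−p))`. -/
theorem nlw_linear_inside_D_decay_small_p (p γ₀ B : ℝ)
    (hp2 : 2 < p) (hp' : p ≤ (1 + Real.sqrt 17) / 2)
    (hγ₁ : 1 < γ₀) (hγ₂ : γ₀ < p - 1) (hB : 0 < B) :
    ∃ C : ℝ, 0 < C ∧ ∀ φ : ℝ → E3 → ℝ, IsNLWSolution p φ →
      wEnergy p 0 γ₀ φ ≤ ENNReal.ofReal B → wEnergy p 1 γ₀ φ < ⊤ →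
      ∀ t₀ : ℝ, 0 ≤ t₀ → ∀ x₀ : E3, (t₀, x₀) ∈ Dset →
        |psiLin p φ t₀ x₀|
          ≤ C * (2 + t₀ + ‖x₀‖) ^ (-((3 + (p - 2) ^ 2) / ((p + 1) * (5 - p)) * γ₀))
            * (1 + |‖x₀‖ - t₀|) ^ (-(γ₀ / (p + 1)))
            * Real.sqrt (wEnergy p 1 γ₀ φ).toReal := by
  have hp4 : p ^ 2 ≤ p + 4 := by
    have h17 := Real.sq_sqrt (show (0 : ℝ) ≤ 17 by norm_num)
    nlinarith [Real.sqrt_nonneg 17]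
  obtain ⟨C₁, hC₁, h₁⟩ := psiLin_decay_exterior hp2 hp4 hγ₁ hγ₂ hB
  obtain ⟨C₂, hC₂, h₂⟩ := psiLin_decay_interior hp2 hp4 hγ₁ hγ₂ hB
  refine ⟨max C₁ C₂, lt_max_of_lt_left hC₁, fun φ hφ hE0 hE1 t₀ ht₀ x₀ hD => ?_⟩
  rw [mul_assoc (max C₁ C₂)]
  have hnn : 0 ≤ 2 + t₀ + ‖x₀‖ := by positivity
  rcases le_or_gt (t₀ + 2) ‖x₀‖ with h | h
  · refine (h₁ φ hφ hE0 hE1 t₀ ht₀ x₀ hD h).trans ?_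
    unfold decayExp
    gcongr
    exact le_max_left _ _
  · refine (h₂ φ hφ hE0 hE1 t₀ ht₀ x₀ h).trans ?_
    unfold decayExp
    gcongr
    exact le_max_right _ _
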